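/- Assume the stated hypotheses on Ω and u, and let a ∈ ∂Ω be a GBU point. Then u_{νν}/u_ν^p → −1 near (a,T): for every ε > 0 there exists η > 0 such that |u_{νν}(x,t) + u_ν(x,t)^p| ≤ ε u_ν(x,t)^p for all x ∈ Ω_{δ₀} with |x − a| < η and all t ∈ (T − η, T). -/

import Mathlib

open Set Metric Filter RealInnerProductSpace

noncomputable section

set_option linter.unusedVariables false

/-- A set `Ω ⊆ ℝⁿ` has boundary of class `C²`: near each boundary point, `Ω` is the strict
sublevel set of a `C²` function with nonvanishing gradient (equivalently, after a rigid motion,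
the boundary is locally the graph of a `C²` function with `Ω` strictly on one side). -/
def IsC2Boundary {n : ℕ} (Ω : Set (EuclideanSpace ℝ (Fin n))) : Prop :=
  ∀ x ∈ frontier Ω, ∃ f : EuclideanSpace ℝ (Fin n) → ℝ, ∃ U ∈ nhds x,
    ContDiffOn ℝ 2 f U ∧ (∀ y ∈ U, fderiv ℝ f y ≠ 0) ∧
    U ∩ Ω = U ∩ {y | f y < 0} ∧ U ∩ frontier Ω = U ∩ {y | f y = 0}

set_option linter.unusedSectionVars false
set_option linter.unusedSimpArgs false

section JetCalc
variable {V : Type*} [NormedAddCommGroup V] [InnerProductSpace ℝ V] [FiniteDimensional ℝ V]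
  [CompleteSpace V]

/-- `v` is twice differentiable at `y` with gradient `g` and Laplacian `l`. -/
def Jet (v : V → ℝ) (y g : V) (l : ℝ) : Prop :=
  ∃ (G : V → V) (A : V →L[ℝ] V), (∀ᶠ z in nhds y, HasGradientAt v (G z) z) ∧ G y = g ∧
    HasFDerivAt G A y ∧ LinearMap.trace ℝ V (A : V →ₗ[ℝ] V) = l

theorem Jet.grad {v : V → ℝ} {y g : V} {l : ℝ} (h : Jet v y g l) : HasGradientAt v g y := by
  obtain ⟨G, A, h1, h2, h3, h4⟩ := h
  rw [← h2]; exact h1.self_of_nhds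

theorem Jet.congr {v : V → ℝ} {y g g' : V} {l l' : ℝ} (h : Jet v y g l) (hg : g = g')
    (hl : l = l') : Jet v y g' l' := hg ▸ hl ▸ h

theorem Jet.add {v w : V → ℝ} {y g g' : V} {l l' : ℝ} (h : Jet v y g l) (h' : Jet w y g' l') :
    Jet (fun z => v z + w z) y (g + g') (l + l') := by
  obtain ⟨G, A, h1, h2, h3, h4⟩ := h
  obtain ⟨G', A', h1', h2', h3', h4'⟩ := h'
  refine ⟨fun z => G z + G' z, A + A', ?_, by simp [h2, h2'], h3.add h3', by
    simp [h4, h4']⟩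
  filter_upwards [h1, h1'] with z hz hz'
  rw [hasGradientAt_iff_hasFDerivAt] at *
  rw [map_add]
  exact hz.add hz'

theorem Jet.const_mul {v : V → ℝ} {y g : V} {l : ℝ} (c : ℝ) (h : Jet v y g l) :
    Jet (fun z => c * v z) y (c • g) (c * l) := by
  obtain ⟨G, A, h1, h2, h3, h4⟩ := h
  refine ⟨fun z => c • G z, c • A, ?_, by simp [h2], h3.const_smul c, by
    simp [h4]⟩
  filter_upwards [h1] with z hz
  rw [hasGradientAt_iff_hasFDerivAt] at *
  exact (hz.const_mul c).congr_fderiv (by ext w; simp)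

theorem Jet.neg {v : V → ℝ} {y g : V} {l : ℝ} (h : Jet v y g l) :
    Jet (fun z => - v z) y (-g) (-l) := by
  have := h.const_mul (-1)
  simpa using this

theorem Jet.sub {v w : V → ℝ} {y g g' : V} {l l' : ℝ} (h : Jet v y g l) (h' : Jet w y g' l') :
    Jet (fun z => v z - w z) y (g - g') (l - l') := by
  have := h.add h'.neg
  simpa [sub_eq_add_neg] using this

theorem Jet.const (c : ℝ) (y : V) : Jet (fun _ : V => c) y 0 0 := by
  refine ⟨fun _ => 0, 0, ?_, rfl, hasFDerivAt_const _ _, by simp⟩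
  filter_upwards with z
  rw [hasGradientAt_iff_hasFDerivAt]
  simpa using hasFDerivAt_const c z

theorem Jet.linear (b ν y : V) : Jet (fun z : V => ⟪z - b, ν⟫) y ν 0 := by
  refine ⟨fun _ => ν, 0, ?_, rfl, hasFDerivAt_const _ _, by simp⟩
  filter_upwards with z
  rw [hasGradientAt_iff_hasFDerivAt]
  have h2 : HasFDerivAt (fun z : V => z - b) (ContinuousLinearMap.id ℝ V) z :=
    (hasFDerivAt_id z).sub_const b
  exact (h2.inner ℝ (hasFDerivAt_const ν z)).congr_fderiv (by
    ext w; simp [real_inner_comm])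

theorem Jet.normsq (b y : V) :
    Jet (fun z : V => ‖z - b‖ ^ 2) y ((2:ℝ) • (y - b)) (2 * Module.finrank ℝ V) := by
  refine ⟨fun z => (2:ℝ) • (z - b), (2:ℝ) • ContinuousLinearMap.id ℝ V, ?_, rfl, ?_, ?_⟩
  · filter_upwards with z
    rw [hasGradientAt_iff_hasFDerivAt]
    have h2 : HasFDerivAt (fun z : V => z - b) (ContinuousLinearMap.id ℝ V) z :=
      (hasFDerivAt_id z).sub_const b
    exact h2.norm_sq.congr_fderiv (by ext w; simp [inner_smul_left])
  · exact ((hasFDerivAt_id y).sub_const b).const_smul (2:ℝ)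
  · simp

theorem trace_outer (g g' : V) :
    LinearMap.trace ℝ V ((((InnerProductSpace.toDual ℝ V g).smulRight g' : V →L[ℝ] V)) :
      V →ₗ[ℝ] V) = ⟪g, g'⟫ := by
  rw [LinearMap.trace_eq_sum_inner _ (stdOrthonormalBasis ℝ V)]
  simp only [ContinuousLinearMap.coe_coe, ContinuousLinearMap.smulRight_apply,
    InnerProductSpace.toDual_apply_apply, inner_smul_right]
  rw [← OrthonormalBasis.sum_inner_mul_inner (stdOrthonormalBasis ℝ V) g g']

theorem Jet.comp {v : V → ℝ} {y g : V} {l : ℝ} (h : Jet v y g l) {η η' : ℝ → ℝ} {c : ℝ}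
    (h1 : ∀ᶠ x in nhds (v y), HasDerivAt η (η' x) x) (h2 : HasDerivAt η' c (v y)) :
    Jet (fun z => η (v z)) y (η' (v y) • g) (η' (v y) * l + c * ‖g‖ ^ 2) := by
  have hg := h.grad
  obtain ⟨G, A, k1, k2, k3, k4⟩ := h
  have hc : ContinuousAt v y := hg.hasFDerivAt.continuousAt
  refine ⟨fun z => η' (v z) • G z, η' (v y) • A +
    (InnerProductSpace.toDual ℝ V (c • g)).smulRight g, ?_, by simp [k2], ?_, ?_⟩
  · filter_upwards [k1, hc.eventually h1] with z hz hz'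
    rw [hasGradientAt_iff_hasFDerivAt] at *
    exact (hz'.comp_hasFDerivAt z hz).congr_fderiv (by ext w; simp [inner_smul_left])
  · have e1 : HasFDerivAt (fun z => η' (v z)) (c • InnerProductSpace.toDual ℝ V g) y := by
      have := h2.comp_hasFDerivAt y hg.hasFDerivAt
      exact this
    exact (e1.smul k3).congr_fderiv (by ext w; simp [k2, inner_smul_left])
  · rw [ContinuousLinearMap.toLinearMap_add, map_add, trace_outer, ContinuousLinearMap.toLinearMap_smul, map_smul,
      k4, inner_smul_left, real_inner_self_eq_norm_sq]
    simp

theorem Jet.mul {v w : V → ℝ} {y g g' : V} {l l' : ℝ} (h : Jet v y g l) (h' : Jet w y g' l') :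
    Jet (fun z => v z * w z) y (v y • g' + w y • g) (v y * l' + w y * l + 2 * ⟪g, g'⟫) := by
  have hd : ∀ x : ℝ, HasDerivAt (fun x : ℝ => x ^ 2) (2 * x) x := fun x => by
    simpa using hasDerivAt_pow 2 x
  have hd2 : ∀ x : ℝ, HasDerivAt (fun x : ℝ => 2 * x) 2 x := fun x => by
    simpa using (hasDerivAt_id x).const_mul 2
  have s1 := (h.add h').comp (Eventually.of_forall hd) (hd2 _)
  have s2 := (h.sub h').comp (Eventually.of_forall hd) (hd2 _)
  have := (s1.sub s2).const_mul (1/4)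
  have e : (fun z => v z * w z) = fun z => (1/4) * ((v z + w z)^2 - (v z - w z)^2) := by
    ext z; ring
  rw [e]
  refine this.congr ?_ ?_
  · module
  · have a1 := norm_add_sq_real g g'
    have a2 := norm_sub_sq_real g g'
    rw [a1, a2]; ring

theorem Jet.coisom {W : Type*} [NormedAddCommGroup W] [InnerProductSpace ℝ W]
    [FiniteDimensional ℝ W] [CompleteSpace W] {v : V → ℝ} {g : V} {l : ℝ} (L : W →L[ℝ] V) (c : V)
    (y : W) (hL : ∀ x, L (ContinuousLinearMap.adjoint L x) = x) (h : Jet v (L y + c) g l) :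
    Jet (fun z => v (L z + c)) y (ContinuousLinearMap.adjoint L g) l := by
  obtain ⟨G, A, k1, k2, k3, k4⟩ := h
  have hLd : ∀ z, HasFDerivAt (fun z => L z + c) L z := fun z => L.hasFDerivAt.add_const c
  refine ⟨fun z => ContinuousLinearMap.adjoint L (G (L z + c)),
    (ContinuousLinearMap.adjoint L).comp (A.comp L), ?_, by simp [k2], ?_, ?_⟩
  · filter_upwards [(hLd y).continuousAt.eventually k1] with z hz
    rw [hasGradientAt_iff_hasFDerivAt] at *
    exact (hz.comp z (hLd z)).congr_fderiv (by
      ext w; simp [ContinuousLinearMap.adjoint_inner_left])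
  · exact ((ContinuousLinearMap.adjoint L).hasFDerivAt).comp y (k3.comp y (hLd y))
  · rw [← k4, ContinuousLinearMap.toLinearMap_comp, ContinuousLinearMap.toLinearMap_comp,
      LinearMap.trace_comp_comm', LinearMap.comp_assoc]
    congr 1
    ext x
    simp [hL]

theorem Jet.congr_fun {v w : V → ℝ} {y g : V} {l : ℝ} (h : Jet v y g l)
    (e : ∀ᶠ z in nhds y, w z = v z) : Jet w y g l := by
  obtain ⟨G, A, h1, h2, h3, h4⟩ := h
  refine ⟨G, A, ?_, h2, h3, h4⟩
  filter_upwards [h1, e.eventually_nhds] with z hz he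
  rw [hasGradientAt_iff_hasFDerivAt] at *
  exact hz.congr_of_eventuallyEq he

theorem second_test {f f' : ℝ → ℝ} {c : ℝ} (h1 : ∀ᶠ s in nhds (0:ℝ), HasDerivAt f (f' s) s)
    (h2 : HasDerivAt f' c 0) (hm : IsLocalMax f 0) : c ≤ 0 := by
  by_contra hc
  push Not at hc
  have h0 : f' 0 = 0 := hm.hasDerivAt_eq_zero h1.self_of_nhds
  have e1 : ∀ᶠ s in nhds (0:ℝ), deriv f s = f' s := by
    filter_upwards [h1] with s hs using hs.deriv
  have d1 : deriv (deriv f) 0 = c := by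
    rw [Filter.EventuallyEq.deriv_eq e1, h2.deriv]
  have hmin : IsLocalMin f 0 := by
    apply isLocalMin_of_deriv_deriv_pos
    · rw [d1]; exact hc
    · rw [e1.self_of_nhds, h0]
    · exact h1.self_of_nhds.continuousAt
  have hconst : ∀ᶠ s in nhds (0:ℝ), f s = f 0 := by
    filter_upwards [hm, hmin] with s a b using le_antisymm a b
  have e2 : ∀ᶠ s in nhds (0:ℝ), f' s = 0 := by
    filter_upwards [hconst.eventually_nhds, h1] with s hs h1s
    have : HasDerivAt f 0 s := (hasDerivAt_const s (f 0)).congr_of_eventuallyEq hs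
    exact h1s.unique this
  have : HasDerivAt f' 0 0 := (hasDerivAt_const (0:ℝ) (0:ℝ)).congr_of_eventuallyEq e2
  exact hc.ne' (h2.unique this)

theorem Jet.isLocalMax {v : V → ℝ} {y g : V} {l : ℝ} (h : Jet v y g l) (hm : IsLocalMax v y) :
    g = 0 ∧ l ≤ 0 := by
  have hg := h.grad
  refine ⟨?_, ?_⟩
  · have := hm.hasFDerivAt_eq_zero hg.hasFDerivAt
    simpa using this
  · obtain ⟨G, A, k1, k2, k3, k4⟩ := h
    rw [← k4, LinearMap.trace_eq_sum_inner _ (stdOrthonormalBasis ℝ V)]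
    apply Finset.sum_nonpos
    intro i _
    set e := stdOrthonormalBasis ℝ V i
    have hl : ∀ s : ℝ, HasDerivAt (fun s : ℝ => y + s • e) e s := fun s => by
      simpa using ((hasDerivAt_id s).smul_const e).const_add y
    have hl0 : Tendsto (fun s : ℝ => y + s • e) (nhds 0) (nhds y) := by
      have := (hl 0).continuousAt.tendsto
      simpa using this
    apply second_test (f := fun s => v (y + s • e)) (f' := fun s => ⟪e, G (y + s • e)⟫)
    · filter_upwards [hl0.eventually k1] with s hs
      have := hs.hasFDerivAt.comp_hasDerivAt s (hl s)
      have e2 : (InnerProductSpace.toDual ℝ V (G (y + s • e))) e = ⟪e, G (y + s • e)⟫ := by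
        simp [real_inner_comm]
      rw [e2] at this
      exact this
    · have k3' : HasFDerivAt G A (y + (0:ℝ) • e) := by simpa using k3
      have := (hasDerivAt_const (0:ℝ) e).inner ℝ (k3'.comp_hasDerivAt 0 (hl 0))
      simpa using this
    · have := hl0.eventually hm
      simpa [IsLocalMax, IsMaxFilter] using this

theorem ell_max {K : Set V} (hK : IsCompact K) {Φ : V → ℝ} (hc : ContinuousOn Φ K)
    (h : ∀ y ∈ K, 0 < Φ y → K ∈ nhds y ∧ ∃ g l, Jet Φ y g l ∧ (g = 0 → 0 < l)) :
    ∀ y ∈ K, Φ y ≤ 0 := by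
  intro y hy
  obtain ⟨y0, hy0, hmax⟩ := hK.exists_isMaxOn ⟨y, hy⟩ hc
  by_contra hcon
  push Not at hcon
  have hpos : 0 < Φ y0 := lt_of_lt_of_le hcon (hmax hy)
  obtain ⟨hn, g, l, hj, hl⟩ := h y0 hy0 hpos
  have := hj.isLocalMax (hmax.isLocalMax hn)
  linarith [hl this.1, this.2]

theorem deriv_nonneg_of_left_max {f : ℝ → ℝ} {t d : ℝ} (h : HasDerivAt f d t)
    (hm : ∀ᶠ s in nhdsWithin t (Iio t), f s ≤ f t) : 0 ≤ d := by
  have := h.hasDerivWithinAt (s := Iio t)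
  rw [hasDerivWithinAt_iff_tendsto_slope' (by simp)] at this
  apply ge_of_tendsto this
  filter_upwards [hm, self_mem_nhdsWithin] with s hs hst
  rw [slope_def_field]
  apply div_nonneg_of_nonpos
  · linarith
  · have : s < t := hst
    linarith

theorem par_max {K : Set (V × ℝ)} (hK : IsCompact K) {Φ : V → ℝ → ℝ}
    (hc : ContinuousOn (fun q : V × ℝ => Φ q.1 q.2) K)
    (h : ∀ y t, (y, t) ∈ K → 0 < Φ y t → (∀ᶠ z in nhds y, (z, t) ∈ K) ∧
      (∀ᶠ s in nhdsWithin t (Iio t), (y, s) ∈ K) ∧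
      ∃ g l d, Jet (fun z => Φ z t) y g l ∧ HasDerivAt (Φ y) d t ∧ (g = 0 → d < l)) :
    ∀ y t, (y, t) ∈ K → Φ y t ≤ 0 := by
  intro y t hy
  obtain ⟨⟨y0, t0⟩, hy0, hmax⟩ := hK.exists_isMaxOn ⟨(y, t), hy⟩ hc
  by_contra hcon
  push Not at hcon
  have hpos : 0 < Φ y0 t0 := lt_of_lt_of_le hcon (hmax hy)
  obtain ⟨hn, hn2, g, l, d, hj, hd, hl⟩ := h y0 t0 hy0 hpos
  have a1 := hj.isLocalMax (by
    filter_upwards [hn] with z hz using hmax hz)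
  have a2 := deriv_nonneg_of_left_max hd (by
    filter_upwards [hn2] with z hz using hmax hz)
  linarith [hl a1.1, a1.2]
end JetCalc


section ParCalc
variable {V : Type*} [NormedAddCommGroup V] [InnerProductSpace ℝ V] [FiniteDimensional ℝ V]
  [CompleteSpace V]

/-- `z` solves `z_t - Δz = f` on `K`, with gradient `G`. -/
def Par (z : V → ℝ → ℝ) (G : V → ℝ → V) (f : V → ℝ → ℝ) (K : Set (V × ℝ)) : Prop :=
  ContinuousOn (fun q : V × ℝ => z q.1 q.2) K ∧ ContinuousOn (fun q : V × ℝ => G q.1 q.2) K ∧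
  ∀ y t, (y, t) ∈ K → ∃ l d, Jet (fun x => z x t) y (G y t) l ∧ HasDerivAt (z y) d t ∧
    d - l = f y t

theorem Par.mono {z : V → ℝ → ℝ} {G : V → ℝ → V} {f : V → ℝ → ℝ} {K K' : Set (V × ℝ)}
    (h : Par z G f K) (hK : K' ⊆ K) : Par z G f K' :=
  ⟨h.1.mono hK, h.2.1.mono hK, fun y t hy => h.2.2 y t (hK hy)⟩

theorem Par.sub {z z' : V → ℝ → ℝ} {G G' : V → ℝ → V} {f f' : V → ℝ → ℝ} {K : Set (V × ℝ)}
    (h : Par z G f K) (h' : Par z' G' f' K) :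
    Par (fun y t => z y t - z' y t) (fun y t => G y t - G' y t) (fun y t => f y t - f' y t) K := by
  refine ⟨h.1.sub h'.1, h.2.1.sub h'.2.1, fun y t hy => ?_⟩
  obtain ⟨l, d, h1, h2, h3⟩ := h.2.2 y t hy
  obtain ⟨l', d', h1', h2', h3'⟩ := h'.2.2 y t hy
  exact ⟨l - l', d - d', h1.sub h1', h2.sub h2', by simp only [← h3, ← h3']; ring⟩

theorem Par.const_mul {z : V → ℝ → ℝ} {G : V → ℝ → V} {f : V → ℝ → ℝ} {K : Set (V × ℝ)}
    (c : ℝ) (h : Par z G f K) :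
    Par (fun y t => c * z y t) (fun y t => c • G y t) (fun y t => c * f y t) K := by
  refine ⟨continuousOn_const.mul h.1, continuousOn_const.smul h.2.1, fun y t hy => ?_⟩
  obtain ⟨l, d, h1, h2, h3⟩ := h.2.2 y t hy
  exact ⟨c * l, c * d, h1.const_mul c, h2.const_mul c, by simp only [← h3]; ring⟩

theorem Par.coisom {z : V → ℝ → ℝ} {G : V → ℝ → V} {f : V → ℝ → ℝ} {K K' : Set (V × ℝ)}
    (h : Par z G f K) (L : V →L[ℝ] V) (c : V)
    (hL : ∀ x, L (ContinuousLinearMap.adjoint L x) = x)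
    (hK : ∀ y t, (y, t) ∈ K' → (L y + c, t) ∈ K) :
    Par (fun y t => z (L y + c) t) (fun y t => ContinuousLinearMap.adjoint L (G (L y + c) t))
      (fun y t => f (L y + c) t) K' := by
  have hc : ContinuousOn (fun q : V × ℝ => (L q.1 + c, q.2)) K' := by fun_prop
  have hm : MapsTo (fun q : V × ℝ => (L q.1 + c, q.2)) K' K := fun q hq => hK q.1 q.2 hq
  refine ⟨h.1.comp hc hm, (ContinuousLinearMap.continuous _).comp_continuousOn (h.2.1.comp hc hm),
    fun y t hy => ?_⟩
  obtain ⟨l, d, h1, h2, h3⟩ := h.2.2 _ t (hK y t hy)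
  exact ⟨l, d, h1.coisom L c y hL, h2, h3⟩

theorem Par.shift {z : V → ℝ → ℝ} {G : V → ℝ → V} {f : V → ℝ → ℝ} {K K' : Set (V × ℝ)}
    (h : Par z G f K) (c : V) (hK : ∀ y t, (y, t) ∈ K' → (y + c, t) ∈ K) :
    Par (fun y t => z (y + c) t) (fun y t => G (y + c) t) (fun y t => f (y + c) t) K' := by
  have hadj : ContinuousLinearMap.adjoint (ContinuousLinearMap.id ℝ V)
      = ContinuousLinearMap.id ℝ V := by
    symm
    rw [ContinuousLinearMap.eq_adjoint_iff]
    simp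
  have := h.coisom (ContinuousLinearMap.id ℝ V) c (by intro x; rw [hadj]; rfl) hK
  simpa [hadj] using this

/-- Linear reflection in the hyperplane orthogonal to `e`. -/
def rfn (e : V) : V →L[ℝ] V :=
  ContinuousLinearMap.id ℝ V - (2:ℝ) • (InnerProductSpace.toDual ℝ V e).smulRight e

theorem rfn_apply (e x : V) : rfn e x = x - (2 * ⟪e, x⟫) • e := by
  simp [rfn, smul_smul]

theorem rfn_adj (e : V) : ContinuousLinearMap.adjoint (rfn e) = rfn e := by
  symm
  rw [ContinuousLinearMap.eq_adjoint_iff]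
  intro x y
  simp only [rfn_apply, inner_sub_left, inner_sub_right, inner_smul_left, inner_smul_right]
  simp [real_inner_comm]
  ring

theorem rfn_rfn (e : V) (he : ‖e‖ = 1) (x : V) : rfn e (rfn e x) = x := by
  simp only [rfn_apply, inner_sub_right, inner_smul_right, real_inner_self_eq_norm_sq, he]
  module

theorem rfn_co (e : V) (he : ‖e‖ = 1) (x : V) : rfn e (ContinuousLinearMap.adjoint (rfn e) x) = x := by
  rw [rfn_adj, rfn_rfn e he]

theorem rfn_norm (e : V) (he : ‖e‖ = 1) (x : V) : ‖rfn e x‖ = ‖x‖ := by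
  have : ‖rfn e x‖ ^ 2 = ‖x‖ ^ 2 := by
    rw [← real_inner_self_eq_norm_sq, ← real_inner_self_eq_norm_sq,
      ← ContinuousLinearMap.adjoint_inner_right, rfn_adj, rfn_rfn e he]
  exact (sq_eq_sq₀ (norm_nonneg _) (norm_nonneg _)).1 this

/-- half-cylinder barrier -/
theorem lemT0 {w : V → ℝ → ℝ} {Gw : V → ℝ → V} {f : V → ℝ → ℝ} {x0 e : V} (he : ‖e‖ = 1)
    {R t0 S g K : ℝ} (hR : 0 < R) (hS : 0 ≤ S) (hg : 0 ≤ g)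
    (hw : Par w Gw f (closedBall x0 R ×ˢ Icc (t0 - R ^ 2) t0))
    (h0 : ∀ y ∈ closedBall x0 R, ∀ t ∈ Icc (t0 - R ^ 2) t0, ⟪y - x0, e⟫ = 0 → w y t ≤ 0)
    (h1 : ∀ y ∈ closedBall x0 R, ∀ t ∈ Icc (t0 - R ^ 2) t0, 0 ≤ ⟪y - x0, e⟫ → w y t ≤ 2 * S)
    (h2 : ∀ y ∈ closedBall x0 R, ∀ t ∈ Icc (t0 - R ^ 2) t0, 0 ≤ ⟪y - x0, e⟫ → f y t ≤ 2 * g)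
    (hK : (4 * Module.finrank ℝ V + 2) * S / R + 2 * g * R < K) :
    ∀ ξ, 0 ≤ ξ → ξ ≤ R → w (x0 + ξ • e) t0 ≤ K * ξ + 2 * S * ξ ^ 2 / R ^ 2 := by
  set n : ℝ := (Module.finrank ℝ V : ℝ)
  have hn : 0 ≤ n := by positivity
  have hKpos : 0 < K := lt_of_le_of_lt (by positivity) hK
  set ψ : V → ℝ → ℝ := fun y t => (2 * S / R ^ 2) * (‖y - x0‖ ^ 2) +
    (2 * S / R ^ 2) * (t0 - t) + (K * ⟪y - x0, e⟫ - K / (2 * R) * ⟪y - x0, e⟫ ^ 2) with hψ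
  set KK : Set (V × ℝ) := {q | q.1 ∈ closedBall x0 R ∧ q.2 ∈ Icc (t0 - R ^ 2) t0 ∧
    0 ≤ ⟪q.1 - x0, e⟫} with hKK
  have hKKsub : KK ⊆ closedBall x0 R ×ˢ Icc (t0 - R ^ 2) t0 := fun q hq => ⟨hq.1, hq.2.1⟩
  have hKKc : IsCompact KK := by
    apply ((isCompact_closedBall x0 R).prod isCompact_Icc).of_isClosed_subset _ hKKsub
    apply IsClosed.inter (isClosed_closedBall.preimage continuous_fst)
    apply IsClosed.inter (isClosed_Icc.preimage continuous_snd)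
    exact isClosed_le (f := fun _ : V × ℝ => (0:ℝ)) (g := fun q : V × ℝ => ⟪q.1 - x0, e⟫)
      continuous_const (by fun_prop)
  have hξle : ∀ y ∈ closedBall x0 R, ⟪y - x0, e⟫ ≤ R := fun y hy => by
    have := real_inner_le_norm (y - x0) e
    rw [he, mul_one] at this
    exact this.trans (by simpa [dist_eq_norm] using hy)
  have hquad : ∀ ξ, 0 ≤ ξ → ξ ≤ R → 0 ≤ K * ξ - K / (2 * R) * ξ ^ 2 := fun ξ hξ hξR => by
    have : K * ξ - K / (2 * R) * ξ ^ 2 = K * ξ * (2 * R - ξ) / (2 * R) := by field_simp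
    rw [this]
    have : 0 ≤ 2 * R - ξ := by linarith
    positivity
  have main := par_max hKKc (Φ := fun y t => w y t - ψ y t) (by
    apply (hw.1.mono hKKsub).sub
    simp only [hψ]
    fun_prop) (by
    intro y t hyt hpos
    obtain ⟨hy, ht, hξ⟩ := hyt
    simp only at hy ht hξ
    have hq := hquad _ hξ (hξle y hy)
    have hw1 := h1 y hy t ht hξ
    have hA : 0 ≤ 2 * S / R ^ 2 := by positivity
    have hyn : ‖y - x0‖ ≤ R := by simpa [dist_eq_norm] using hy
    have hAR : 2 * S / R ^ 2 * R ^ 2 = 2 * S := by field_simp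
    have htt := ht.2
    have hξ0 : 0 < ⟪y - x0, e⟫ := by
      rcases hξ.lt_or_eq with h | h
      · exact h
      · exfalso
        have := h0 y hy t ht h.symm
        have a1 : 0 ≤ (2 * S / R ^ 2) * (‖y - x0‖ ^ 2) := by positivity
        have a2 : 0 ≤ (2 * S / R ^ 2) * (t0 - t) := mul_nonneg hA (by linarith)
        simp only [hψ] at hpos
        linarith
    have hyR : ‖y - x0‖ < R := by
      by_contra hcon
      have : ‖y - x0‖ = R := le_antisymm hyn (not_lt.1 hcon)
      have a2 : 0 ≤ (2 * S / R ^ 2) * (t0 - t) := mul_nonneg hA (by linarith)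
      simp only [hψ, this] at hpos
      linarith
    have htR : t0 - R ^ 2 < t := by
      by_contra hcon
      have : t = t0 - R ^ 2 := le_antisymm (not_lt.1 hcon) ht.1
      have a1 : 0 ≤ (2 * S / R ^ 2) * (‖y - x0‖ ^ 2) := by positivity
      simp only [hψ, this, sub_sub_cancel] at hpos
      subst this
      linarith
    refine ⟨?_, ?_, ?_⟩
    · have o1 : ∀ᶠ z in nhds y, z ∈ ball x0 R :=
        isOpen_ball.mem_nhds (by simpa [dist_eq_norm] using hyR)
      have o2 : ∀ᶠ z in nhds y, 0 < ⟪z - x0, e⟫ :=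
        (isOpen_lt continuous_const (by fun_prop)).mem_nhds hξ0
      filter_upwards [o1, o2] with z hz hz2
      exact ⟨ball_subset_closedBall hz, ht, hz2.le⟩
    · filter_upwards [Ioo_mem_nhdsLT htR] with s hs
      exact ⟨hy, ⟨hs.1.le, hs.2.le.trans ht.2⟩, hξ⟩
    · obtain ⟨l, d, j1, j2, j3⟩ := hw.2.2 y t ⟨hy, ht⟩
      have jl := Jet.linear x0 e y
      have jn := Jet.normsq x0 y
      have jsq := jl.mul jl
      have jψ := ((jn.const_mul (2 * S / R ^ 2)).add (Jet.const ((2 * S / R ^ 2) * (t0 - t)) y)).add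
        ((jl.const_mul K).sub (jsq.const_mul (K / (2 * R))))
      have jψ' := jψ.congr_fun (w := fun z => ψ z t) (by
        filter_upwards with z
        simp only [hψ]; ring)
      have dψ : HasDerivAt (ψ y) (-(2 * S / R ^ 2)) t := by
        have := (((hasDerivAt_id t).const_sub t0).const_mul (2 * S / R ^ 2)).const_add
          ((2 * S / R ^ 2) * (‖y - x0‖ ^ 2)) |>.add_const
          (K * ⟪y - x0, e⟫ - K / (2 * R) * ⟪y - x0, e⟫ ^ 2)
        have e0 : 2 * S / R ^ 2 * -1 = -(2 * S / R ^ 2) := by ring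
        rw [← e0]
        exact this
      refine ⟨_, _, _, j1.sub jψ', j2.sub dψ, fun _ => ?_⟩
      have hf := h2 y hy t ht hξ
      rw [← j3] at hf
      simp only [real_inner_self_eq_norm_sq, he]
      have e1 : 2 * S / R ^ 2 + (2 * S / R ^ 2 * (2 * n) + 0 + (K * 0 - K / (2 * R) *
          (⟪y - x0, e⟫ * 0 + ⟪y - x0, e⟫ * 0 + 2 * 1 ^ 2)))
          = ((4 * n + 2) * S / R - K) / R := by
        field_simp; ring
      have e2 : ((4 * n + 2) * S / R - K) / R < -(2 * g) := by
        rw [div_lt_iff₀ hR]; linarith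
      linarith)
  intro ξ hξ hξR
  have hin : (x0 + ξ • e, t0) ∈ KK := by
    refine ⟨?_, ⟨by simp only; nlinarith, le_refl _⟩, ?_⟩
    · simp [dist_eq_norm, norm_smul, he, abs_of_nonneg hξ, hξR]
    · simp [inner_smul_left, real_inner_self_eq_norm_sq, he, hξ]
  have := main _ _ hin
  simp only [hψ, add_sub_cancel_left, norm_smul, he, inner_smul_left, real_inner_self_eq_norm_sq,
    sub_self] at this
  simp only [Real.norm_eq_abs, mul_one, sq_abs, mul_zero, add_zero, one_pow, conj_trivial] at this
  have h3 : 0 ≤ K / (2 * R) * ξ ^ 2 := by positivity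
  have h4 : 2 * S / R ^ 2 * ξ ^ 2 = 2 * S * ξ ^ 2 / R ^ 2 := by ring
  linarith

theorem lemT {z : V → ℝ → ℝ} {G : V → ℝ → V} {f : V → ℝ → ℝ} {x0 e : V} (he : ‖e‖ = 1)
    {R t0 S g : ℝ} (hR : 0 < R) (hS : 0 ≤ S) (hg : 0 ≤ g)
    (hz : Par z G f (closedBall x0 R ×ˢ Icc (t0 - R ^ 2) t0))
    (h1 : ∀ y ∈ closedBall x0 R, ∀ t ∈ Icc (t0 - R ^ 2) t0,
      z y t - z (y - (2 * ⟪e, y - x0⟫) • e) t ≤ 2 * S)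
    (h2 : ∀ y ∈ closedBall x0 R, ∀ t ∈ Icc (t0 - R ^ 2) t0,
      f y t - f (y - (2 * ⟪e, y - x0⟫) • e) t ≤ 2 * g) :
    ⟪G x0 t0, e⟫ ≤ (2 * Module.finrank ℝ V + 1) * S / R + g * R := by
  set n : ℝ := (Module.finrank ℝ V : ℝ)
  have hσ : ∀ y, rfn e y + (x0 - rfn e x0) = y - (2 * ⟪e, y - x0⟫) • e := fun y => by
    simp only [rfn_apply, inner_sub_right]; module
  have hσK : ∀ y t, (y, t) ∈ closedBall x0 R ×ˢ Icc (t0 - R ^ 2) t0 →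
      (rfn e y + (x0 - rfn e x0), t) ∈ closedBall x0 R ×ˢ Icc (t0 - R ^ 2) t0 := by
    rintro y t ⟨hy, ht⟩
    refine ⟨?_, ht⟩
    have : rfn e y + (x0 - rfn e x0) - x0 = rfn e (y - x0) := by rw [map_sub]; abel
    simp only [mem_closedBall, dist_eq_norm] at hy ⊢
    rw [this, rfn_norm e he]; exact hy
  have hw := hz.sub (hz.coisom (rfn e) (x0 - rfn e x0) (rfn_co e he) hσK)
  have key : ∀ K, (4 * n + 2) * S / R + 2 * g * R < K → ∀ ξ, 0 ≤ ξ → ξ ≤ R →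
      z (x0 + ξ • e) t0 - z (x0 + (-ξ) • e) t0 ≤ K * ξ + 2 * S * ξ ^ 2 / R ^ 2 := by
    intro K hK ξ hξ hξR
    have := lemT0 he hR hS hg hw (by
      intro y hy t ht h0
      simp only [hσ]
      rw [real_inner_comm, h0]; simp) (by
      intro y hy t ht _
      simp only [hσ]
      exact h1 y hy t ht) (by
      intro y hy t ht _
      simp only [hσ]
      exact h2 y hy t ht) hK ξ hξ hξR
    simp only [hσ] at this
    have e1 : x0 + ξ • e - (2 * ⟪e, x0 + ξ • e - x0⟫) • e = x0 + (-ξ) • e := by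
      simp only [add_sub_cancel_left, inner_smul_right, real_inner_self_eq_norm_sq, he]
      module
    rwa [e1] at this
  -- derivative
  obtain ⟨l, d, hj, -, -⟩ := hz.2.2 x0 t0 ⟨mem_closedBall_self hR.le, by
    constructor <;> nlinarith⟩
  have hD : HasDerivAt (fun ξ : ℝ => z (x0 + ξ • e) t0 - z (x0 + (-ξ) • e) t0)
      (2 * ⟪G x0 t0, e⟫) 0 := by
    have hl : HasDerivAt (fun s : ℝ => x0 + s • e) e 0 := by
      simpa using ((hasDerivAt_id (0:ℝ)).smul_const e).const_add x0
    have hl' : HasDerivAt (fun s : ℝ => x0 + (-s) • e) (-e) 0 := by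
      simpa using ((hasDerivAt_id (0:ℝ)).neg.smul_const e).const_add x0
    have hg1 : HasFDerivAt (fun x => z x t0) (InnerProductSpace.toDual ℝ V (G x0 t0))
        (x0 + (0:ℝ) • e) := by simpa using hj.grad.hasFDerivAt
    have hg2 : HasFDerivAt (fun x => z x t0) (InnerProductSpace.toDual ℝ V (G x0 t0))
        (x0 + (-(0:ℝ)) • e) := by simpa using hj.grad.hasFDerivAt
    have := (hg1.comp_hasDerivAt (0:ℝ) hl).sub (hg2.comp_hasDerivAt (0:ℝ) hl')
    have e3 : (InnerProductSpace.toDual ℝ V (G x0 t0)) e -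
      (InnerProductSpace.toDual ℝ V (G x0 t0)) (-e) = 2 * ⟪G x0 t0, e⟫ := by
      simp; ring
    rw [e3] at this
    exact this
  have hlim := hD.hasDerivWithinAt (s := Ioi 0)
  rw [hasDerivWithinAt_iff_tendsto_slope' (by simp)] at hlim
  have : ∀ K, (4 * n + 2) * S / R + 2 * g * R < K → 2 * ⟪G x0 t0, e⟫ ≤ K := by
    intro K hK
    have lim2 : Tendsto (fun ξ : ℝ => K + 2 * S * ξ / R ^ 2) (nhdsWithin 0 (Ioi 0)) (nhds K) := by
      have : Continuous (fun ξ : ℝ => K + 2 * S * ξ / R ^ 2) := by fun_prop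
      have := this.tendsto 0
      simp only [mul_zero, zero_div, add_zero] at this
      exact this.mono_left nhdsWithin_le_nhds
    apply le_of_tendsto_of_tendsto hlim lim2
    filter_upwards [Ioo_mem_nhdsGT hR] with ξ hξ
    rw [slope_def_field]
    simp only [neg_zero, zero_smul, sub_self, sub_zero]
    rw [div_le_iff₀ hξ.1]
    have := key K hK ξ hξ.1.le hξ.2.le
    have e4 : (K + 2 * S * ξ / R ^ 2) * ξ = K * ξ + 2 * S * ξ ^ 2 / R ^ 2 := by ring
    linarith
  have := le_of_forall_gt_imp_ge_of_dense this
  have e5 : (4 * n + 2) * S / R + 2 * g * R = 2 * ((2 * n + 1) * S / R + g * R) := by ring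
  linarith

/-- norm version -/
theorem lemT' {z : V → ℝ → ℝ} {G : V → ℝ → V} {f : V → ℝ → ℝ} {x0 : V}
    {R t0 S g : ℝ} (hR : 0 < R)
    (hz : Par z G f (closedBall x0 R ×ˢ Icc (t0 - R ^ 2) t0))
    (h1 : ∀ y ∈ closedBall x0 R, ∀ t ∈ Icc (t0 - R ^ 2) t0, |z y t| ≤ S)
    (h2 : ∀ y ∈ closedBall x0 R, ∀ t ∈ Icc (t0 - R ^ 2) t0, |f y t| ≤ g) :
    ‖G x0 t0‖ ≤ (2 * Module.finrank ℝ V + 1) * S / R + g * R := by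
  have hx0 : x0 ∈ closedBall x0 R := mem_closedBall_self hR.le
  have ht0 : t0 ∈ Icc (t0 - R ^ 2) t0 := by constructor <;> nlinarith
  have hS : 0 ≤ S := (abs_nonneg _).trans (h1 x0 hx0 t0 ht0)
  have hg : 0 ≤ g := (abs_nonneg _).trans (h2 x0 hx0 t0 ht0)
  by_cases hG : G x0 t0 = 0
  · rw [hG, norm_zero]; positivity
  set e : V := (‖G x0 t0‖)⁻¹ • G x0 t0
  have hne : ‖G x0 t0‖ ≠ 0 := norm_ne_zero_iff.2 hG
  have he : ‖e‖ = 1 := by simp [e, norm_smul, hne]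
  have hin : ∀ y ∈ closedBall x0 R, y - (2 * ⟪e, y - x0⟫) • e ∈ closedBall x0 R := fun y hy => by
    have : y - (2 * ⟪e, y - x0⟫) • e - x0 = rfn e (y - x0) := by rw [rfn_apply]; abel
    simp only [mem_closedBall, dist_eq_norm] at hy ⊢
    rw [this, rfn_norm e he]; exact hy
  have := lemT he hR hS hg hz (fun y hy t ht => by
    have a := abs_le.1 (h1 y hy t ht)
    have b := abs_le.1 (h1 _ (hin y hy) t ht)
    linarith) (fun y hy t ht => by
    have a := abs_le.1 (h2 y hy t ht)
    have b := abs_le.1 (h2 _ (hin y hy) t ht)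
    linarith)
  have e1 : ⟪G x0 t0, e⟫ = ‖G x0 t0‖ := by
    simp only [e, inner_smul_right, real_inner_self_eq_norm_sq]
    field_simp
  rwa [e1] at this

/-- gradient bound with drift -/
theorem lemG {z : V → ℝ → ℝ} {G : V → ℝ → V} {f : V → ℝ → ℝ} {x0 : V}
    {R t0 S g k : ℝ} (hR : 0 < R) (hk : 0 ≤ k) (hg : 0 ≤ g)
    (hz : Par z G f (closedBall x0 R ×ˢ Icc (t0 - R ^ 2) t0))
    (h1 : ∀ y ∈ closedBall x0 R, ∀ t ∈ Icc (t0 - R ^ 2) t0, |z y t| ≤ S)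
    (h2 : ∀ y ∈ closedBall x0 R, ∀ t ∈ Icc (t0 - R ^ 2) t0, |f y t| ≤ k / R * ‖G y t‖ + g) :
    ‖G x0 t0‖ ≤ (2 * Module.finrank ℝ V + 1) * (8 * k + 8) * (S / R + g * R) := by
  set n : ℝ := (Module.finrank ℝ V : ℝ)
  have hn : 0 ≤ n := by positivity
  have hx0 : x0 ∈ closedBall x0 R := mem_closedBall_self hR.le
  have ht0 : t0 ∈ Icc (t0 - R ^ 2) t0 := by constructor <;> nlinarith
  have hS : 0 ≤ S := (abs_nonneg _).trans (h1 x0 hx0 t0 ht0)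
  set D : V × ℝ → ℝ := fun q => min (R - ‖q.1 - x0‖) (Real.sqrt (q.2 - (t0 - R ^ 2))) with hD
  have hDc : Continuous D := by fun_prop
  obtain ⟨⟨y1, t1⟩, hq, hmax⟩ := ((isCompact_closedBall x0 R).prod (isCompact_Icc)).exists_isMaxOn
    ⟨(x0, t0), hx0, ht0⟩ (hDc.continuousOn.mul hz.2.1.norm)
  have hD0 : D (x0, t0) = R := by
    simp [hD, Real.sqrt_sq hR.le]
  set d := D (y1, t1) with hd
  set Θ := d * ‖G y1 t1‖ with hΘ
  have hΘ0 : R * ‖G x0 t0‖ ≤ Θ := by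
    have := hmax (show (x0, t0) ∈ _ from ⟨hx0, ht0⟩)
    have this : D (x0, t0) * ‖G x0 t0‖ ≤ D (y1, t1) * ‖G y1 t1‖ := this
    rw [hD0] at this
    exact this
  by_cases hG : G x0 t0 = 0
  · rw [hG, norm_zero]; positivity
  have hGpos : 0 < ‖G x0 t0‖ := norm_pos_iff.2 hG
  have hΘpos : 0 < Θ := lt_of_lt_of_le (by positivity) hΘ0
  have hdpos : 0 < d := by
    by_contra hcon
    have : Θ ≤ 0 := mul_nonpos_of_nonpos_of_nonneg (not_lt.1 hcon) (norm_nonneg _)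
    linarith
  have hd1 : d ≤ R - ‖y1 - x0‖ := min_le_left _ _
  have hd2 : d ≤ Real.sqrt (t1 - (t0 - R ^ 2)) := min_le_right _ _
  have hdR : d ≤ R := by have := norm_nonneg (y1 - x0); linarith
  have hd2' : d ^ 2 ≤ t1 - (t0 - R ^ 2) := by
    have h0 : 0 ≤ t1 - (t0 - R ^ 2) := by have := hq.2.1; simp only at this; linarith
    rw [← Real.sq_sqrt h0]
    exact pow_le_pow_left₀ hdpos.le hd2 2
  set lam : ℝ := 1 / (4 * k + 4) with hlam
  have hlpos : 0 < lam := by positivity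
  have hlam4 : lam ≤ 1 / 4 := by
    rw [hlam]; apply one_div_le_one_div_of_le <;> linarith
  have hlk : 2 * k * lam ≤ 1 / 2 := by
    rw [hlam, mul_one_div, div_le_iff₀ (by positivity)]; linarith
  have ht1 : t1 ≤ t0 := hq.2.2
  have hsub : ∀ y ∈ closedBall y1 (lam * d), ∀ t ∈ Icc (t1 - (lam * d) ^ 2) t1,
      y ∈ closedBall x0 R ∧ t ∈ Icc (t0 - R ^ 2) t0 ∧ ‖G y t‖ ≤ 2 * Θ / d := by
    intro y hy t ht
    have hy' : ‖y - y1‖ ≤ lam * d := by simpa [dist_eq_norm] using hy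
    have a1 : ‖y - x0‖ ≤ lam * d + ‖y1 - x0‖ := by
      have : y - x0 = (y - y1) + (y1 - x0) := by abel
      rw [this]; exact (norm_add_le _ _).trans (by linarith)
    have ld : lam * d ≤ d / 4 := by nlinarith
    have ld0 : 0 < lam * d := by positivity
    have b1 : d / 2 ≤ R - ‖y - x0‖ := by linarith
    have b2 : (d / 2) ^ 2 ≤ t - (t0 - R ^ 2) := by
      have := ht.1
      nlinarith
    have hyR : y ∈ closedBall x0 R := by
      simp only [mem_closedBall, dist_eq_norm]; linarith
    have htR : t ∈ Icc (t0 - R ^ 2) t0 := ⟨by nlinarith, ht.2.trans ht1⟩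
    refine ⟨hyR, htR, ?_⟩
    have := hmax (show (y, t) ∈ _ from ⟨hyR, htR⟩)
    have this : D (y, t) * ‖G y t‖ ≤ Θ := this
    have hDy : d / 2 ≤ D (y, t) := le_min b1 (Real.le_sqrt_of_sq_le b2)
    have h5 : d / 2 * ‖G y t‖ ≤ Θ := le_trans (by gcongr) this
    rw [le_div_iff₀ hdpos]; linarith
  have hT := lemT' (R := lam * d) (x0 := y1) (t0 := t1) (S := S) (g := k / R * (2 * Θ / d) + g)
    (by positivity) (hz.mono (by
      rintro ⟨y, t⟩ ⟨hy, ht⟩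
      exact ⟨(hsub y hy t ht).1, (hsub y hy t ht).2.1⟩)) (by
      intro y hy t ht
      exact h1 y (hsub y hy t ht).1 t (hsub y hy t ht).2.1) (by
      intro y hy t ht
      refine (h2 y (hsub y hy t ht).1 t (hsub y hy t ht).2.1).trans ?_
      have := (hsub y hy t ht).2.2
      gcongr)
  have h6 : Θ ≤ (2 * n + 1) * S / lam + (2 * k * lam) * Θ * (d / R) + g * lam * d ^ 2 := by
    calc Θ ≤ d * ((2 * n + 1) * S / (lam * d) + (k / R * (2 * Θ / d) + g) * (lam * d)) := by
          rw [hΘ]; gcongr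
      _ = _ := by field_simp; ring
  have h7 : (2 * k * lam) * Θ * (d / R) ≤ Θ / 2 := by
    have : d / R ≤ 1 := by rw [div_le_one hR]; exact hdR
    calc (2 * k * lam) * Θ * (d / R) ≤ (1 / 2) * Θ * 1 := by gcongr
      _ = _ := by ring
  have h8 : g * lam * d ^ 2 ≤ g * 1 * R ^ 2 := by gcongr; linarith
  have h9 : (2 * n + 1) * S / lam = (2 * n + 1) * (4 * k + 4) * S := by
    rw [hlam]; field_simp
  have h10 : R * ‖G x0 t0‖ ≤ (2 * n + 1) * (8 * k + 8) * S + 2 * g * R ^ 2 := by linarith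
  have h11 : R * ‖G x0 t0‖ ≤ R * ((2 * n + 1) * (8 * k + 8) * (S / R + g * R)) := by
    have e1 : R * ((2 * n + 1) * (8 * k + 8) * (S / R + g * R)) = (2 * n + 1) * (8 * k + 8) * S
      + (2 * n + 1) * (8 * k + 8) * (g * R ^ 2) := by field_simp
    rw [e1]
    have : 2 ≤ (2 * n + 1) * (8 * k + 8) := by nlinarith
    have := mul_le_mul_of_nonneg_right this (show 0 ≤ g * R ^ 2 by positivity)
    linarith
  exact le_of_mul_le_mul_left h11 hR
end ParCalc


theorem rpow_lip {p N a b : ℝ} (hp : 1 ≤ p) (ha : 0 ≤ a) (hb : 0 ≤ b) (haN : a ≤ N) (hbN : b ≤ N) :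
    |a ^ p - b ^ p| ≤ p * N ^ (p - 1) * |a - b| := by
  have hN : 0 ≤ N := ha.trans haN
  have := Convex.norm_image_sub_le_of_norm_hasDerivWithin_le (s := Icc 0 N)
    (f := fun x : ℝ => x ^ p) (f' := fun x => p * x ^ (p - 1)) (C := p * N ^ (p - 1))
    (x := b) (y := a) (fun x hx => (Real.hasDerivAt_rpow_const (Or.inr hp)).hasDerivWithinAt)
    (fun x hx => by
      rw [Real.norm_eq_abs, abs_of_nonneg (by have := Real.rpow_nonneg hx.1 (p-1); positivity)]
      have : x ^ (p - 1) ≤ N ^ (p - 1) := Real.rpow_le_rpow hx.1 hx.2 (by linarith)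
      gcongr) (convex_Icc 0 N) ⟨hb, hbN⟩ ⟨ha, haN⟩
  simpa [Real.norm_eq_abs] using this

section LemS
variable {V : Type*} [NormedAddCommGroup V] [InnerProductSpace ℝ V] [FiniteDimensional ℝ V]
  [CompleteSpace V]

theorem normpow_lip {p N : ℝ} {v w : V} (hp : 1 ≤ p) (hv : ‖v‖ ≤ N) (hw : ‖w‖ ≤ N) :
    |‖v‖ ^ p - ‖w‖ ^ p| ≤ p * N ^ (p - 1) * ‖v - w‖ := by
  have hN : 0 ≤ N := (norm_nonneg v).trans hv
  refine (rpow_lip hp (norm_nonneg _) (norm_nonneg _) hv hw).trans ?_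
  have := abs_norm_sub_norm_le v w
  have := Real.rpow_nonneg hN (p - 1)
  gcongr

theorem mvt_ball {v : V → ℝ} {G : V → V} {K : Set V} (hK : Convex ℝ K) {N : ℝ}
    (h : ∀ y ∈ K, HasGradientAt v (G y) y) (hN : ∀ y ∈ K, ‖G y‖ ≤ N) {y y' : V} (hy : y ∈ K)
    (hy' : y' ∈ K) : |v y' - v y| ≤ N * ‖y' - y‖ := by
  have := hK.norm_image_sub_le_of_norm_hasFDerivWithin_le (f := v)
    (f' := fun y => InnerProductSpace.toDual ℝ V (G y)) (C := N)
    (fun y hy => (h y hy).hasFDerivAt.hasFDerivWithinAt) (fun y hy => by simpa using hN y hy) hy hy'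
  simpa [Real.norm_eq_abs] using this

/-- the hypotheses of the local lemma S -/
structure SHyp (p ρ N k0 : ℝ) (x : V) (t : ℝ) (u : V → ℝ → ℝ) (G : V → ℝ → V) : Prop where
  hp : 1 ≤ p
  hρ : 0 < ρ
  hN : 0 < N
  hk : N ^ (p - 1) * ρ ≤ k0
  par : Par u G (fun y t => ‖G y t‖ ^ p) (closedBall x (ρ / 2) ×ˢ Icc (t - ρ ^ 2 / 4) t)
  hG : ∀ y ∈ closedBall x (ρ / 2), ∀ s ∈ Icc (t - ρ ^ 2 / 4) t, ‖G y s‖ ≤ N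

variable {p ρ N k0 : ℝ} {x : V} {t : ℝ} {u : V → ℝ → ℝ} {G : V → ℝ → V}

theorem SHyp.k0_nonneg (h : SHyp p ρ N k0 x t u G) : 0 ≤ k0 :=
  le_trans (by have := h.hρ; have := Real.rpow_nonneg h.hN.le (p-1); positivity) h.hk

theorem SHyp.par_diff (h : SHyp p ρ N k0 x t u G) {y c : V} {s R : ℝ}
    (h1 : ∀ y' ∈ closedBall y R, y' ∈ closedBall x (ρ / 2) ∧ y' + c ∈ closedBall x (ρ / 2))
    (h2 : t - ρ ^ 2 / 4 ≤ s - R ^ 2) (h3 : s ≤ t) :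
    Par (fun y' s => u (y' + c) s - u y' s) (fun y' s => G (y' + c) s - G y' s)
      (fun y' s => ‖G (y' + c) s‖ ^ p - ‖G y' s‖ ^ p) (closedBall y R ×ˢ Icc (s - R ^ 2) s) := by
  apply Par.sub
  · apply h.par.shift c
    rintro y' s' ⟨a, b⟩
    exact ⟨(h1 y' a).2, h2.trans b.1, b.2.trans h3⟩
  · apply h.par.mono
    rintro ⟨y', s'⟩ ⟨a, b⟩
    exact ⟨(h1 y' a).1, h2.trans b.1, b.2.trans h3⟩

theorem SHyp.s0 (h : SHyp p ρ N k0 x t u G) {y c : V} {s : ℝ} (hy : ‖y - x‖ ≤ ρ / 4)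
    (hc : ‖c‖ ≤ ρ / 8) (hs : s ∈ Icc (t - ρ ^ 2 / 16) t) :
    ‖G (y + c) s - G y s‖ ≤ 8 * (2 * Module.finrank ℝ V + 1) * (8 * (p * k0) + 8) * N / ρ * ‖c‖ := by
  have hρ := h.hρ
  have hp := h.hp
  have hN := h.hN
  have hk0 := h.k0_nonneg
  have hmem : ∀ y' ∈ closedBall y (ρ / 8), y' ∈ closedBall x (ρ / 2) ∧
      y' + c ∈ closedBall x (ρ / 2) := by
    intro y' hy'
    simp only [mem_closedBall, dist_eq_norm] at hy' ⊢
    have a1 : ‖y' - x‖ ≤ ρ / 8 + ρ / 4 := by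
      have : y' - x = (y' - y) + (y - x) := by abel
      rw [this]; exact (norm_add_le _ _).trans (by linarith)
    refine ⟨by linarith, ?_⟩
    have : y' + c - x = (y' - x) + c := by abel
    rw [this]; exact (norm_add_le _ _).trans (by linarith)
  have ht1 : t - ρ ^ 2 / 4 ≤ s - (ρ / 8) ^ 2 := by have := hs.1; nlinarith
  have hti : ∀ s' ∈ Icc (s - (ρ / 8) ^ 2) s, s' ∈ Icc (t - ρ ^ 2 / 4) t := fun s' hs' =>
    ⟨ht1.trans hs'.1, hs'.2.trans hs.2⟩
  have key := lemG (k := p * k0) (S := N * ‖c‖) (g := 0) (by positivity) (by positivity) (le_refl _)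
    (h.par_diff hmem ht1 hs.2) (by
      intro y' hy' s' hs'
      have := mvt_ball (convex_closedBall x (ρ / 2)) (v := fun y => u y s') (G := fun y => G y s')
        (fun y hy => by
          obtain ⟨l, d, j, -⟩ := h.par.2.2 y s' ⟨hy, hti s' hs'⟩
          exact j.grad) (fun y hy => h.hG y hy s' (hti s' hs')) (hmem y' hy').1 (hmem y' hy').2
      simpa using this) (by
      intro y' hy' s' hs'
      refine (normpow_lip hp (h.hG _ (hmem y' hy').2 s' (hti s' hs'))
        (h.hG _ (hmem y' hy').1 s' (hti s' hs'))).trans ?_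
      rw [add_zero]
      gcongr
      rw [le_div_iff₀ (by positivity)]
      have := h.hk
      have h0 : 0 ≤ N ^ (p - 1) * ρ := by positivity
      calc p * N ^ (p - 1) * (ρ / 8) = p * (N ^ (p - 1) * ρ) * (1 / 8) := by ring
        _ ≤ p * (N ^ (p - 1) * ρ) * 1 := by gcongr; norm_num
        _ ≤ p * k0 := by rw [mul_one]; gcongr)
  refine key.trans (le_of_eq ?_)
  field_simp
  ring

/-- the constant in `s0` -/
def cS0 (n p k0 : ℝ) : ℝ := 8 * (2 * n + 1) * (8 * (p * k0) + 8)

theorem SHyp.src (h : SHyp p ρ N k0 x t u G) {y τ : V} {s k : ℝ} (hτ : ‖τ‖ = 1) (hk0 : 0 ≤ k)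
    (hk : k ≤ ρ / 8) (hy : ‖y - x‖ ≤ ρ / 4) (hs : s ∈ Icc (t - ρ ^ 2 / 16) t) :
    |‖G (y + k • τ) s‖ ^ p - ‖G y s‖ ^ p| ≤ p * cS0 (Module.finrank ℝ V) p k0 * N ^ p * (k / ρ) := by
  have hρ := h.hρ
  have hp := h.hp
  have hN := h.hN
  have hc : ‖k • τ‖ = k := by rw [norm_smul, hτ, mul_one, Real.norm_eq_abs, abs_of_nonneg hk0]
  have h0 := h.s0 hy (c := k • τ) (by rw [hc]; exact hk) hs
  have hs' : s ∈ Icc (t - ρ ^ 2 / 4) t := ⟨by have := hs.1; nlinarith, hs.2⟩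
  have hy1 : y ∈ closedBall x (ρ / 2) := by simp only [mem_closedBall, dist_eq_norm]; linarith
  have hy2 : y + k • τ ∈ closedBall x (ρ / 2) := by
    simp only [mem_closedBall, dist_eq_norm]
    have : y + k • τ - x = (y - x) + k • τ := by abel
    rw [this]; exact (norm_add_le _ _).trans (by linarith)
  refine (normpow_lip hp (h.hG _ hy2 s hs') (h.hG _ hy1 s hs')).trans ?_
  have hNp : N ^ p = N ^ (p - 1) * N := by
    rw [← Real.rpow_add_one hN.ne']; ring_nf
  calc p * N ^ (p - 1) * ‖G (y + k • τ) s - G y s‖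
      ≤ p * N ^ (p - 1) * (8 * (2 * Module.finrank ℝ V + 1) * (8 * (p * k0) + 8) * N / ρ * ‖k • τ‖) := by
        have := Real.rpow_nonneg hN.le (p-1)
        gcongr
    _ = _ := by rw [hc, hNp, cS0]; ring

/-- parallelogram bound -/
def Hpar (ρ B : ℝ) (x τ : V) (t : ℝ) (u : V → ℝ → ℝ) : Prop :=
  ∀ s ∈ Icc (t - ρ ^ 2 / 4) t, ∀ y : V, ∀ r1 r2 : ℝ, y ∈ closedBall x (ρ / 2) →
    y + r1 • τ ∈ closedBall x (ρ / 2) → y + r2 • τ ∈ closedBall x (ρ / 2) →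
    y + (r1 + r2) • τ ∈ closedBall x (ρ / 2) →
    |u (y + (r1 + r2) • τ) s - u (y + r1 • τ) s - u (y + r2 • τ) s + u y s| ≤ B

theorem refl_mem {y Y τ : V} (hτ : ‖τ‖ = 1) {R : ℝ} (hy : y ∈ closedBall Y R) :
    y - (2 * ⟪τ, y - Y⟫) • τ ∈ closedBall Y R := by
  have : y - (2 * ⟪τ, y - Y⟫) • τ - Y = rfn τ (y - Y) := by rw [rfn_apply]; abel
  simp only [mem_closedBall, dist_eq_norm] at hy ⊢
  rw [this, rfn_norm τ hτ]; exact hy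

theorem SHyp.tang (h : SHyp p ρ N k0 x t u G) {τ Y : V} {s k R B : ℝ} (hτ : ‖τ‖ = 1)
    (hR : 0 < R) (hRρ : R ≤ ρ / 8) (hk0 : 0 ≤ k) (hk : k ≤ ρ / 8) (hY : ‖Y - x‖ ≤ ρ / 8)
    (hs : s ∈ Icc (t - ρ ^ 2 / 64) t)
    (hB : ∀ y ∈ closedBall Y R, ∀ s' ∈ Icc (s - R ^ 2) s,
      |(u (y + k • τ) s' - u y s') - (u (y - (2 * ⟪τ, y - Y⟫) • τ + k • τ) s' -
        u (y - (2 * ⟪τ, y - Y⟫) • τ) s')| ≤ B) :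
    |⟪G (Y + k • τ) s - G Y s, τ⟫| ≤ (2 * Module.finrank ℝ V + 1) * (B / 2) / R +
      p * cS0 (Module.finrank ℝ V) p k0 * N ^ p * (k / ρ) * R := by
  have hρ := h.hρ
  have hp := h.hp
  have hN := h.hN
  have hk00 := h.k0_nonneg
  have hc : ‖k • τ‖ = k := by rw [norm_smul, hτ, mul_one, Real.norm_eq_abs, abs_of_nonneg hk0]
  have hm : ∀ y' ∈ closedBall Y R, ‖y' - x‖ ≤ ρ / 4 := by
    intro y' hy'
    simp only [mem_closedBall, dist_eq_norm] at hy'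
    have : y' - x = (y' - Y) + (Y - x) := by abel
    rw [this]; exact (norm_add_le _ _).trans (by linarith)
  have hmem : ∀ y' ∈ closedBall Y R, y' ∈ closedBall x (ρ / 2) ∧
      y' + k • τ ∈ closedBall x (ρ / 2) := by
    intro y' hy'
    have a1 := hm y' hy'
    simp only [mem_closedBall, dist_eq_norm]
    refine ⟨by linarith, ?_⟩
    have : y' + k • τ - x = (y' - x) + k • τ := by abel
    rw [this]; exact (norm_add_le _ _).trans (by linarith)
  have hR2 : R ^ 2 ≤ ρ ^ 2 / 64 := by nlinarith
  have hsR : ∀ s' ∈ Icc (s - R ^ 2) s, s' ∈ Icc (t - ρ ^ 2 / 16) t := fun s' hs' =>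
    ⟨by have := hs'.1; have := hs.1; nlinarith, hs'.2.trans hs.2⟩
  have ht1 : t - ρ ^ 2 / 4 ≤ s - R ^ 2 := by have := hs.1; nlinarith
  set g := p * cS0 (Module.finrank ℝ V) p k0 * N ^ p * (k / ρ) with hg
  have hcS : 0 ≤ cS0 (Module.finrank ℝ V) p k0 := by unfold cS0; positivity
  have hg0 : 0 ≤ g := by positivity
  have hB0 : 0 ≤ B := (abs_nonneg _).trans (hB Y (mem_closedBall_self hR.le) s
    ⟨by nlinarith, le_refl _⟩)
  have hpd := h.par_diff hmem ht1 hs.2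
  have hsrc : ∀ y ∈ closedBall Y R, ∀ s' ∈ Icc (s - R ^ 2) s,
    |(‖G (y + k • τ) s'‖ ^ p - ‖G y s'‖ ^ p) - (‖G (y - (2 * ⟪τ, y - Y⟫) • τ + k • τ) s'‖ ^ p -
      ‖G (y - (2 * ⟪τ, y - Y⟫) • τ) s'‖ ^ p)| ≤ 2 * g := by
    intro y hy s' hs'
    have a := abs_le.1 (h.src hτ hk0 hk (hm y hy) (hsR s' hs'))
    have b := abs_le.1 (h.src hτ hk0 hk (hm _ (refl_mem hτ hy)) (hsR s' hs'))
    rw [abs_le]; constructor <;> linarith [a.1, a.2, b.1, b.2]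
  have up := lemT (e := τ) hτ hR (S := B / 2) (by positivity) hg0 hpd (by
      intro y hy s' hs'
      have := (abs_le.1 (hB y hy s' hs')).2
      linarith) (by
      intro y hy s' hs'
      exact (abs_le.1 (hsrc y hy s' hs')).2)
  have e0 : ∀ y, (2 * ⟪-τ, y - Y⟫) • (-τ) = (2 * ⟪τ, y - Y⟫) • τ := fun y => by
    rw [inner_neg_left]; module
  have dn := lemT (e := -τ) (by simpa using hτ) hR (S := B / 2) (by positivity) hg0 hpd (by
      intro y hy s' hs'
      have := (abs_le.1 (hB y hy s' hs')).2
      simp only [e0]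
      linarith) (by
      intro y hy s' hs'
      simp only [e0]
      exact (abs_le.1 (hsrc y hy s' hs')).2)
  rw [inner_neg_right] at dn
  rw [abs_le]
  constructor <;> linarith

theorem SHyp.s1 (h : SHyp p ρ N k0 x t u G) {τ Y : V} {s k lam ε1 : ℝ} (hτ : ‖τ‖ = 1)
    (hl : 0 < lam) (hl8 : lam ≤ 1 / 8) (hH : Hpar ρ (ε1 * ρ ^ 2 * N ^ p) x τ t u)
    (hk0 : 0 ≤ k) (hk : k ≤ lam * ρ) (hY : ‖Y - x‖ ≤ ρ / 8) (hs : s ∈ Icc (t - ρ ^ 2 / 64) t) :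
    |⟪G (Y + k • τ) s - G Y s, τ⟫| ≤ ((2 * Module.finrank ℝ V + 1) * ε1 / (2 * lam) +
      p * cS0 (Module.finrank ℝ V) p k0 * lam ^ 2) * ρ * N ^ p := by
  have hρ := h.hρ
  have hp := h.hp
  have hN := h.hN
  have hk00 := h.k0_nonneg
  have hlρ : lam * ρ ≤ ρ / 8 := by nlinarith
  have hc : ‖k • τ‖ = k := by rw [norm_smul, hτ, mul_one, Real.norm_eq_abs, abs_of_nonneg hk0]
  have hm : ∀ y' ∈ closedBall Y (lam * ρ), y' ∈ closedBall x (ρ / 2) ∧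
      y' + k • τ ∈ closedBall x (ρ / 2) := by
    intro y' hy'
    simp only [mem_closedBall, dist_eq_norm] at hy' ⊢
    have a1 : ‖y' - x‖ ≤ ρ / 4 := by
      have : y' - x = (y' - Y) + (Y - x) := by abel
      rw [this]; exact (norm_add_le _ _).trans (by linarith)
    refine ⟨by linarith, ?_⟩
    have : y' + k • τ - x = (y' - x) + k • τ := by abel
    rw [this]; exact (norm_add_le _ _).trans (by linarith)
  have hcS : 0 ≤ cS0 (Module.finrank ℝ V) p k0 := by unfold cS0; positivity
  have := h.tang hτ (R := lam * ρ) (by positivity) hlρ hk0 (hk.trans hlρ) hY hs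
    (B := ε1 * ρ ^ 2 * N ^ p) (by
    intro y hy s' hs'
    have m1 := hm y hy
    have m2 := hm _ (refl_mem hτ hy)
    set r := ⟪τ, y - Y⟫
    have hs'' : s' ∈ Icc (t - ρ ^ 2 / 4) t :=
      ⟨by have := hs'.1; have := hs.1; nlinarith, hs'.2.trans hs.2⟩
    have e1 : y - (2 * r) • τ + (k + 2 * r) • τ = y + k • τ := by module
    have e2 : y - (2 * r) • τ + (2 * r) • τ = y := by module
    have := hH s' hs'' (y - (2 * r) • τ) k (2 * r) m2.1 m2.2 (by rw [e2]; exact m1.1)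
      (by rw [e1]; exact m1.2)
    rw [e1, e2] at this
    refine le_trans (le_of_eq ?_) this
    congr 1; ring)
  refine this.trans ?_
  have e : ((2 * Module.finrank ℝ V + 1) * ε1 / (2 * lam) +
      p * cS0 (Module.finrank ℝ V) p k0 * lam ^ 2) * ρ * N ^ p =
      (2 * Module.finrank ℝ V + 1) * (ε1 * ρ ^ 2 * N ^ p / 2) / (lam * ρ) +
      p * cS0 (Module.finrank ℝ V) p k0 * N ^ p * (lam * ρ / ρ) * (lam * ρ) := by
    field_simp
  rw [e]
  gcongr

theorem SHyp.s2 (h : SHyp p ρ N k0 x t u G) {τ : V} {k lam B1 : ℝ} (hτ : ‖τ‖ = 1)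
    (hl : 0 < lam) (hl8 : lam ≤ 1 / 8) (hk0 : 0 ≤ k) (hk : k ≤ lam * ρ / 4)
    (hB : ∀ Y s k, 0 ≤ k → k ≤ lam * ρ → ‖Y - x‖ ≤ ρ / 8 → s ∈ Icc (t - ρ ^ 2 / 64) t →
      |⟪G (Y + k • τ) s - G Y s, τ⟫| ≤ B1) :
    |⟪G (x + k • τ) t - G x t, τ⟫| ≤ ((2 * Module.finrank ℝ V + 1) * (2 * B1) / (lam * ρ) +
      p * cS0 (Module.finrank ℝ V) p k0 * N ^ p * lam) * k := by
  have hρ := h.hρ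
  have hp := h.hp
  have hN := h.hN
  have hk00 := h.k0_nonneg
  have hlρ : lam * ρ ≤ ρ / 8 := by nlinarith
  have hc : ‖k • τ‖ = k := by rw [norm_smul, hτ, mul_one, Real.norm_eq_abs, abs_of_nonneg hk0]
  have hcS : 0 ≤ cS0 (Module.finrank ℝ V) p k0 := by unfold cS0; positivity
  have hlρ0 : 0 < lam * ρ := by positivity
  have hBs : ∀ Y s k, |k| ≤ lam * ρ / 2 → ‖Y - x‖ ≤ ρ / 16 → s ∈ Icc (t - ρ ^ 2 / 64) t →
      |⟪G (Y + k • τ) s - G Y s, τ⟫| ≤ B1 := by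
    intro Y s k hk hY hs
    rcases le_or_gt 0 k with h0 | h0
    · exact hB Y s k h0 (by rw [abs_of_nonneg h0] at hk; linarith) (by linarith) hs
    · rw [abs_of_neg h0] at hk
      have := hB (Y + k • τ) s (-k) (by linarith) (by linarith) (by
        have e : Y + k • τ - x = (Y - x) + k • τ := by abel
        rw [e]; refine (norm_add_le _ _).trans ?_
        rw [norm_smul, hτ, Real.norm_eq_abs, abs_of_neg h0]; linarith) hs
      have e : Y + k • τ + (-k) • τ = Y := by module
      rw [e, ← neg_sub, inner_neg_left, abs_neg] at this
      exact this
  have := h.tang hτ (Y := x) (s := t) (R := lam * ρ / 4) (by positivity) (by linarith) hk0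
    (by linarith) (by simp; positivity) (by constructor <;> nlinarith)
    (B := B1 * k) (by
    intro y hy s' hs'
    have hy' : ‖y - x‖ ≤ lam * ρ / 4 := by simpa [dist_eq_norm] using hy
    set r := ⟪τ, y - x⟫
    have hr : |r| ≤ lam * ρ / 4 := by
      have := abs_real_inner_le_norm τ (y - x)
      rw [hτ, one_mul] at this; linarith
    have hs64 : s' ∈ Icc (t - ρ ^ 2 / 64) t := ⟨by have := hs'.1; nlinarith, hs'.2⟩
    have hs'' : s' ∈ Icc (t - ρ ^ 2 / 4) t := ⟨by have := hs'.1; nlinarith, hs'.2⟩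
    have hd : ∀ q ∈ Icc (0:ℝ) k, HasDerivWithinAt (fun q : ℝ => u (y + q • τ) s' -
        u (y - (2 * r) • τ + q • τ) s') (⟪G (y + q • τ) s', τ⟫ -
          ⟪G (y - (2 * r) • τ + q • τ) s', τ⟫) (Icc 0 k) q := by
      intro q hq
      have hin : ∀ w, ‖w - x‖ ≤ ρ / 4 → HasDerivAt (fun q : ℝ => u (w - q • τ + q • τ) s') 0 q := by
        intro w hw
        simpa using hasDerivAt_const q (u w s')
      have hgen : ∀ w, ‖w - x‖ ≤ ρ / 4 →
          HasDerivAt (fun q : ℝ => u (w + q • τ) s') ⟪G (w + q • τ) s', τ⟫ q := by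
        intro w hw
        have hq1 : ‖q • τ‖ ≤ ρ / 8 := by
          rw [norm_smul, hτ, Real.norm_eq_abs, abs_of_nonneg hq.1]; linarith [hq.2]
        have hm : w + q • τ ∈ closedBall x (ρ / 2) := by
          simp only [mem_closedBall, dist_eq_norm]
          have : w + q • τ - x = (w - x) + q • τ := by abel
          rw [this]; exact (norm_add_le _ _).trans (by linarith)
        obtain ⟨l, d, j, -⟩ := h.par.2.2 _ s' ⟨hm, hs''⟩
        have hl : HasDerivAt (fun s : ℝ => w + s • τ) τ q := by
          simpa using ((hasDerivAt_id q).smul_const τ).const_add w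
        exact j.grad.hasFDerivAt.comp_hasDerivAt q hl
      have h2r : ‖y - (2 * r) • τ - x‖ ≤ ρ / 4 := by
        have := refl_mem hτ hy
        simp only [mem_closedBall, dist_eq_norm] at this
        exact this.trans (by linarith)
      exact ((hgen y (by linarith)).sub (hgen _ h2r)).hasDerivWithinAt
    have := (convex_Icc (0:ℝ) k).norm_image_sub_le_of_norm_hasDerivWithin_le (C := B1) hd (by
      intro q hq
      have e1 : y + q • τ = (y - (2 * r) • τ + q • τ) + (2 * r) • τ := by module
      rw [Real.norm_eq_abs, ← inner_sub_left]
      conv_lhs => rw [e1]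
      apply hBs _ _ _ _ _ hs64
      · rw [abs_mul, abs_two]; linarith
      · have := refl_mem hτ hy
        simp only [mem_closedBall, dist_eq_norm] at this
        have e : y - (2 * r) • τ + q • τ - x = (y - (2 * r) • τ - x) + q • τ := by abel
        rw [e]
        refine (norm_add_le _ _).trans ?_
        rw [norm_smul, hτ, Real.norm_eq_abs, abs_of_nonneg hq.1, mul_one]
        linarith [hq.2]) (x := 0) (y := k) ⟨le_refl _, hk0⟩ ⟨hk0, le_refl _⟩
    simp only [Real.norm_eq_abs, zero_smul, add_zero, sub_zero, abs_of_nonneg hk0] at this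
    refine le_trans (le_of_eq ?_) this
    congr 1; ring)
  refine this.trans ?_
  have : p * cS0 (Module.finrank ℝ V) p k0 * N ^ p * (k / ρ) * (lam * ρ / 4)
    ≤ p * cS0 (Module.finrank ℝ V) p k0 * N ^ p * lam * k := by
    have e : p * cS0 (Module.finrank ℝ V) p k0 * N ^ p * (k / ρ) * (lam * ρ / 4) =
      p * cS0 (Module.finrank ℝ V) p k0 * N ^ p * lam * k * (1 / 4) := by field_simp
    rw [e]
    have : 0 ≤ p * cS0 (Module.finrank ℝ V) p k0 * N ^ p * lam * k := by positivity
    linarith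
  have e2 : (2 * Module.finrank ℝ V + 1) * (B1 * k / 2) / (lam * ρ / 4) =
    (2 * Module.finrank ℝ V + 1) * (2 * B1) / (lam * ρ) * k := by field_simp; ring
  rw [e2, add_mul]
  linarith

theorem deriv_bound {G : V → V} {H : V →L[ℝ] V} {x τ : V} {C k1 : ℝ} (hk1 : 0 < k1)
    (hH : HasFDerivAt G H x) (hb : ∀ k, 0 ≤ k → k ≤ k1 → |⟪G (x + k • τ) - G x, τ⟫| ≤ C * k) :
    |⟪H τ, τ⟫| ≤ C := by
  have hl : HasDerivAt (fun s : ℝ => x + s • τ) τ 0 := by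
    simpa using ((hasDerivAt_id (0:ℝ)).smul_const τ).const_add x
  have hH' : HasFDerivAt G H (x + (0:ℝ) • τ) := by simpa using hH
  have hd := (hH'.comp_hasDerivAt (0:ℝ) hl).inner ℝ (hasDerivAt_const (0:ℝ) τ)
  have hlim := hd.hasDerivWithinAt (s := Ioi 0)
  rw [hasDerivWithinAt_iff_tendsto_slope' (by simp)] at hlim
  have hlim := hlim.abs
  simp only [inner_zero_right, zero_add] at hlim
  refine le_of_tendsto hlim ?_
  filter_upwards [Ioo_mem_nhdsGT hk1] with k hk
  rw [slope_def_field, abs_div, sub_zero, abs_of_pos hk.1, div_le_iff₀ hk.1]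
  have := hb k hk.1.le hk.2.le
  simpa [inner_sub_left] using this

theorem lemS (V : Type*) [NormedAddCommGroup V] [InnerProductSpace ℝ V] [FiniteDimensional ℝ V]
    [CompleteSpace V] {p k0 η : ℝ} (hp : 1 ≤ p) (hk0 : 0 ≤ k0) (hη : 0 < η) : ∃ ε1 > 0,
    ∀ (ρ N : ℝ) (x : V) (t : ℝ) (u : V → ℝ → ℝ) (G : V → ℝ → V) (τ : V), SHyp p ρ N k0 x t u G →
    ‖τ‖ = 1 → Hpar ρ (ε1 * ρ ^ 2 * N ^ p) x τ t u →
    (∀ s ∈ Icc (t - ρ ^ 2 / 4) t, ∀ y : V, ∀ r : ℝ, y ∈ closedBall x (ρ / 2) →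
      y + r • τ ∈ closedBall x (ρ / 2) → |u (y + r • τ) s - u y s| ≤ ε1 * ρ * N) →
    |⟪G x t, τ⟫| ≤ η * N ∧ ∀ H : V →L[ℝ] V, HasFDerivAt (fun y => G y t) H x → |⟪H τ, τ⟫| ≤ η * N ^ p := by
  set n : ℝ := (Module.finrank ℝ V : ℝ) with hn
  have hn0 : 0 ≤ n := by positivity
  set c := cS0 n p k0 with hc
  have hc0 : 0 ≤ c := by rw [hc]; unfold cS0; positivity
  set D := (2 * (2 * n + 1) + 1) * p * c + k0 + 1 with hD
  have hD1 : 1 ≤ D := by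
    have : 0 ≤ (2 * (2 * n + 1) + 1) * p * c := by positivity
    linarith
  set lam := min (1 / 8) (η / (2 * D)) with hlam
  have hl : 0 < lam := by positivity
  have hl8 : lam ≤ 1 / 8 := min_le_left _ _
  have hlD : D * lam ≤ η / 2 := by
    have := min_le_right (1 / 8) (η / (2 * D))
    calc D * lam ≤ D * (η / (2 * D)) := by gcongr
      _ = η / 2 := by field_simp
  set ε1 := η / 2 * lam ^ 2 / (2 * n + 1) ^ 2 with hε1
  refine ⟨ε1, by positivity, ?_⟩
  intro ρ N x t u G τ h hτ hH hH2
  have hρ := h.hρ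
  have hN := h.hN
  have hlρ : lam * ρ ≤ ρ / 8 := by nlinarith
  have hlρ0 : 0 < lam * ρ := by positivity
  have hNp0 : 0 < N ^ p := by positivity
  have hNp : N ^ p = N ^ (p - 1) * N := by
    rw [← Real.rpow_add_one hN.ne']; ring_nf
  have hE1 : (2 * n + 1) * ε1 / lam ≤ η / 2 := by
    rw [hε1, div_le_iff₀ hl]
    have e : (2 * n + 1) * (η / 2 * lam ^ 2 / (2 * n + 1) ^ 2) = η / 2 * lam * (lam / (2 * n + 1)) := by
      field_simp
    rw [e]
    have : lam / (2 * n + 1) ≤ 1 := by rw [div_le_one (by positivity)]; linarith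
    have h0 : 0 ≤ η / 2 * lam := by positivity
    nlinarith
  constructor
  · -- first derivative
    have hsub : ∀ y ∈ closedBall x (lam * ρ), y ∈ closedBall x (ρ / 2) := fun y hy =>
      closedBall_subset_closedBall (by linarith) hy
    have hts : ∀ s ∈ Icc (t - (lam * ρ) ^ 2) t, s ∈ Icc (t - ρ ^ 2 / 4) t := fun s hs =>
      ⟨by have := hs.1; nlinarith, hs.2⟩
    have hpar := h.par.mono (K' := closedBall x (lam * ρ) ×ˢ Icc (t - (lam * ρ) ^ 2) t) (by
      rintro ⟨y, s⟩ ⟨a, b⟩; exact ⟨hsub y a, hts s b⟩)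
    have gen : ∀ e : V, (e = τ ∨ e = -τ) → ⟪G x t, e⟫ ≤ η * N := by
      intro e he
      have hen : ‖e‖ = 1 := by rcases he with rfl | rfl <;> simp [hτ]
      have := lemT hen hlρ0 (S := ε1 * ρ * N / 2) (g := N ^ p) (by positivity) hNp0.le hpar (by
        intro y hy s hs
        have m2 := refl_mem hen hy
        have key : ∀ r : ℝ, y - r • e ∈ closedBall x (ρ / 2) → |u y s - u (y - r • e) s| ≤ ε1 * ρ * N := by
          intro r hr
          rcases he with rfl | rfl
          · have e1 : y - r • e + r • e = y := by module
            have := hH2 s (hts s hs) (y - r • e) r hr (by rw [e1]; exact hsub y hy)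
            rwa [e1] at this
          · have e1 : y - r • (-τ) = y + r • τ := by module
            rw [e1] at hr ⊢
            rw [abs_sub_comm]
            exact hH2 s (hts s hs) y r (hsub y hy) hr
        have := (abs_le.1 (key _ (hsub _ m2))).2
        linarith) (by
        intro y hy s hs
        have m2 := refl_mem hen hy
        have a1 : ‖G y s‖ ^ p ≤ N ^ p := Real.rpow_le_rpow (norm_nonneg _)
          (h.hG y (hsub y hy) s (hts s hs)) (by linarith)
        have a2 := Real.rpow_nonneg (norm_nonneg (G (y - (2 * ⟪e, y - x⟫) • e) s)) p
        linarith)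
      refine this.trans ?_
      have b1 : N ^ p * (lam * ρ) ≤ k0 * lam * N := by
        have := h.hk
        calc N ^ p * (lam * ρ) = (N ^ (p - 1) * ρ) * lam * N := by rw [hNp]; ring
          _ ≤ _ := by gcongr
      have b2 : k0 * lam ≤ η / 2 := by
        refine le_trans ?_ hlD
        gcongr
        have : 0 ≤ (2 * (2 * n + 1) + 1) * p * c := by positivity
        linarith
      have b3 : (2 * n + 1) * (ε1 * ρ * N / 2) / (lam * ρ) = ((2 * n + 1) * ε1 / lam) * N / 2 := by
        field_simp
      rw [b3]
      have : ((2 * n + 1) * ε1 / lam) * N / 2 ≤ η / 2 * N := by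
        have := mul_le_mul_of_nonneg_right hE1 hN.le
        have : 0 ≤ η / 2 * N := by positivity
        linarith
      have := mul_le_mul_of_nonneg_right b2 hN.le
      linarith
    have u1 := gen τ (Or.inl rfl)
    have u2 := gen (-τ) (Or.inr rfl)
    rw [inner_neg_right] at u2
    rw [abs_le]; constructor <;> linarith
  · intro H hHd
    have hB := fun Y s k (h0 : 0 ≤ k) (h1 : k ≤ lam * ρ) (h2 : ‖Y - x‖ ≤ ρ / 8)
      (h3 : s ∈ Icc (t - ρ ^ 2 / 64) t) => h.s1 hτ hl hl8 hH h0 h1 h2 h3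
    have := deriv_bound (C := _) (k1 := lam * ρ / 4) (by positivity) hHd (fun k a b =>
      h.s2 hτ hl hl8 a b hB)
    refine this.trans ?_
    have e1 : (2 * n + 1) * (2 * (((2 * n + 1) * ε1 / (2 * lam) + p * c * lam ^ 2) * ρ * N ^ p)) / (lam * ρ)
        + p * c * N ^ p * lam = ((2 * n + 1) ^ 2 * ε1 / lam ^ 2 +
          ((2 * (2 * n + 1) + 1) * p * c) * lam) * N ^ p := by
      field_simp
      ring
    have e2 : (2 * n + 1) ^ 2 * ε1 / lam ^ 2 = η / 2 := by
      rw [hε1]; field_simp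
    have e3 : ((2 * (2 * n + 1) + 1) * p * c) * lam ≤ η / 2 := by
      refine le_trans ?_ hlD
      gcongr
      linarith
    rw [e1, e2]
    have := mul_le_mul_of_nonneg_right e3 hNp0.le
    linarith
end LemS


section Geom
variable {V : Type*} [NormedAddCommGroup V] [InnerProductSpace ℝ V] [FiniteDimensional ℝ V]
  [CompleteSpace V]

/-- geometric facts about the boundary near `a` -/
structure Geo (Ω : Set V) (δ : V → ℝ) (ν : V → V) (a : V) (κ rg : ℝ) : Prop where
  op : IsOpen Ω
  dd : ∀ x, δ x = infDist x (frontier Ω)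
  ha : a ∈ frontier Ω
  hκ : 0 < κ
  hrg : 0 < rg
  nrm : ∀ b ∈ frontier Ω, ‖ν b‖ = 1
  int : ∀ b ∈ frontier Ω, ∀ y, κ * ‖y - b‖ ^ 2 < ⟪y - b, ν b⟫ → y ∈ Ω
  dlow : ∀ b ∈ frontier Ω, ∀ y, ⟪y - b, ν b⟫ - κ * ‖y - b‖ ^ 2 ≤ δ y
  ext : ∀ b ∈ frontier Ω, dist b a < rg → ∀ y ∈ Ω, dist y b < rg →
    δ y ≤ ⟪y - b, ν b⟫ + κ * ‖y - b‖ ^ 2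
  foot : ∀ y ∈ Ω, dist y a < rg → ∃ b ∈ frontier Ω, y = b + δ y • ν b ∧ ν y = ν b
  ray : ∀ b ∈ frontier Ω, ∀ s, 0 < s → s < rg → b + s • ν b ∈ Ω ∧ δ (b + s • ν b) = s

theorem segment_hits {Ω : Set V} {y y' : V} (hy : y ∈ Ω) (hy' : y' ∉ Ω) :
    infDist y (frontier Ω) ≤ dist y y' := by
  have hpc : IsPreconnected (segment ℝ y y') := (convex_segment y y').isPreconnected
  obtain ⟨w, hw, hwf⟩ : ∃ w ∈ segment ℝ y y', w ∈ frontier Ω := by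
    by_contra hc
    push Not at hc
    have hcov : segment ℝ y y' ⊆ interior Ω ∪ (closure Ω)ᶜ := by
      intro w hw
      by_cases h1 : w ∈ interior Ω
      · exact Or.inl h1
      · refine Or.inr fun h2 => hc w hw ⟨h2, h1⟩
    have n1 : (segment ℝ y y' ∩ interior Ω).Nonempty := by
      refine ⟨y, left_mem_segment ℝ y y', ?_⟩
      by_contra h1
      exact hc y (left_mem_segment ℝ y y') ⟨subset_closure hy, h1⟩
    have n2 : (segment ℝ y y' ∩ (closure Ω)ᶜ).Nonempty := by
      refine ⟨y', right_mem_segment ℝ y y', fun h2 => ?_⟩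
      exact hc y' (right_mem_segment ℝ y y') ⟨h2, fun h1 => hy' (interior_subset h1)⟩
    obtain ⟨w, -, h1, h2⟩ := hpc _ _ isOpen_interior isClosed_closure.isOpen_compl hcov n1 n2
    exact h2 (subset_closure (interior_subset h1))
  refine (infDist_le_dist_of_mem hwf).trans ?_
  rw [dist_comm y w, dist_comm y y']
  have := (mem_segment_iff_wbtw.1 hw).dist_add_dist
  rw [dist_comm w y, dist_comm y' y]
  linarith [dist_nonneg (x := w) (y := y')]

theorem geo_int {Ω : Set V} {b ν : V} {r : ℝ} (hr : 0 < r) (hν : ‖ν‖ = 1)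
    (h1 : b + r • ν ∈ Ω) (h2 : infDist (b + r • ν) (frontier Ω) = r) (y : V) :
    (1 / (2 * r) * ‖y - b‖ ^ 2 < ⟪y - b, ν⟫ → y ∈ Ω) ∧
      ⟪y - b, ν⟫ - 1 / (2 * r) * ‖y - b‖ ^ 2 ≤ infDist y (frontier Ω) := by
  have e : ‖y - (b + r • ν)‖ ^ 2 = ‖y - b‖ ^ 2 - 2 * r * ⟪y - b, ν⟫ + r ^ 2 := by
    have : y - (b + r • ν) = (y - b) - r • ν := by abel
    rw [this, norm_sub_sq_real, inner_smul_right, norm_smul, hν, Real.norm_eq_abs, mul_one, sq_abs]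
    ring
  have e2 : 1 / (2 * r) * ‖y - b‖ ^ 2 = ‖y - b‖ ^ 2 / (2 * r) := by ring
  rw [e2]
  constructor
  · intro h
    rw [div_lt_iff₀ (by positivity)] at h
    by_contra hc
    have := segment_hits h1 hc
    rw [h2, dist_comm, dist_eq_norm] at this
    have : r ^ 2 ≤ ‖y - (b + r • ν)‖ ^ 2 := pow_le_pow_left₀ hr.le this 2
    linarith
  · have h3 : infDist (b + r • ν) (frontier Ω) ≤ infDist y (frontier Ω) + dist (b + r • ν) y :=
      infDist_le_infDist_add_dist
    rw [h2, dist_comm, dist_eq_norm] at h3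
    have h4 : ‖y - (b + r • ν)‖ ≤ r - (⟪y - b, ν⟫ - ‖y - b‖ ^ 2 / (2 * r)) := by
      set X := 2 * r * ⟪y - b, ν⟫ - ‖y - b‖ ^ 2 with hX
      have eX : ⟪y - b, ν⟫ - ‖y - b‖ ^ 2 / (2 * r) = X / (2 * r) := by
        rw [hX]; field_simp
      rw [eX]
      have hXr : X ≤ r ^ 2 := by have := sq_nonneg ‖y - (b + r • ν)‖; linarith
      have h5 : 0 ≤ r - X / (2 * r) := by
        have : X / (2 * r) ≤ r ^ 2 / (2 * r) := by gcongr
        have e3 : r ^ 2 / (2 * r) = r / 2 := by field_simp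
        linarith
      apply le_of_sq_le_sq _ h5
      rw [e]
      have e4 : (r - X / (2 * r)) ^ 2 = r ^ 2 - X + (X / (2 * r)) ^ 2 := by field_simp; ring
      rw [e4]
      have := sq_nonneg (X / (2 * r))
      linarith
    linarith

set_option maxHeartbeats 1600000 in
theorem geo_ext {Ω : Set V} {a : V} {ν : V → V} {κ1 : ℝ} (ha : a ∈ frontier Ω)
    (hν : ∀ b ∈ frontier Ω, ‖ν b‖ = 1)
    (hinside : ∀ b ∈ frontier Ω, ∀ y, κ1 * ‖y - b‖ ^ 2 < ⟪y - b, ν b⟫ → y ∈ Ω)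
    (hκ1 : 0 < κ1)
    {f : V → ℝ} {U : Set V} (hU : U ∈ nhds a) (hf : ContDiffOn ℝ 2 f U)
    (hf0 : ∀ y ∈ U, fderiv ℝ f y ≠ 0) (hfΩ : U ∩ Ω = U ∩ {y | f y < 0})
    (hfb : U ∩ frontier Ω = U ∩ {y | f y = 0}) :
    ∃ κ > 0, ∃ rg > 0, ∀ b ∈ frontier Ω, dist b a < rg → ∀ y ∈ Ω, dist y b < rg →
      infDist y (frontier Ω) ≤ ⟪y - b, ν b⟫ + κ * ‖y - b‖ ^ 2 := by
  have haU : a ∈ U := mem_of_mem_nhds hU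
  have hfa : ContDiffAt ℝ 2 f a := hf.contDiffAt hU
  have hdf : ContDiffAt ℝ 1 (fderiv ℝ f) a := hfa.fderiv_right (by norm_num)
  obtain ⟨Λ, W, hW, hLip⟩ := hdf.exists_lipschitzOnWith
  set m := ‖fderiv ℝ f a‖ / 2 with hm
  have hfa0 : 0 < ‖fderiv ℝ f a‖ := norm_pos_iff.2 (hf0 a haU)
  have hmpos : 0 < m := by positivity
  have hm2 : ∀ᶠ y in nhds a, m < ‖fderiv ℝ f y‖ :=
    hdf.continuousAt.norm.eventually (lt_mem_nhds (by linarith))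
  have hdiff : ∀ᶠ y in nhds a, DifferentiableAt ℝ f y := by
    filter_upwards [hfa.eventually (by simp)] with y hy
    exact hy.differentiableAt (by norm_num)
  obtain ⟨r1, hr1, hball⟩ := Metric.eventually_nhds_iff_ball.1
    ((((show ∀ᶠ y in nhds a, y ∈ U from hU).and hW).and hm2).and hdiff)
  set L : ℝ := (Λ : ℝ) + 1 with hL
  have hLpos : 0 < L := by positivity
  have hquad : ∀ b ∈ ball a r1, ∀ y ∈ ball a r1,
      |f y - f b - fderiv ℝ f b (y - b)| ≤ L * ‖y - b‖ ^ 2 := by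
    intro b hb y hy
    have hseg : segment ℝ b y ⊆ ball a r1 := (convex_ball a r1).segment_subset hb hy
    have := (convex_segment b y).norm_image_sub_le_of_norm_hasFDerivWithin_le' (f := f)
      (f' := fun x => fderiv ℝ f x) (φ := fderiv ℝ f b) (C := L * ‖y - b‖)
      (fun x hx => (hball x (hseg hx)).2.hasFDerivAt.hasFDerivWithinAt) (fun x hx => by
        have h1 := hLip.dist_le_mul x (hball x (hseg hx)).1.1.2 b (hball b hb).1.1.2
        rw [dist_eq_norm] at h1
        have h2 : dist x b ≤ ‖y - b‖ := by
          have := (mem_segment_iff_wbtw.1 hx).dist_add_dist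
          rw [← dist_eq_norm, dist_comm y b, dist_comm x b]
          linarith [dist_nonneg (x := x) (y := y)]
        refine h1.trans ?_
        have : (Λ : ℝ) ≤ L := by rw [hL]; linarith
        gcongr) (left_mem_segment ℝ b y) (right_mem_segment ℝ b y)
    rw [Real.norm_eq_abs] at this
    calc _ ≤ _ := this
      _ = _ := by ring
  -- direction of the derivative at boundary points
  have hdir : ∀ b ∈ frontier Ω, b ∈ ball a r1 → ∃ μ, m ≤ μ ∧
      ∀ w, fderiv ℝ f b w = - μ * ⟪w, ν b⟫ := by
    intro b hb hba
    have hbU := (hball b hba).1.1.1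
    have hfb0 : f b = 0 := by
      have : b ∈ U ∩ {y | f y = 0} := hfb ▸ ⟨hbU, hb⟩
      exact this.2
    have hle : ∀ w, 0 < ⟪w, ν b⟫ → fderiv ℝ f b w ≤ 0 := by
      intro w hw
      have hl : HasDerivAt (fun s : ℝ => b + s • w) w 0 := by
        simpa using ((hasDerivAt_id (0:ℝ)).smul_const w).const_add b
      have hD : HasFDerivAt f (fderiv ℝ f b) (b + (0:ℝ) • w) := by
        simpa using (hball b hba).2.hasFDerivAt
      have hd := (hD.comp_hasDerivAt (0:ℝ) hl).hasDerivWithinAt (s := Ioi 0)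
      rw [hasDerivWithinAt_iff_tendsto_slope' (by simp)] at hd
      refine le_of_tendsto hd ?_
      have hin : ∀ᶠ s in nhdsWithin (0:ℝ) (Ioi 0), b + s • w ∈ U := by
        have hUb : U ∈ nhds b := by
          filter_upwards [isOpen_ball.mem_nhds hba] with z hz using (hball z hz).1.1.1
        have : Tendsto (fun s : ℝ => b + s • w) (nhds 0) (nhds b) := by
          simpa using hl.continuousAt.tendsto
        exact (this.mono_left nhdsWithin_le_nhds).eventually hUb
      have hin2 : ∀ᶠ s in nhdsWithin (0:ℝ) (Ioi 0), κ1 * s * ‖w‖ ^ 2 < ⟪w, ν b⟫ := by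
        have : Tendsto (fun s : ℝ => κ1 * s * ‖w‖ ^ 2) (nhds 0) (nhds 0) := by
          have : Continuous (fun s : ℝ => κ1 * s * ‖w‖ ^ 2) := by fun_prop
          simpa using this.tendsto 0
        exact (this.mono_left nhdsWithin_le_nhds).eventually (gt_mem_nhds hw)
      filter_upwards [hin, hin2, self_mem_nhdsWithin] with s h1 h2 h3
      have hs : 0 < s := h3
      have hΩ : b + s • w ∈ Ω := by
        apply hinside b hb
        rw [add_sub_cancel_left, norm_smul, inner_smul_left, Real.norm_eq_abs, mul_pow, sq_abs]
        simp only [conj_trivial]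
        have := mul_lt_mul_of_pos_left h2 hs
        calc κ1 * (s ^ 2 * ‖w‖ ^ 2) = s * (κ1 * s * ‖w‖ ^ 2) := by ring
          _ < _ := this
      have hneg : f (b + s • w) < 0 := by
        have : b + s • w ∈ U ∩ {y | f y < 0} := hfΩ ▸ ⟨h1, hΩ⟩
        exact this.2
      rw [slope_def_field]
      apply div_nonpos_of_nonpos_of_nonneg
      · simp only [Function.comp, zero_smul, add_zero, hfb0]; linarith
      · linarith
    set μ := - fderiv ℝ f b (ν b) with hμ
    have hνν : ⟪ν b, ν b⟫ = 1 := by rw [real_inner_self_eq_norm_sq, hν b hb]; norm_num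
    have hμ0 : 0 ≤ μ := by
      have := hle (ν b) (by rw [hνν]; norm_num)
      linarith
    have hle2 : ∀ w, ⟪w, ν b⟫ = 0 → fderiv ℝ f b w ≤ 0 := by
      intro w hw
      by_contra hc
      push Not at hc
      set q := fderiv ℝ f b w
      have := hle ((2 * (μ + 1)) • w + q • ν b) (by
        rw [inner_add_left, inner_smul_left, inner_smul_left, hw, hνν]; simpa using hc)
      rw [map_add, map_smul, map_smul] at this
      have e : fderiv ℝ f b (ν b) = - μ := by rw [hμ]; ring
      rw [e] at this
      simp only [smul_eq_mul] at this
      have : q * (μ + 2) ≤ 0 := by linarith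
      have : 0 < q * (μ + 2) := by positivity
      linarith
    have heq : ∀ w, fderiv ℝ f b w = - μ * ⟪w, ν b⟫ := by
      intro w
      have h1 : ⟪w - ⟪w, ν b⟫ • ν b, ν b⟫ = 0 := by
        rw [inner_sub_left, inner_smul_left, hνν]; simp
      have h2 := hle2 _ h1
      have h3 := hle2 (-(w - ⟪w, ν b⟫ • ν b)) (by rw [inner_neg_left, h1, neg_zero])
      rw [map_neg] at h3
      have h4 : fderiv ℝ f b (w - ⟪w, ν b⟫ • ν b) = 0 := by linarith
      rw [map_sub, map_smul, smul_eq_mul] at h4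
      rw [hμ]; linarith
    refine ⟨μ, ?_, heq⟩
    refine (hball b hba).1.2.le.trans ?_
    apply ContinuousLinearMap.opNorm_le_bound _ hμ0
    intro w
    rw [heq w, Real.norm_eq_abs, abs_mul, abs_neg, abs_of_nonneg hμ0]
    have := abs_real_inner_le_norm w (ν b)
    rw [hν b hb, mul_one] at this
    gcongr
  set κ := 2 * L / m with hκ
  have hκpos : 0 < κ := by positivity
  have hκm : κ * m = 2 * L := by rw [hκ]; field_simp
  set rg := min (r1 / 4) (min 1 (1 / κ)) with hrg
  have hrg0 : 0 < rg := by positivity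
  have hrg1 : rg ≤ r1 / 4 := min_le_left _ _
  have hrg2 : rg ≤ 1 := (min_le_right _ _).trans (min_le_left _ _)
  have hrg3 : rg ≤ 1 / κ := (min_le_right _ _).trans (min_le_right _ _)
  refine ⟨κ, hκpos, rg, hrg0, ?_⟩
  intro b hb hba y hy hyb
  have hbB : b ∈ ball a r1 := by rw [mem_ball]; linarith
  have hyB : y ∈ ball a r1 := by
    rw [mem_ball]; linarith [dist_triangle y b a]
  obtain ⟨μ, hμm, hμ⟩ := hdir b hb hbB
  have hfb0 : f b = 0 := by
    have : b ∈ U ∩ {y | f y = 0} := hfb ▸ ⟨(hball b hbB).1.1.1, hb⟩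
    exact this.2
  have hfy : f y < 0 := by
    have : y ∈ U ∩ {y | f y < 0} := hfΩ ▸ ⟨(hball y hyB).1.1.1, hy⟩
    exact this.2
  have hq := abs_le.1 (hquad b hbB y hyB)
  rw [hμ, hfb0] at hq
  set s := ⟪y - b, ν b⟫ with hs
  set D := ‖y - b‖ with hD
  have hD0 : 0 ≤ D := norm_nonneg _
  have hDrg : D < rg := by rw [hD, ← dist_eq_norm]; exact hyb
  have hκD : κ * D ≤ 1 := by
    have : D ≤ 1 / κ := by linarith
    calc κ * D ≤ κ * (1 / κ) := by gcongr
      _ = 1 := by field_simp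
  have hμpos : 0 < μ := by linarith
  have hμκ : 2 * L ≤ μ * κ := by rw [← hκm, mul_comm]; gcongr
  have hα : 0 ≤ s + κ * D ^ 2 := by
    by_contra hc
    push Not at hc
    have h1 : μ * (s + κ * D ^ 2) < 0 := mul_neg_of_pos_of_neg hμpos hc
    have h2 : 0 ≤ (μ * κ - 2 * L) * D ^ 2 := by
      have : 0 ≤ μ * κ - 2 * L := by linarith
      positivity
    have h3 : 0 ≤ L * D ^ 2 := by positivity
    nlinarith [hq.1]
  set α := s + κ * D ^ 2 with hαd
  have hDν : ‖ν b‖ = 1 := hν b hb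
  have hνν : ⟪ν b, ν b⟫ = 1 := by rw [real_inner_self_eq_norm_sq, hDν]; norm_num
  set y' := y - α • ν b with hy'
  have hsD : |s| ≤ D := by
    have := abs_real_inner_le_norm (y - b) (ν b)
    rwa [hDν, mul_one] at this
  have hin' : ⟪y' - b, ν b⟫ = - κ * D ^ 2 := by
    have : y' - b = (y - b) - α • ν b := by rw [hy']; abel
    rw [this, inner_sub_left, inner_smul_left, hνν]
    simp only [conj_trivial, mul_one]
    rw [hαd]; ring
  have hn' : ‖y' - b‖ ^ 2 ≤ 2 * D ^ 2 := by
    have : y' - b = (y - b) - α • ν b := by rw [hy']; abel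
    rw [this, norm_sub_sq_real, inner_smul_right, norm_smul, hDν, mul_one, Real.norm_eq_abs, sq_abs]
    rw [← hs, ← hD]
    have e : D ^ 2 - 2 * (α * s) + α ^ 2 = D ^ 2 - s ^ 2 + (κ * D) ^ 2 * D ^ 2 := by rw [hαd]; ring
    rw [e]
    have h1 : (κ * D) ^ 2 ≤ 1 := by
      have : 0 ≤ κ * D := by positivity
      nlinarith
    have h2 : (κ * D) ^ 2 * D ^ 2 ≤ 1 * D ^ 2 := by gcongr
    nlinarith [sq_nonneg s]
  have hy'B : y' ∈ ball a r1 := by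
    rw [mem_ball]
    have h1 : ‖y' - b‖ ≤ 2 * D := by
      apply le_of_sq_le_sq _ (by positivity)
      nlinarith
    have := dist_triangle y' b a
    rw [dist_eq_norm y' b] at this
    linarith
  have hy'Ω : y' ∉ Ω := by
    intro hc
    have hneg : f y' < 0 := by
      have : y' ∈ U ∩ {y | f y < 0} := hfΩ ▸ ⟨(hball y' hy'B).1.1.1, hc⟩
      exact this.2
    have hq' := abs_le.1 (hquad b hbB y' hy'B)
    rw [hμ, hfb0, hin'] at hq'
    have h1 : L * ‖y' - b‖ ^ 2 ≤ L * (2 * D ^ 2) := by gcongr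
    have h2 : 0 ≤ (μ * κ - 2 * L) * D ^ 2 := by
      have : 0 ≤ μ * κ - 2 * L := by linarith
      positivity
    nlinarith [hq'.1]
  refine (segment_hits hy hy'Ω).trans (le_of_eq ?_)
  rw [dist_eq_norm, hy', sub_sub_cancel, norm_smul, hDν, mul_one, Real.norm_eq_abs,
    abs_of_nonneg hα]

theorem geo_foot {Ω : Set V} {δ : V → ℝ} (hδ : ∀ x, δ x = infDist x (frontier Ω))
    {y b ν : V} (hy : 0 < δ y) (hb : b ∈ frontier Ω) (hyb : dist y b = δ y) (hν : ‖ν‖ = 1)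
    (hg : HasGradientAt δ ν y) : y = b + δ y • ν := by
  set d := δ y with hd
  set w := d⁻¹ • (y - b) with hw
  have hwn : ‖w‖ = 1 := by
    rw [hw, norm_smul, ← dist_eq_norm, hyb, norm_inv, Real.norm_eq_abs, abs_of_pos hy]
    field_simp
  have hdw : d • w = y - b := by rw [hw, smul_smul, mul_inv_cancel₀ hy.ne', one_smul]
  have hδy : ∀ s, 0 ≤ s → s ≤ d → δ (y - s • w) = d - s := by
    intro s h0 h1
    apply le_antisymm
    · rw [hδ]
      refine (infDist_le_dist_of_mem hb).trans (le_of_eq ?_)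
      have : y - s • w - b = (d - s) • w := by rw [sub_smul, hdw]; abel
      rw [dist_eq_norm, this, norm_smul, hwn, mul_one, Real.norm_eq_abs, abs_of_nonneg (by linarith)]
    · have h3 : infDist y (frontier Ω) ≤ infDist (y - s • w) (frontier Ω) + dist y (y - s • w) :=
        infDist_le_infDist_add_dist
      rw [← hδ, ← hδ, dist_eq_norm, sub_sub_cancel, norm_smul, hwn, mul_one, Real.norm_eq_abs,
        abs_of_nonneg h0] at h3
      linarith
  have hl : HasDerivAt (fun s : ℝ => y - s • w) (-w) 0 := by
    simpa using ((hasDerivAt_id (0:ℝ)).smul_const w).const_sub y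
  have hD : HasFDerivAt δ (InnerProductSpace.toDual ℝ V ν) (y - (0:ℝ) • w) := by
    simpa using hg.hasFDerivAt
  have hd1 := (hD.comp_hasDerivAt (0:ℝ) hl).hasDerivWithinAt (s := Ioi 0)
  have hd2 : HasDerivWithinAt (δ ∘ fun s : ℝ => y - s • w) (-1) (Ioi 0) 0 := by
    have : HasDerivWithinAt (fun s : ℝ => d - s) (-1) (Ioi 0) 0 := by
      simpa using ((hasDerivAt_id (0:ℝ)).const_sub d).hasDerivWithinAt (s := Ioi 0)
    refine this.congr_of_eventuallyEq ?_ ?_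
    · filter_upwards [Ioo_mem_nhdsGT hy] with s hs
      exact hδy s hs.1.le hs.2.le
    · exact hδy 0 le_rfl hy.le
  have h3 := (uniqueDiffWithinAt_Ioi (0:ℝ)).eq_deriv (Ioi 0) hd1 hd2
  have h4 : ⟪ν, w⟫ = 1 := by
    have : (InnerProductSpace.toDual ℝ V ν) (-w) = - ⟪ν, w⟫ := by simp
    rw [this] at h3; linarith
  have h5 : ν = w := (inner_eq_one_iff_of_norm_eq_one hν hwn).1 h4
  rw [h5, hdw]; abel
end Geom


section Pw
variable {p β : ℝ}
theorem beta_pos (hp : 2 < p) (hβ : β = 1 / (p - 1)) : 0 < β ∧ β < 1 ∧ β * (p - 1) = 1 := by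
  have : 0 < p - 1 := by linarith
  refine ⟨by rw [hβ]; positivity, ?_, by rw [hβ]; field_simp⟩
  rw [hβ, div_lt_one this]; linarith

theorem pw1 {x : ℝ} (hx : 0 < x) (β : ℝ) : x ^ (-β) = x ^ (1 - β) / x := by
  rw [show (-β) = (1 - β) - 1 by ring, Real.rpow_sub_one hx.ne']

theorem pw2 (hp : 2 < p) (hβ : β = 1 / (p - 1)) {c x : ℝ} (hc : 0 ≤ c) (hx : 0 < x) :
    (c * x ^ (-β)) ^ (p - 1) = c ^ (p - 1) / x := by
  rw [Real.mul_rpow hc (Real.rpow_nonneg hx.le _), ← Real.rpow_mul hx.le,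
    show -β * (p - 1) = -1 by linarith [(beta_pos hp hβ).2.2], Real.rpow_neg_one]
  rfl

theorem pw3 (hp : 2 < p) (hβ : β = 1 / (p - 1)) {c x : ℝ} (hc : 0 ≤ c) (hx : 0 < x) :
    (c * x ^ (-β)) ^ p = c ^ p * x ^ (1 - β) / x ^ 2 := by
  rw [Real.mul_rpow hc (Real.rpow_nonneg hx.le _), ← Real.rpow_mul hx.le,
    show -β * p = (1 - β) - (2:ℕ) by push_cast; linarith [(beta_pos hp hβ).2.2], Real.rpow_sub_natCast hx.ne']
  ring

theorem pw_anti {x y : ℝ} (hβ : 0 ≤ β) (hx : 0 < x) (hxy : x ≤ y) : y ^ (-β) ≤ x ^ (-β) :=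
  Real.rpow_le_rpow_of_nonpos hx hxy (by linarith)

theorem pw_mono {x y : ℝ} (hβ : β ≤ 1) (hx : 0 ≤ x) (hxy : x ≤ y) : x ^ (1 - β) ≤ y ^ (1 - β) :=
  Real.rpow_le_rpow hx hxy (by linarith)
end Pw

section Ell
variable {V : Type*} [NormedAddCommGroup V] [InnerProductSpace ℝ V] [FiniteDimensional ℝ V]
  [CompleteSpace V]

theorem Jet.shift {v : V → ℝ} {y g h : V} {l : ℝ} (j : Jet v (y + h) g l) :
    Jet (fun z => v (z + h)) y g l := by
  have ha : ∀ x, ContinuousLinearMap.adjoint (ContinuousLinearMap.id ℝ V) x = x := fun x =>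
    ext_inner_left ℝ fun w => by rw [ContinuousLinearMap.adjoint_inner_right]; rfl
  have := Jet.coisom (v := v) (g := g) (l := l) (ContinuousLinearMap.id ℝ V) h y (fun x => ha x) j
  rw [ha] at this
  exact this

/-- elliptic comparison with drift -/
theorem barE {w : V → ℝ} {K : Set V} (hK : IsCompact K) (hc : ContinuousOn w K) {e b y0 : V}
    (he : ‖e‖ = 1) {k m f c0 c1 c2 K1 L L' R' : ℝ} (hk : 0 ≤ k) (hkm : k ≤ m) (hc1 : 0 ≤ c1) (hc2 : 0 ≤ c2)
    (hK1 : 0 ≤ K1)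
    (hinside : ∀ y ∈ K, c0 + c1 * ‖y - y0‖ ^ 2 + c2 * ‖y - b‖ ^ 2 +
        K1 * (1 - Real.exp (-(m * ⟪y - b, e⟫))) < w y →
      K ∈ nhds y ∧ ∃ g l, Jet w y g l ∧ -(k * ‖g‖ + f) ≤ l)
    (hb : ∀ y ∈ K, ‖y - y0‖ ≤ L ∧ ‖y - b‖ ≤ L' ∧ ⟪y - b, e⟫ ≤ R')
    (hKb : c1 * (2 * Module.finrank ℝ V + 2 * k * L) + c2 * (2 * Module.finrank ℝ V + 2 * k * L') + f
      < K1 * m * (m - k) * Real.exp (-(m * R'))) :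
    ∀ y ∈ K, w y ≤ c0 + c1 * ‖y - y0‖ ^ 2 + c2 * ‖y - b‖ ^ 2 +
        K1 * (1 - Real.exp (-(m * ⟪y - b, e⟫))) := by
  set n : ℝ := (Module.finrank ℝ V : ℝ)
  intro y hy
  have := ell_max (Φ := fun y => w y - (c0 + c1 * ‖y - y0‖ ^ 2 + c2 * ‖y - b‖ ^ 2 +
        K1 * (1 - Real.exp (-(m * ⟪y - b, e⟫))))) hK (hc.sub (by fun_prop)) ?_ y hy
  · simpa using this
  intro y hy hpos
  obtain ⟨hn, g, l, hj, hl⟩ := hinside y hy (by simpa using hpos)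
  have hd : ∀ x : ℝ, HasDerivAt (fun x : ℝ => K1 * (1 - Real.exp (-(m * x))))
      (K1 * m * Real.exp (-(m * x))) x := fun x => by
    have h1 : HasDerivAt (fun x : ℝ => -(m * x)) (-m) x := by
      exact ((hasDerivAt_id x).const_mul m).neg.congr_deriv (by ring)
    exact ((h1.exp.const_sub 1).const_mul K1).congr_deriv (by ring)
  have hd2 : ∀ x : ℝ, HasDerivAt (fun x : ℝ => (K1 * m * Real.exp (-(m * x))))
      (-(K1 * m ^ 2 * Real.exp (-(m * x)))) x := fun x => by
    have h1 : HasDerivAt (fun x : ℝ => -(m * x)) (-m) x := by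
      exact ((hasDerivAt_id x).const_mul m).neg.congr_deriv (by ring)
    exact (h1.exp.const_mul (K1 * m)).congr_deriv (by ring)
  have jψ := (((Jet.const c0 y).add ((Jet.normsq y0 y).const_mul c1)).add
    ((Jet.normsq b y).const_mul c2)).add
    ((Jet.linear b e y).comp (Eventually.of_forall hd) (hd2 _))
  refine ⟨hn, _, _, hj.sub jψ, fun h0 => ?_⟩
  set E := Real.exp (-(m * ⟪y - b, e⟫)) with hE
  have hg : g = c1 • (2:ℝ) • (y - y0) + c2 • (2:ℝ) • (y - b) + (K1 * m * E) • e := by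
    have := sub_eq_zero.1 h0
    rw [this, zero_add]
  have hE0 : 0 < E := Real.exp_pos _
  have hbb := hb y hy
  have hm' : 0 ≤ m := hk.trans hkm
  have hgn : ‖g‖ ≤ 2 * c1 * L + 2 * c2 * L' + K1 * m * E := by
    rw [hg]
    refine (norm_add_le _ _).trans (add_le_add ((norm_add_le _ _).trans (add_le_add ?_ ?_)) ?_)
    · rw [norm_smul, norm_smul, Real.norm_eq_abs, abs_of_nonneg hc1]; norm_num
      nlinarith [hbb.1]
    · rw [norm_smul, norm_smul, Real.norm_eq_abs, abs_of_nonneg hc2]; norm_num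
      nlinarith [hbb.2.1]
    · rw [norm_smul, he, Real.norm_eq_abs, abs_of_nonneg (by positivity), mul_one]
  have hEm : Real.exp (-(m * R')) ≤ E := by
    apply Real.exp_le_exp.2
    nlinarith [hbb.2.2]
  have hm : 0 ≤ m := hk.trans hkm
  have h3 : K1 * m * (m - k) * Real.exp (-(m * R')) ≤ K1 * m * (m - k) * E := by
    have : 0 ≤ m - k := by linarith
    gcongr
  have h4 : k * ‖g‖ ≤ k * (2 * c1 * L + 2 * c2 * L' + K1 * m * E) := by gcongr
  rw [he]
  nlinarith

theorem lemGe {v : V → ℝ} {G : V → V} {x0 : V}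
    {R S g k : ℝ} (hR : 0 < R) (hk : 0 ≤ k) (hg : 0 ≤ g)
    (hG : ContinuousOn G (closedBall x0 R))
    (hz : ∀ y ∈ closedBall x0 R, ∃ l, Jet v y (G y) l ∧ |l| ≤ k / R * ‖G y‖ + g)
    (h1 : ∀ y ∈ closedBall x0 R, |v y| ≤ S) :
    ‖G x0‖ ≤ (2 * Module.finrank ℝ V + 1) * (8 * k + 8) * (S / R + g * R) := by
  choose! l hl using hz
  refine lemG (z := fun y _ => v y) (G := fun y _ => G y) (f := fun y _ => - l y) (t0 := 0) hR hk hg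
    ⟨?_, ?_, ?_⟩ (fun y hy t ht => h1 y hy) (fun y hy t ht => by
      simpa using (hl y hy).2)
  · have : ContinuousOn v (closedBall x0 R) := fun y hy =>
      (hl y hy).1.grad.hasFDerivAt.continuousAt.continuousWithinAt
    exact this.comp continuousOn_fst (fun q hq => hq.1)
  · exact hG.comp continuousOn_fst (fun q hq => hq.1)
  · intro y t hyt
    exact ⟨l y, 0, (hl y hyt.1).1, hasDerivAt_const _ _, by simp⟩

/-- a time slice of the solution -/
structure Slice (p β M C1 κ rg : ℝ) (Ω : Set V) (δ : V → ℝ) (ν : V → V) (a : V)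
    (v : V → ℝ) (g : V → V) : Prop where
  geo : Geo Ω δ ν a κ rg
  hp : 2 < p
  hβ : β = 1 / (p - 1)
  hM : 0 ≤ M
  hC : 0 < C1
  jet : ∀ y ∈ Ω, ∃ l, Jet v y (g y) l ∧ |l + ‖g y‖ ^ p| ≤ M
  gc : ContinuousOn g Ω
  grad : ∀ y ∈ Ω, dist y a < rg → ‖g y‖ ≤ C1 * δ y ^ (-β)
  ub : ∀ y ∈ Ω, dist y a < rg → |v y| ≤ C1 * δ y ^ (1 - β)
  cont : ContinuousOn v (closure Ω)
  bd : ∀ b ∈ frontier Ω, v b = 0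
  fin : ∃ C, ∀ y ∈ Ω, ‖g y‖ ≤ C

variable {p β M C1 κ rg : ℝ} {Ω : Set V} {δ : V → ℝ} {ν : V → V} {a : V} {v : V → ℝ} {g : V → V}

theorem Slice.zjet (h : Slice p β M C1 κ rg Ω δ ν a v g) {y c : V} (hy : y ∈ Ω) (hyc : y + c ∈ Ω)
    {N : ℝ} (h1 : ‖g y‖ ≤ N) (h2 : ‖g (y + c)‖ ≤ N) :
    ∃ l, Jet (fun z => v (z + c) - v z) y (g (y + c) - g y) l ∧
      |l| ≤ p * N ^ (p - 1) * ‖g (y + c) - g y‖ + 2 * M := by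
  obtain ⟨l1, j1, b1⟩ := h.jet _ hy
  obtain ⟨l2, j2, b2⟩ := h.jet _ hyc
  refine ⟨_, j2.shift.sub j1, ?_⟩
  have := abs_le.1 (normpow_lip (p := p) (by linarith [h.hp]) h2 h1)
  rw [abs_le] at *
  constructor <;> linarith

theorem Geo.dpos (h : Geo Ω δ ν a κ rg) {y : V} (hy : y ∈ Ω) : 0 < δ y := by
  rw [h.dd]
  apply (isClosed_frontier.notMem_iff_infDist_pos ⟨a, h.ha⟩).1
  intro h1
  rw [h.op.frontier_eq] at h1
  exact h1.2 hy
theorem Geo.pt (h : Geo Ω δ ν a κ rg) {b y : V} (hb : b ∈ frontier Ω) (hba : dist b a < rg / 2)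
    (hs : 0 < ⟪y - b, ν b⟫) (h1 : κ * ‖y - b‖ ^ 2 ≤ ⟪y - b, ν b⟫ / 2) (h2 : ‖y - b‖ < rg / 2) :
    y ∈ Ω ∧ ⟪y - b, ν b⟫ / 2 ≤ δ y ∧ δ y ≤ 2 * ⟪y - b, ν b⟫ ∧ dist y a < rg := by
  have hy : y ∈ Ω := h.int b hb y (by linarith)
  have hr := h.hrg
  have h3 : dist y b < rg / 2 := by rw [dist_eq_norm]; exact h2
  refine ⟨hy, by linarith [h.dlow b hb y], ?_, by linarith [dist_triangle y b a]⟩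
  linarith [h.ext b hb (by linarith) y hy (by linarith)]

theorem Geo.inner_le (h : Geo Ω δ ν a κ rg) {b y : V} (hb : b ∈ frontier Ω) :
    ⟪y - b, ν b⟫ ≤ ‖y - b‖ := by
  have := real_inner_le_norm (y - b) (ν b)
  rwa [h.nrm b hb, mul_one] at this
end Ell


section LemA
variable {V : Type*} [NormedAddCommGroup V] [InnerProductSpace ℝ V] [FiniteDimensional ℝ V]
  [CompleteSpace V]
variable {p β M C1 κ rg : ℝ} {Ω : Set V} {δ : V → ℝ} {ν : V → V} {a : V} {v : V → ℝ} {g : V → V}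

set_option maxHeartbeats 1600000 in
theorem lemA0 (S : Slice p β M C1 κ rg Ω δ ν a v g) {b : V} (hb : b ∈ frontier Ω)
    (hba : dist b a < rg / 2) {θ1 r R' L k1 CR D ϱ X : ℝ} (hϱ : 0 < ϱ) (hX : X = ϱ ^ (1 - β))
    (hθ : 0 < θ1) (hr : 0 < r) (hr1 : r ≤ 1) (hR : 17 ≤ R') (hL : 1 ≤ L)
    (hk1 : k1 = p * C1 ^ (p - 1) * (2 / r)) (hCR : CR = 2 * (C1 * (2 * R') ^ (1 - β)))
    (h1 : 2 * (C1 * (2 * r) ^ (1 - β)) ≤ θ1) (h2 : 8 * (C1 * (R' / 2) ^ (-β)) ≤ θ1)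
    (h3 : CR / L ^ 2 * (2 * Module.finrank ℝ V + 2 * k1 * L) ≤ D)
    (hD : D = θ1 * (k1 + 1) * Real.exp (-((k1 + 1) * R')) / 2) (h4 : 2 * M * ϱ ^ 2 < D * X)
    (h5 : κ * (L + R' + 24) ^ 2 * ϱ ≤ r / 2) (h6 : (L + R' + 24) * ϱ < rg / 2)
    {y0 c : V} (hy0 : ‖y0 - b‖ ≤ 16 * ϱ) (hc : ⟪c, ν b⟫ = 0) (hcn : ‖c‖ ≤ 8 * ϱ)
    (hy0Ω : y0 ∈ Ω) (hycΩ : y0 + c ∈ Ω) : v (y0 + c) - v y0 ≤ 2 * θ1 * X := by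
  have G := S.geo
  have hκ := G.hκ
  have hrg := G.hrg
  have hC := S.hC
  have hp := S.hp
  obtain ⟨β0, β1, β2⟩ := beta_pos S.hp S.hβ
  have hX0 : 0 < X := by rw [hX]; positivity
  set Λ := L + R' + 24 with hΛ
  have hsc : ∀ y, ⟪y + c - b, ν b⟫ = ⟪y - b, ν b⟫ := fun y => by
    rw [show y + c - b = (y - b) + c by abel, inner_add_left, hc, add_zero]
  have hnc : ∀ y, ‖y + c - b‖ ≤ ‖y - b‖ + 8 * ϱ := fun y => by
    rw [show y + c - b = (y - b) + c by abel]
    exact (norm_add_le _ _).trans (by linarith)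
  have hsq : ∀ y : V, ‖y - b‖ ≤ Λ * ϱ → κ * ‖y - b‖ ^ 2 ≤ r * ϱ / 2 := fun y hy => by
    have : ‖y - b‖ ^ 2 ≤ (Λ * ϱ) ^ 2 := by gcongr
    calc κ * ‖y - b‖ ^ 2 ≤ κ * (Λ * ϱ) ^ 2 := by gcongr
      _ = (κ * Λ ^ 2 * ϱ) * ϱ := by ring
      _ ≤ r / 2 * ϱ := by gcongr
      _ = _ := by ring
  have hpt : ∀ y : V, ‖y - b‖ ≤ Λ * ϱ → r * ϱ ≤ ⟪y - b, ν b⟫ →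
      y ∈ Ω ∧ ⟪y - b, ν b⟫ / 2 ≤ δ y ∧ δ y ≤ 2 * ⟪y - b, ν b⟫ ∧ dist y a < rg := fun y hy hs => by
    have : 0 < r * ϱ := by positivity
    exact G.pt hb hba (by linarith) (by linarith [hsq y hy]) (by linarith)
  have hup : ∀ y ∈ Ω, ‖y - b‖ ≤ Λ * ϱ → ∀ q, r ≤ q → ⟪y - b, ν b⟫ ≤ q * ϱ →
      |v y| ≤ C1 * (2 * q) ^ (1 - β) * X := fun y hy hyb q hq hs => by
    have e1 : dist y b < rg / 2 := by rw [dist_eq_norm]; linarith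
    have e2 := G.ext b hb (by linarith) y hy (by linarith)
    have e3 : r * ϱ ≤ q * ϱ := by gcongr
    have e4 : δ y ≤ 2 * q * ϱ := by linarith [hsq y hyb, G.dpos hy]
    refine (S.ub y hy (by linarith [dist_triangle y b a])).trans ?_
    rw [hX, mul_assoc, ← Real.mul_rpow (by linarith) hϱ.le]
    have := pw_mono β1.le (G.dpos hy).le e4
    gcongr
  by_cases hs0 : ⟪y0 - b, ν b⟫ ≤ r * ϱ
  · have e1 := abs_le.1 (hup y0 hy0Ω (by nlinarith) r le_rfl hs0)
    have e2 := abs_le.1 (hup (y0 + c) hycΩ (by have := hnc y0; nlinarith) r le_rfl (by rw [hsc]; exact hs0))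
    have : 2 * (C1 * (2 * r) ^ (1 - β)) * X ≤ θ1 * X := by gcongr
    nlinarith
  push Not at hs0
  have hk10 : 0 ≤ k1 := by rw [hk1]; positivity
  have hCR0 : 0 ≤ CR := by rw [hCR]; positivity
  set K : Set V := {y | r * ϱ ≤ ⟪y - b, ν b⟫ ∧ ⟪y - b, ν b⟫ ≤ R' * ϱ ∧ ‖y - y0‖ ≤ L * ϱ} with hKd
  have hKb : ∀ y ∈ K, ‖y - b‖ ≤ (L + 16) * ϱ := fun y hy => by
    have := norm_sub_le_norm_sub_add_norm_sub y y0 b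
    linarith [hy.2.2]
  have cs : Continuous fun y : V => ⟪y - b, ν b⟫ := by fun_prop
  have cn : Continuous fun y : V => ‖y - y0‖ := by fun_prop
  have hKc : IsCompact K := by
    refine (isCompact_closedBall y0 (L * ϱ)).of_isClosed_subset ?_ (fun y hy => by
      rw [mem_closedBall, dist_eq_norm]; exact hy.2.2)
    exact (isClosed_le continuous_const cs).inter
      ((isClosed_le cs continuous_const).inter (isClosed_le cn continuous_const))
  have hKy : ∀ y ∈ K, y ∈ Ω ∧ ⟪y - b, ν b⟫ / 2 ≤ δ y ∧ δ y ≤ 2 * ⟪y - b, ν b⟫ ∧ dist y a < rg :=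
    fun y hy => hpt y (by have := hKb y hy; nlinarith) hy.1
  have hKyc : ∀ y ∈ K, y + c ∈ Ω ∧ ⟪y - b, ν b⟫ / 2 ≤ δ (y + c) ∧ δ (y + c) ≤ 2 * ⟪y - b, ν b⟫ ∧
      dist (y + c) a < rg := fun y hy => by
    have := hpt (y + c) (by have := hKb y hy; have := hnc y; nlinarith) (by rw [hsc]; exact hy.1)
    rwa [hsc] at this
  have hz : ∀ y ∈ K, |v (y + c) - v y| ≤ CR * X := fun y hy => by
    have e1 := hup y (hKy y hy).1 (by have := hKb y hy; nlinarith) R' (by linarith) hy.2.1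
    have e2 := hup (y + c) (hKyc y hy).1 (by have := hKb y hy; have := hnc y; nlinarith) R' (by linarith)
      (by rw [hsc]; exact hy.2.1)
    rw [hCR]
    rw [abs_le] at *
    constructor <;> linarith
  have hcontv : ContinuousOn v Ω := S.cont.mono subset_closure
  have key := barE (w := fun y => v (y + c) - v y) hKc (e := ν b) (b := b) (y0 := y0)
    (k := k1 / ϱ) (m := (k1 + 1) / ϱ) (f := 2 * M) (c0 := θ1 * X) (c1 := CR * X / (L * ϱ) ^ 2) (c2 := 0)
    (K1 := θ1 * X) (L := L * ϱ) (L' := (L + 16) * ϱ) (R' := R' * ϱ) ?_ (G.nrm b hb) (by positivity)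
    (by gcongr; linarith) (by positivity) le_rfl (by positivity) ?_
    (fun y hy => ⟨hy.2.2, hKb y hy, hy.2.1⟩) ?_ y0 ?_
  · refine key.trans ?_
    simp only [sub_self, norm_zero]
    have : 0 < Real.exp (-((k1 + 1) / ϱ * ⟪y0 - b, ν b⟫)) := Real.exp_pos _
    have : 0 < θ1 * X := by positivity
    nlinarith
  · refine ContinuousOn.sub (hcontv.comp (by fun_prop) fun y hy => (hKyc y hy).1)
      (hcontv.mono fun y hy => (hKy y hy).1)
  · intro y hy hlt
    have hexp : Real.exp (-((k1 + 1) / ϱ * ⟪y - b, ν b⟫)) ≤ 1 := by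
      apply Real.exp_le_one_iff.2
      have : 0 < r * ϱ := by positivity
      have : 0 < ⟪y - b, ν b⟫ := by linarith [hy.1]
      have : 0 ≤ (k1 + 1) / ϱ * ⟪y - b, ν b⟫ := by positivity
      linarith
    have hlt' : θ1 * X + CR * X / (L * ϱ) ^ 2 * ‖y - y0‖ ^ 2 < v (y + c) - v y := by
      have : 0 ≤ θ1 * X * (1 - Real.exp (-((k1 + 1) / ϱ * ⟪y - b, ν b⟫))) :=
        mul_nonneg (by positivity) (by linarith)
      linarith
    have hlt1 : θ1 * X < v (y + c) - v y := by
      have : 0 ≤ CR * X / (L * ϱ) ^ 2 * ‖y - y0‖ ^ 2 := by positivity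
      linarith
    have f1 : r * ϱ < ⟪y - b, ν b⟫ := by
      rcases lt_or_eq_of_le hy.1 with h | h
      · exact h
      have e1 := abs_le.1 (hup y (hKy y hy).1 (by have := hKb y hy; nlinarith) r le_rfl h.symm.le)
      have e2 := abs_le.1 (hup (y + c) (hKyc y hy).1 (by have := hKb y hy; have := hnc y; nlinarith) r le_rfl
        (by rw [hsc]; exact h.symm.le))
      have : 2 * (C1 * (2 * r) ^ (1 - β)) * X ≤ θ1 * X := by gcongr
      nlinarith
    have f2 : ⟪y - b, ν b⟫ < R' * ϱ := by
      rcases lt_or_eq_of_le hy.2.1 with h | h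
      · exact h
      exfalso
      have hseg : ∀ w ∈ segment ℝ y (y + c), w ∈ Ω ∧ ‖g w‖ ≤ C1 * (R' * ϱ / 2) ^ (-β) := by
        intro w hw
        rw [segment_eq_image'] at hw
        obtain ⟨q, hq, rfl⟩ := hw
        have i1 : y + q • (y + c - y) - b = (y - b) + q • c := by
          rw [add_sub_cancel_left]; abel
        have i2 : ⟪y + q • (y + c - y) - b, ν b⟫ = R' * ϱ := by
          rw [i1, inner_add_left, inner_smul_left, hc, h]; simp
        have i3 : ‖y + q • (y + c - y) - b‖ ≤ (L + 24) * ϱ := by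
          rw [i1]
          refine (norm_add_le _ _).trans ?_
          rw [norm_smul, Real.norm_eq_abs, abs_of_nonneg hq.1]
          have := hKb y hy
          have : q * ‖c‖ ≤ 1 * (8 * ϱ) := mul_le_mul hq.2 hcn (norm_nonneg _) (by norm_num)
          linarith
        have i4 := hpt (y + q • (y + c - y)) (by nlinarith) (by rw [i2]; nlinarith)
        rw [i2] at i4
        refine ⟨i4.1, (S.grad _ i4.1 i4.2.2.2).trans ?_⟩
        have := pw_anti β0.le (by positivity) i4.2.1
        gcongr
      have := mvt_ball (v := v) (G := g) (convex_segment y (y + c)) (fun w hw => by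
        obtain ⟨l, hl, _⟩ := S.jet w (hseg w hw).1
        exact hl.grad) (fun w hw => (hseg w hw).2) (left_mem_segment ℝ y (y + c)) (right_mem_segment ℝ y (y + c))
      rw [add_sub_cancel_left] at this
      have i5 : C1 * (R' * ϱ / 2) ^ (-β) * ‖c‖ ≤ θ1 * X := by
        have : (R' * ϱ / 2) ^ (-β) = (R' / 2) ^ (-β) * (X / ϱ) := by
          rw [show R' * ϱ / 2 = (R' / 2) * ϱ by ring, Real.mul_rpow (by positivity) hϱ.le, pw1 hϱ, hX]
        rw [this]
        calc C1 * ((R' / 2) ^ (-β) * (X / ϱ)) * ‖c‖ ≤ C1 * ((R' / 2) ^ (-β) * (X / ϱ)) * (8 * ϱ) := by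
              gcongr
          _ = 8 * (C1 * (R' / 2) ^ (-β)) * X := by field_simp
          _ ≤ _ := by gcongr
      linarith [(abs_le.1 this).2]
    have f3 : ‖y - y0‖ < L * ϱ := by
      rcases lt_or_eq_of_le hy.2.2 with h | h
      · exact h
      have e1 := abs_le.1 (hz y hy)
      rw [h, div_mul_cancel₀ _ (by positivity)] at hlt'
      have : 0 < θ1 * X := by positivity
      linarith
    constructor
    · have o : IsOpen {y | r * ϱ < ⟪y - b, ν b⟫ ∧ ⟪y - b, ν b⟫ < R' * ϱ ∧ ‖y - y0‖ < L * ϱ} :=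
        (isOpen_lt continuous_const cs).inter
        ((isOpen_lt cs continuous_const).inter (isOpen_lt cn continuous_const))
      exact mem_of_superset (o.mem_nhds ⟨f1, f2, f3⟩) fun z hz => ⟨hz.1.le, hz.2.1.le, hz.2.2.le⟩
    · have a1 := hKy y hy
      have a2 := hKyc y hy
      have hrp : 0 < r * ϱ / 2 := by positivity
      obtain ⟨l, hl1, hl2⟩ := S.zjet (N := C1 * (r * ϱ / 2) ^ (-β)) a1.1 a2.1
        ((S.grad _ a1.1 a1.2.2.2).trans (by
          have := pw_anti β0.le hrp (show r * ϱ / 2 ≤ δ y by linarith)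
          gcongr))
        ((S.grad _ a2.1 a2.2.2.2).trans (by
          have := pw_anti β0.le hrp (show r * ϱ / 2 ≤ δ (y + c) by linarith)
          gcongr))
      refine ⟨_, l, hl1, ?_⟩
      rw [pw2 hp S.hβ hC.le hrp] at hl2
      have : p * (C1 ^ (p - 1) / (r * ϱ / 2)) = k1 / ϱ := by rw [hk1]; field_simp
      rw [this] at hl2
      exact (abs_le.1 hl2).1
  · simp only [zero_mul, add_zero]
    have q1 : (k1 + 1) / ϱ * (R' * ϱ) = (k1 + 1) * R' := by field_simp
    have q2 : θ1 * X * ((k1 + 1) / ϱ) * ((k1 + 1) / ϱ - k1 / ϱ) * Real.exp (-((k1 + 1) / ϱ * (R' * ϱ)))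
        = 2 * D * X / ϱ ^ 2 := by
      rw [q1, hD]; field_simp; ring
    rw [q2]
    have q3 : CR * X / (L * ϱ) ^ 2 * (2 * (Module.finrank ℝ V : ℝ) + 2 * (k1 / ϱ) * (L * ϱ)) =
      CR / L ^ 2 * (2 * (Module.finrank ℝ V : ℝ) + 2 * k1 * L) * X / ϱ ^ 2 := by
      field_simp
    rw [q3]
    have q4 : 2 * M < D * X / ϱ ^ 2 := by rw [lt_div_iff₀ (by positivity)]; exact h4
    have q5 : CR / L ^ 2 * (2 * (Module.finrank ℝ V : ℝ) + 2 * k1 * L) * X / ϱ ^ 2 ≤ D * X / ϱ ^ 2 := by gcongr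
    have : 2 * D * X / ϱ ^ 2 = D * X / ϱ ^ 2 + D * X / ϱ ^ 2 := by ring
    linarith
  · refine ⟨hs0.le, ?_, by simp; positivity⟩
    have := G.inner_le (y := y0) hb
    nlinarith
theorem pw_small {c q ε : ℝ} (hc : 0 ≤ c) (hq : 0 < q) (hε : 0 < ε) :
    ∃ x0 > 0, ∀ x, 0 ≤ x → x ≤ x0 → c * x ^ q < ε := by
  refine ⟨(ε / (c + 1)) ^ (1 / q), by positivity, fun x hx hx0 => ?_⟩
  have : x ^ q ≤ ε / (c + 1) := by
    calc x ^ q ≤ ((ε / (c + 1)) ^ (1 / q)) ^ q := by gcongr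
      _ = _ := by rw [← Real.rpow_mul (by positivity), one_div_mul_cancel hq.ne', Real.rpow_one]
  calc c * x ^ q ≤ c * (ε / (c + 1)) := by gcongr
    _ < ε := by rw [← mul_div_assoc, div_lt_iff₀ (by linarith)]; nlinarith

theorem pw_sq {β x : ℝ} (hx : 0 < x) : x ^ 2 = x ^ (1 + β) * x ^ (1 - β) := by
  rw [← Real.rpow_add hx, ← Real.rpow_natCast]; norm_num

theorem lemA (V : Type*) [NormedAddCommGroup V] [InnerProductSpace ℝ V] [FiniteDimensional ℝ V]
    [CompleteSpace V] {p β M C1 κ rg : ℝ} (hp : 2 < p) (hβ : β = 1 / (p - 1)) (hM : 0 ≤ M) (hC : 0 < C1)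
    (hκ : 0 < κ) (hrg : 0 < rg) {θ : ℝ} (hθ : 0 < θ) : ∃ ρ0 > 0, ∀ (Ω : Set V) (δ : V → ℝ)
    (ν : V → V) (a : V) (v : V → ℝ) (g : V → V), Slice p β M C1 κ rg Ω δ ν a v g →
    ∀ b ∈ frontier Ω, dist b a < rg / 2 → ∀ ϱ, 0 < ϱ → ϱ ≤ ρ0 → ∀ y0 c : V, ‖y0 - b‖ ≤ 8 * ϱ →
    ⟪c, ν b⟫ = 0 → ‖c‖ ≤ 8 * ϱ → y0 ∈ Ω → y0 + c ∈ Ω → |v (y0 + c) - v y0| ≤ θ * ϱ ^ (1 - β) := by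
  obtain ⟨β0, β1, β2⟩ := beta_pos hp hβ
  set n : ℝ := (Module.finrank ℝ V : ℝ)
  have hn : 0 ≤ n := by positivity
  set θ1 := θ / 2 with hθ1
  have hθ10 : 0 < θ1 := by positivity
  obtain ⟨r0, hr0, hr⟩ := pw_small (c := 2 * C1) (q := 1 - β) (by positivity) (by linarith) hθ10
  set r := min (r0 / 2) 1 with hrd
  have hrp : 0 < r := by positivity
  have hr2 : 2 * (C1 * (2 * r) ^ (1 - β)) ≤ θ1 := by
    have := hr (2 * r) (by positivity) (by have := min_le_left (r0/2) 1; linarith)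
    linarith
  obtain ⟨q0, hq0, hq⟩ := pw_small (c := 8 * C1) (q := β) (by positivity) (by linarith) hθ10
  set R' := max 17 (2 / q0) with hR'
  have hR17 : 17 ≤ R' := le_max_left _ _
  have hR2 : 8 * (C1 * (R' / 2) ^ (-β)) ≤ θ1 := by
    have := hq (R' / 2)⁻¹ (by positivity) (by
      rw [inv_le_comm₀ (by positivity) hq0]
      have : 2 / q0 ≤ R' := le_max_right _ _
      rw [le_div_iff₀ two_pos]; rw [div_le_iff₀ hq0] at this; field_simp; linarith)
    rw [Real.inv_rpow (by positivity), ← Real.rpow_neg (by positivity)] at this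
    linarith
  set k1 := p * C1 ^ (p - 1) * (2 / r) with hk1
  have hk10 : 0 < k1 := by positivity
  set CR := 2 * (C1 * (2 * R') ^ (1 - β)) with hCR
  have hCR0 : 0 < CR := by positivity
  set D := θ1 * (k1 + 1) * Real.exp (-((k1 + 1) * R')) / 2 with hD
  have hD0 : 0 < D := by positivity
  set L := max 1 (CR * (2 * n + 2 * k1) / D) with hL
  have hL1 : 1 ≤ L := le_max_left _ _
  have hL2 : CR / L ^ 2 * (2 * n + 2 * k1 * L) ≤ D := by
    have h1 : CR * (2 * n + 2 * k1) / D ≤ L := le_max_right _ _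
    rw [div_le_iff₀ hD0] at h1
    have h2 : CR * (2 * n + 2 * k1 * L) ≤ CR * (2 * n + 2 * k1) * L := by
      have : 2 * n + 2 * k1 * L ≤ (2 * n + 2 * k1) * L := by nlinarith
      calc _ ≤ CR * ((2 * n + 2 * k1) * L) := by gcongr
        _ = _ := by ring
    rw [div_mul_eq_mul_div, div_le_iff₀ (by positivity)]
    nlinarith
  obtain ⟨x0, hx0, hx⟩ := pw_small (c := 2 * M) (q := 1 + β) (by positivity) (by linarith) hD0
  set Λ := L + R' + 24 with hΛ
  have hΛ0 : 0 < Λ := by linarith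
  refine ⟨min x0 (min (r / (2 * (κ * Λ ^ 2))) (rg / (4 * Λ))), by positivity, ?_⟩
  intro Ω δ ν a v g S b hb hba ϱ hϱ hϱ0 y0 c hy0 hc hcn hy hyc
  have a1 : ϱ ≤ x0 := hϱ0.trans (min_le_left _ _)
  have a2 : ϱ ≤ r / (2 * (κ * Λ ^ 2)) := hϱ0.trans ((min_le_right _ _).trans (min_le_left _ _))
  have a3 : ϱ ≤ rg / (4 * Λ) := hϱ0.trans ((min_le_right _ _).trans (min_le_right _ _))
  rw [le_div_iff₀ (by positivity)] at a2 a3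
  have h4 : 2 * M * ϱ ^ 2 < D * ϱ ^ (1 - β) := by
    rw [pw_sq (β := β) hϱ, ← mul_assoc]
    have := hx ϱ hϱ.le a1
    gcongr
  have main : ∀ y0 c : V, ‖y0 - b‖ ≤ 16 * ϱ →
    ⟪c, ν b⟫ = 0 → ‖c‖ ≤ 8 * ϱ → y0 ∈ Ω → y0 + c ∈ Ω → v (y0 + c) - v y0 ≤ 2 * θ1 * ϱ ^ (1 - β) :=
    fun y0 c h1 h2 h3 h4' h5 => lemA0 S hb hba hϱ rfl hθ10 hrp (min_le_right _ _) hR17 hL1 hk1 hCR hr2 hR2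
      hL2 hD h4 (by linarith) (by linarith) h1 h2 h3 h4' h5
  have m1 := main y0 c (by linarith) hc hcn hy hyc
  have m2 := main (y0 + c) (-c) (by
    rw [show y0 + c - b = (y0 - b) + c by abel]
    exact (norm_add_le _ _).trans (by linarith)) (by rw [inner_neg_left, hc, neg_zero]) (by rwa [norm_neg]) hyc
    (by simpa using hy)
  rw [add_neg_cancel_right] at m2
  have : 2 * θ1 = θ := by rw [hθ1]; ring
  rw [this] at m1 m2
  rw [abs_le]
  constructor <;> linarith
end LemA


section LemC
variable {V : Type*} [NormedAddCommGroup V] [InnerProductSpace ℝ V] [FiniteDimensional ℝ V]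
  [CompleteSpace V]
variable {p β M C1 κ rg : ℝ} {Ω : Set V} {δ : V → ℝ} {ν : V → V} {a : V} {v : V → ℝ} {g : V → V}

theorem Geo.ext' (h : Geo Ω δ ν a κ rg) {b y : V} (hb : b ∈ frontier Ω) (hba : dist b a < rg)
    (hy : y ∈ closure Ω) (hyb : dist y b < rg) : 0 ≤ ⟪y - b, ν b⟫ + κ * ‖y - b‖ ^ 2 := by
  by_contra hcon
  push Not at hcon
  have cf : Continuous fun y : V => ⟪y - b, ν b⟫ + κ * ‖y - b‖ ^ 2 := by fun_prop
  have cd : Continuous fun y : V => dist y b := by fun_prop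
  have o : IsOpen ({y : V | ⟪y - b, ν b⟫ + κ * ‖y - b‖ ^ 2 < 0} ∩ {y | dist y b < rg}) :=
    (isOpen_lt cf continuous_const).inter (isOpen_lt cd continuous_const)
  obtain ⟨z, hz, hzΩ⟩ := mem_closure_iff.1 hy _ o ⟨hcon, hyb⟩
  have h1 := h.ext b hb hba z hzΩ hz.2
  have h2 : ⟪z - b, ν b⟫ + κ * ‖z - b‖ ^ 2 < 0 := hz.1
  linarith [h.dpos hzΩ]

theorem lemC0 (G : Geo Ω δ ν a κ rg) {b : V} (hb : b ∈ frontier Ω) (hba : dist b a < rg)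
    {ϱ S A : ℝ} (hϱ : 0 < ϱ) (hϱr : ϱ < rg) (hS : 0 < S) (hA : A = 8 * Module.finrank ℝ V + 4)
    (hκ : 4 * A * κ * ϱ ≤ 1) {w : V → ℝ} (hc : ContinuousOn w (closure Ω))
    (h0 : ∀ y ∈ frontier Ω, w y ≤ 0) (hSw : ∀ y ∈ closure Ω, ‖y - b‖ ≤ ϱ → w y ≤ S)
    (hw : ∀ y ∈ Ω, ‖y - b‖ ≤ ϱ → ∃ g l, Jet w y g l ∧ (‖g‖ ≤ (4 + 2 * A) * S / ϱ → -(2 * S / ϱ ^ 2) < l))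
    {s : ℝ} (hs : 0 < s) (hsϱ : s ≤ ϱ) (hbs : b + s • ν b ∈ Ω) : w (b + s • ν b) ≤ (2 + A) * S / ϱ * s := by
  set n : ℝ := (Module.finrank ℝ V : ℝ)
  have hn : 0 ≤ n := by positivity
  have hA4 : 4 ≤ A := by rw [hA]; linarith
  have hκ0 := G.hκ
  have he := G.nrm b hb
  set K := closure Ω ∩ closedBall b ϱ with hK
  have hKc : IsCompact K := (isCompact_closedBall b ϱ).inter_left isClosed_closure
  have hKn : ∀ y ∈ K, ‖y - b‖ ≤ ϱ := fun y hy => by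
    have := hy.2; rwa [mem_closedBall, dist_eq_norm] at this
  have hKs : ∀ y ∈ K, |⟪y - b, ν b⟫| ≤ ϱ := fun y hy => by
    have := abs_real_inner_le_norm (y - b) (ν b)
    rw [he, mul_one] at this
    exact this.trans (hKn y hy)
  set ψ : V → ℝ := fun y => 2 * S / ϱ ^ 2 * ‖y - b‖ ^ 2 +
    A * S * (⟪y - b, ν b⟫ / ϱ - ⟪y - b, ν b⟫ ^ 2 / (4 * ϱ ^ 2)) with hψ
  have hκϱ : κ * ϱ ≤ 1 / 16 := by
    have : 16 * (κ * ϱ) ≤ 4 * A * (κ * ϱ) := by gcongr; linarith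
    linarith
  have hψlow : ∀ y ∈ K, S / ϱ ^ 2 * ‖y - b‖ ^ 2 ≤ ψ y := fun y hy => by
    have h1 := G.ext' hb hba hy.1 (by rw [dist_eq_norm]; linarith [hKn y hy])
    have h2 := abs_le.1 (hKs y hy)
    have h3 := hKn y hy
    set σ := ⟪y - b, ν b⟫
    have h4 : 0 ≤ S / ϱ ^ 2 * ‖y - b‖ ^ 2 := by positivity
    have e1 : ψ y = 2 * (S / ϱ ^ 2 * ‖y - b‖ ^ 2) + A * S / (4 * ϱ ^ 2) * (σ * (4 * ϱ - σ)) := by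
      simp only [hψ]; change 2 * S / ϱ ^ 2 * ‖y - b‖ ^ 2 + A * S * (σ / ϱ - σ ^ 2 / (4 * ϱ ^ 2)) = _
      field_simp
    rw [e1]
    have e2 : -(κ * ‖y - b‖ ^ 2 * (5 * ϱ)) ≤ σ * (4 * ϱ - σ) := by
      by_cases hσ : 0 ≤ σ
      · have : 0 ≤ σ * (4 * ϱ - σ) := mul_nonneg hσ (by linarith)
        have : 0 ≤ κ * ‖y - b‖ ^ 2 * (5 * ϱ) := by positivity
        linarith
      · push Not at hσ
        have : 0 ≤ (σ + κ * ‖y - b‖ ^ 2) * ϱ := mul_nonneg h1 hϱ.le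
        have : 0 ≤ (-σ) * (ϱ + σ) := mul_nonneg (by linarith) (by linarith)
        nlinarith
    have e3 : A * S / (4 * ϱ ^ 2) * (-(κ * ‖y - b‖ ^ 2 * (5 * ϱ))) ≤
      A * S / (4 * ϱ ^ 2) * (σ * (4 * ϱ - σ)) := by gcongr
    have e4 : A * S / (4 * ϱ ^ 2) * (-(κ * ‖y - b‖ ^ 2 * (5 * ϱ))) =
      - ((5 / 16) * (4 * A * κ * ϱ) * (S / ϱ ^ 2 * ‖y - b‖ ^ 2)) := by field_simp; ring
    have e5 : (5 / 16) * (4 * A * κ * ϱ) * (S / ϱ ^ 2 * ‖y - b‖ ^ 2) ≤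
      (5 / 16) * 1 * (S / ϱ ^ 2 * ‖y - b‖ ^ 2) := by gcongr
    linarith
  have hsn : ‖b + s • ν b - b‖ = s := by
    rw [add_sub_cancel_left, norm_smul, he, mul_one, Real.norm_eq_abs, abs_of_pos hs]
  have hsi : ⟪b + s • ν b - b, ν b⟫ = s := by
    rw [add_sub_cancel_left, inner_smul_left, real_inner_self_eq_norm_sq, he]; simp
  have hyK : b + s • ν b ∈ K := ⟨subset_closure hbs, by rw [mem_closedBall, dist_eq_norm, hsn]; exact hsϱ⟩
  have key := ell_max (Φ := fun y => w y - ψ y) hKc ((hc.mono inter_subset_left).sub (by fun_prop)) ?_ _ hyK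
  · have : ψ (b + s • ν b) ≤ (2 + A) * S / ϱ * s := by
      simp only [hψ]
      rw [hsn, hsi]
      have e1 : 2 * S / ϱ ^ 2 * s ^ 2 ≤ 2 * S / ϱ * s := by
        have : 2 * S / ϱ ^ 2 * s ^ 2 = 2 * S / ϱ * s * (s / ϱ) := by field_simp
        rw [this]
        exact mul_le_of_le_one_right (by positivity) ((div_le_one hϱ).2 hsϱ)
      have e2 : 0 ≤ A * S * (s ^ 2 / (4 * ϱ ^ 2)) := by positivity
      have e3 : (2 + A) * S / ϱ * s = 2 * S / ϱ * s + A * S * (s / ϱ) := by ring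
      rw [e3, mul_sub]
      linarith
    linarith
  intro y hy hpos
  have h1 := hψlow y hy
  have hpos' : ψ y < w y := by linarith
  have hyΩ : y ∈ Ω := by
    by_contra hcon
    have : y ∈ frontier Ω := by rw [G.op.frontier_eq]; exact ⟨hy.1, hcon⟩
    have : 0 ≤ S / ϱ ^ 2 * ‖y - b‖ ^ 2 := by positivity
    linarith [h0 y ‹_›]
  have hyϱ : ‖y - b‖ < ϱ := by
    rcases lt_or_eq_of_le (hKn y hy) with h | h
    · exact h
    rw [h, div_mul_cancel₀ _ (by positivity)] at h1
    linarith [hSw y hy.1 h.le]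
  refine ⟨?_, ?_⟩
  · refine mem_of_superset (inter_mem (G.op.mem_nhds hyΩ) (isOpen_ball.mem_nhds (x := y) (s := ball b ϱ) (by
      rw [mem_ball, dist_eq_norm]; exact hyϱ))) fun z hz => ⟨subset_closure hz.1, ball_subset_closedBall hz.2⟩
  obtain ⟨g, l, hj, hl⟩ := hw y hyΩ hyϱ.le
  have hd : ∀ x : ℝ, HasDerivAt (fun x : ℝ => A * S * (x / ϱ - x ^ 2 / (4 * ϱ ^ 2)))
      (A * S * (1 / ϱ - 2 * x / (4 * ϱ ^ 2))) x := fun x =>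
    ((((hasDerivAt_id x).div_const ϱ).sub ((hasDerivAt_pow 2 x).div_const (4 * ϱ ^ 2))).const_mul (A * S)).congr_deriv
      (by norm_num)
  have hd2 : ∀ x : ℝ, HasDerivAt (fun x : ℝ => A * S * (1 / ϱ - 2 * x / (4 * ϱ ^ 2)))
      (A * S * (- (2 / (4 * ϱ ^ 2)))) x := fun x =>
    (((((hasDerivAt_id x).const_mul 2).div_const (4 * ϱ ^ 2)).const_sub (1 / ϱ)).const_mul (A * S)).congr_deriv
      (by norm_num)
  have jψ := ((Jet.normsq b y).const_mul (2 * S / ϱ ^ 2)).add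
    ((Jet.linear b (ν b) y).comp (Eventually.of_forall hd) (hd2 _))
  refine ⟨_, _, hj.sub jψ, fun hg0 => ?_⟩
  have hg := sub_eq_zero.1 hg0
  have h2 := abs_le.1 (hKs y hy)
  set σ := ⟪y - b, ν b⟫
  have hgn : ‖g‖ ≤ (4 + 2 * A) * S / ϱ := by
    rw [hg]
    refine (norm_add_le _ _).trans ?_
    rw [norm_smul, norm_smul, norm_smul, he, Real.norm_eq_abs, Real.norm_eq_abs, Real.norm_eq_abs, abs_two, mul_one,
      abs_of_nonneg (by positivity), abs_of_nonneg]
    · have e1 : 2 * S / ϱ ^ 2 * (2 * ‖y - b‖) ≤ 2 * S / ϱ ^ 2 * (2 * ϱ) := by gcongr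
      have e2 : 2 * S / ϱ ^ 2 * (2 * ϱ) = 4 * S / ϱ := by field_simp; ring
      have e3 : A * S * (1 / ϱ - 2 * σ / (4 * ϱ ^ 2)) ≤ A * S * (2 / ϱ) := by
        gcongr
        rw [sub_le_iff_le_add]
        have : 0 ≤ (4 * ϱ + 2 * σ) / (4 * ϱ ^ 2) := div_nonneg (by linarith) (by positivity)
        have e : 2 / ϱ + 2 * σ / (4 * ϱ ^ 2) = 1 / ϱ + (4 * ϱ + 2 * σ) / (4 * ϱ ^ 2) := by field_simp; ring
        linarith
      have e4 : (4 + 2 * A) * S / ϱ = 4 * S / ϱ + A * S * (2 / ϱ) := by ring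
      linarith
    · apply mul_nonneg (by positivity)
      have : 0 ≤ (4 * ϱ - 2 * σ) / (4 * ϱ ^ 2) := div_nonneg (by linarith) (by positivity)
      have e : 1 / ϱ - 2 * σ / (4 * ϱ ^ 2) = (4 * ϱ - 2 * σ) / (4 * ϱ ^ 2) := by field_simp
      linarith
  have := hl hgn
  rw [he]
  have e : 2 * S / ϱ ^ 2 * (2 * n) + (A * S * (1 / ϱ - 2 * σ / (4 * ϱ ^ 2)) * 0 + A * S * (- (2 / (4 * ϱ ^ 2))) * 1 ^ 2)
     = - (2 * S / ϱ ^ 2) := by rw [hA]; field_simp; ring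
  linarith

set_option maxHeartbeats 1600000 in
theorem lemC (V : Type*) [NormedAddCommGroup V] [InnerProductSpace ℝ V] [FiniteDimensional ℝ V]
    [CompleteSpace V] {p β M C1 κ rg : ℝ} (hp : 2 < p) (hβ : β = 1 / (p - 1)) (hM : 0 ≤ M) (hC : 0 < C1)
    (hκ : 0 < κ) (hrg : 0 < rg) : ∃ κ0 > 0, ∃ CG > 0, ∃ d0 > 0, ∀ (Ω : Set V) (δ : V → ℝ)
    (ν : V → V) (a : V) (v : V → ℝ) (g : V → V), Slice p β M C1 κ rg Ω δ ν a v g →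
    ∀ b ∈ frontier Ω, dist b a < rg / 4 → ∀ d, 0 < d → d ≤ d0 →
    (∀ y ∈ Ω, ‖y - b‖ ≤ 6 * d → δ y ≤ d / 2 → v y ≤ κ0 * d ^ (1 - β)) →
    ∀ y ∈ Ω, ‖y - b‖ ≤ 3 * d → |v y| ≤ CG * d ^ (-β) * δ y ∧ ‖g y‖ ≤ CG * d ^ (-β) := by
  obtain ⟨β0, β1, β2⟩ := beta_pos hp hβ
  set n : ℝ := (Module.finrank ℝ V : ℝ) with hnd
  have hn : 0 ≤ n := by positivity
  set A : ℝ := 8 * n + 4 with hA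
  have hA0 : 4 ≤ A := by linarith
  set κ1 : ℝ := ((4 + 2 * A)⁻¹) ^ 2 with hκ1
  have hκ10 : 0 < κ1 := by positivity
  have hkappaPow : ((4 + 2 * A) * κ1) ^ p ≤ κ1 := by
    have e1 : (4 + 2 * A) * κ1 = (4 + 2 * A)⁻¹ := by rw [hκ1]; field_simp
    rw [e1, hκ1, ← Real.rpow_natCast]
    apply Real.rpow_le_rpow_of_exponent_ge (by positivity)
    · apply inv_le_one_of_one_le₀; linarith
    · push_cast; linarith
  obtain ⟨x1, hx1, hx1'⟩ := pw_small (c := M) (q := 1 + β) hM (by linarith) hκ10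
  obtain ⟨x2, hx2, hx2'⟩ := pw_small (c := M) (q := 1 + β) hM (by linarith) hC
  set CL := (2 + A) * (κ1 + C1) * 2 with hCL
  have hCL0 : 0 < CL := by positivity
  have hCLC : 2 * C1 ≤ CL := by rw [hCL]; nlinarith
  set CG := (2 * n + 1) * (8 * C1 ^ (p - 1) + 8) * (3 * CL + C1) + CL with hCG
  have hCG1 : 0 ≤ (2 * n + 1) * (8 * C1 ^ (p - 1) + 8) * (3 * CL + C1) := by positivity
  refine ⟨κ1 / 2, by positivity, CG, by positivity, min (min x1 x2) (min (rg / 20) (1 / (4 * A * κ))), by positivity, ?_⟩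
  intro Ω δ ν a v g S b hb hba d hd hd0 hyp
  have G := S.geo
  have d1 : d ≤ x1 := hd0.trans ((min_le_left _ _).trans (min_le_left _ _))
  have d2 : d ≤ x2 := hd0.trans ((min_le_left _ _).trans (min_le_right _ _))
  have d3 : d ≤ rg / 20 := hd0.trans ((min_le_right _ _).trans (min_le_left _ _))
  have d4 : d ≤ 1 / (4 * A * κ) := hd0.trans ((min_le_right _ _).trans (min_le_right _ _))
  rw [le_div_iff₀ (by positivity)] at d4
  set ϱ := d / 2 with hϱd
  have hϱ : 0 < ϱ := by positivity
  set X := ϱ ^ (1 - β) with hX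
  have hX0 : 0 < X := by positivity
  have hdX : d ^ (1 - β) ≤ 2 * X := by
    have : d = 2 * ϱ := by rw [hϱd]; ring
    rw [this, Real.mul_rpow (by norm_num) hϱ.le]
    gcongr
    calc (2:ℝ) ^ (1 - β) ≤ 2 ^ (1:ℝ) := Real.rpow_le_rpow_of_exponent_le (by norm_num) (by linarith)
      _ = 2 := by simp
  have hϱβ : ϱ ^ (-β) ≤ 2 * d ^ (-β) := by
    have : d = 2 * ϱ := by rw [hϱd]; ring
    rw [this, Real.mul_rpow (by norm_num) hϱ.le]
    have : (1:ℝ) / 2 ≤ 2 ^ (-β) := by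
      calc (1:ℝ) / 2 = 2 ^ (-1:ℝ) := by rw [Real.rpow_neg_one]; norm_num
        _ ≤ _ := Real.rpow_le_rpow_of_exponent_le (by norm_num) (by linarith)
    have h2 : 0 < ϱ ^ (-β) := by positivity
    nlinarith
  have m1 : M * ϱ ^ 2 < κ1 * X := by
    rw [pw_sq (β := β) hϱ, ← mul_assoc]
    have := hx1' ϱ hϱ.le (by linarith)
    gcongr
  have m2 : M * ϱ ^ 2 < C1 * X := by
    rw [pw_sq (β := β) hϱ, ← mul_assoc]
    have := hx2' ϱ hϱ.le (by linarith)
    gcongr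
  have hXϱ : X / ϱ = ϱ ^ (-β) := (pw1 hϱ β).symm
  have hna : ∀ y : V, ‖y - b‖ ≤ 6 * d → dist y a < rg := fun y hy => by
    have := dist_triangle y b a
    rw [dist_eq_norm y b] at this
    linarith
  have vb : ∀ y ∈ Ω, ‖y - b‖ ≤ 4 * d → |v y| ≤ CL * d ^ (-β) * δ y := by
    intro y hy hyb
    have hδ := G.dpos hy
    by_cases hδd : ϱ ≤ δ y
    · refine (S.ub y hy (hna y (by linarith))).trans ?_
      have e1 : δ y ^ (1 - β) = δ y ^ (-β) * δ y := by rw [pw1 hδ]; field_simp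
      have e2 := pw_anti β0.le hϱ hδd
      rw [e1, ← mul_assoc]
      have e3 : C1 * δ y ^ (-β) ≤ CL * d ^ (-β) := by
        calc C1 * δ y ^ (-β) ≤ C1 * (2 * d ^ (-β)) := by gcongr; linarith
          _ = 2 * C1 * d ^ (-β) := by ring
          _ ≤ _ := by gcongr
      gcongr
    push Not at hδd
    obtain ⟨b', hb', hyb', -⟩ := G.foot y hy (hna y (by linarith))
    have hν' := G.nrm b' hb'
    have hbb : ‖b' - b‖ ≤ 4 * d + ϱ := by
      have e0 : y - δ y • ν b' = b' := sub_eq_of_eq_add hyb'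
      have : b' - b = (y - b) - δ y • ν b' := by
        calc b' - b = (y - δ y • ν b') - b := by rw [e0]
          _ = _ := by abel
      rw [this]
      refine (norm_sub_le _ _).trans ?_
      rw [norm_smul, hν', Real.norm_eq_abs, abs_of_pos hδ]
      linarith
    have hb'a : dist b' a < rg := hna b' (by linarith)
    have hin : ∀ z : V, ‖z - b'‖ ≤ ϱ → ‖z - b‖ ≤ 6 * d := fun z hz => by
      have := norm_sub_le_norm_sub_add_norm_sub z b' b
      linarith
    have hdz : ∀ z : V, ‖z - b'‖ ≤ ϱ → δ z ≤ ϱ := fun z hz => by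
      rw [G.dd]; exact (infDist_le_dist_of_mem hb').trans (by rwa [dist_eq_norm])
    have hκA : 4 * A * κ * ϱ ≤ 1 := by
      have : 4 * A * κ * ϱ ≤ 4 * A * κ * d := by gcongr; linarith
      linarith
    have hfr : ∀ z ∈ closure Ω, z ∈ Ω ∨ z ∈ frontier Ω := fun z hz => by
      rw [G.op.frontier_eq]; by_cases h : z ∈ Ω
      · exact Or.inl h
      · exact Or.inr ⟨hz, h⟩
    have up := lemC0 (S := κ1 * X) (A := A) (w := v) (s := δ y) G hb' hb'a hϱ (by linarith) (by positivity) hA hκA S.cont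
      (fun z hz => (S.bd z hz).le) (fun z hz hzb => by
        rcases hfr z hz with h | h
        · have e1 := hyp z h (hin z hzb) (hdz z hzb)
          have : κ1 / 2 * d ^ (1 - β) ≤ κ1 / 2 * (2 * X) := by gcongr
          linarith
        · rw [S.bd z h]; positivity) (fun z hz hzb => by
        obtain ⟨l, j, hl⟩ := S.jet z hz
        refine ⟨_, l, j, fun hg => ?_⟩
        have e1 : ‖g z‖ ^ p ≤ ((4 + 2 * A) * κ1 * ϱ ^ (-β)) ^ p := by
          refine Real.rpow_le_rpow (norm_nonneg _) ?_ (by linarith)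
          rw [← hXϱ]; refine hg.trans (le_of_eq ?_); ring
        rw [pw3 hp hβ (by positivity) hϱ] at e1
        have e2 : ((4 + 2 * A) * κ1) ^ p * ϱ ^ (1 - β) / ϱ ^ 2 ≤ κ1 * X / ϱ ^ 2 := by gcongr
        have e3 : M < κ1 * X / ϱ ^ 2 := by rw [lt_div_iff₀ (by positivity)]; exact m1
        have e4 : 2 * (κ1 * X) / ϱ ^ 2 = κ1 * X / ϱ ^ 2 + κ1 * X / ϱ ^ 2 := by ring
        rw [e4]
        linarith [(abs_le.1 hl).1]) hδ hδd.le (by rw [← hyb']; exact hy)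
    have lo := lemC0 (S := C1 * X) (A := A) (w := fun z => - v z) (s := δ y) G hb' hb'a hϱ (by linarith) (by positivity) hA hκA S.cont.neg
      (fun z hz => by rw [S.bd z hz, neg_zero]) (fun z hz hzb => by
        rcases hfr z hz with h | h
        · have e1 := S.ub z h (hna z (hin z hzb))
          have := pw_mono β1.le (G.dpos h).le (hdz z hzb)
          have : C1 * δ z ^ (1 - β) ≤ C1 * X := by gcongr
          linarith [(abs_le.1 e1).1]
        · rw [S.bd z h, neg_zero]; positivity) (fun z hz hzb => by
        obtain ⟨l, j, hl⟩ := S.jet z hz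
        refine ⟨_, -l, j.neg, fun hg => ?_⟩
        have e1 : 0 ≤ ‖g z‖ ^ p := by positivity
        have e3 : M < C1 * X / ϱ ^ 2 := by rw [lt_div_iff₀ (by positivity)]; exact m2
        have e4 : 2 * (C1 * X) / ϱ ^ 2 = C1 * X / ϱ ^ 2 + C1 * X / ϱ ^ 2 := by ring
        rw [e4]
        linarith [(abs_le.1 hl).2]) hδ hδd.le (by rw [← hyb']; exact hy)
    rw [← hyb'] at up lo
    have f1 : (2 + A) * (κ1 * X) / ϱ = (2 + A) * κ1 * ϱ ^ (-β) := by rw [← hXϱ]; ring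
    have f2 : (2 + A) * (C1 * X) / ϱ = (2 + A) * C1 * ϱ ^ (-β) := by rw [← hXϱ]; ring
    rw [f1] at up
    rw [f2] at lo
    have f3 : (2 + A) * κ1 * ϱ ^ (-β) ≤ CL * d ^ (-β) := by
      calc _ ≤ (2 + A) * (κ1 + C1) * (2 * d ^ (-β)) := by gcongr; linarith
        _ = _ := by rw [hCL]; ring
    have f4 : (2 + A) * C1 * ϱ ^ (-β) ≤ CL * d ^ (-β) := by
      calc _ ≤ (2 + A) * (κ1 + C1) * (2 * d ^ (-β)) := by gcongr; linarith
        _ = _ := by rw [hCL]; ring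
    have f5 := mul_le_mul_of_nonneg_right f3 hδ.le
    have f6 := mul_le_mul_of_nonneg_right f4 hδ.le
    rw [abs_le]; constructor <;> linarith
  intro y hy hyb
  have hδ := G.dpos hy
  have hCLG : CL ≤ CG := by rw [hCG]; linarith
  have hdβ : 0 < d ^ (-β) := by positivity
  refine ⟨(vb y hy (by linarith)).trans (by gcongr), ?_⟩
  by_cases hδd : ϱ ≤ δ y
  · refine (S.grad y hy (hna y (by linarith))).trans ?_
    have e2 := pw_anti β0.le hϱ hδd
    calc C1 * δ y ^ (-β) ≤ C1 * (2 * d ^ (-β)) := by gcongr; linarith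
          _ = 2 * C1 * d ^ (-β) := by ring
          _ ≤ _ := by gcongr; linarith
  push Not at hδd
  have hball : ∀ z ∈ closedBall y (δ y / 2), z ∈ Ω ∧ δ y / 2 ≤ δ z ∧ δ z ≤ 3 / 2 * δ y := fun z hz => by
    rw [mem_closedBall, dist_comm] at hz
    refine ⟨?_, ?_, ?_⟩
    · by_contra hcon
      have := segment_hits hy hcon
      rw [← G.dd] at this
      linarith
    · have := infDist_le_infDist_add_dist (s := frontier Ω) (x := y) (y := z)
      rw [← G.dd, ← G.dd] at this; linarith
    · have := infDist_le_infDist_add_dist (s := frontier Ω) (x := z) (y := y)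
      rw [← G.dd, ← G.dd, dist_comm] at this; linarith
  have hbn : ∀ z ∈ closedBall y (δ y / 2), ‖z - b‖ ≤ 4 * d := fun z hz => by
    rw [mem_closedBall, dist_eq_norm] at hz
    have := norm_sub_le_norm_sub_add_norm_sub z y b
    linarith
  have := lemGe (v := v) (G := g) (x0 := y) (R := δ y / 2) (S := CL * d ^ (-β) * (3 / 2 * δ y)) (k := C1 ^ (p - 1))
    (g := M) (by positivity) (by positivity) hM (S.gc.mono fun z hz => (hball z hz).1) (fun z hz => by
      obtain ⟨l, j, hl⟩ := S.jet z (hball z hz).1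
      refine ⟨l, j, ?_⟩
      have e1 : ‖g z‖ ≤ C1 * (δ y / 2) ^ (-β) := by
        refine (S.grad z (hball z hz).1 (hna z (by linarith [hbn z hz]))).trans ?_
        have := pw_anti β0.le (by positivity) (hball z hz).2.1
        gcongr
      have e2 : ‖g z‖ ^ p ≤ C1 ^ (p - 1) / (δ y / 2) * ‖g z‖ := by
        rw [← pw2 hp hβ hC.le (by positivity)]
        have : ‖g z‖ ^ p = ‖g z‖ ^ (p - 1) * ‖g z‖ := by
          rcases eq_or_lt_of_le (norm_nonneg (g z)) with h | h
          · rw [← h, mul_zero, Real.zero_rpow (by linarith)]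
          · rw [Real.rpow_sub_one h.ne']; field_simp
        rw [this]
        gcongr
        linarith
      have e3 : 0 ≤ ‖g z‖ ^ p := by positivity
      have := abs_le.1 hl
      rw [abs_le]; constructor <;> linarith) (fun z hz => (vb z (hball z hz).1 (hbn z hz)).trans (by
        have := (hball z hz).2.2
        gcongr))
  refine this.trans ?_
  have e1 : CL * d ^ (-β) * (3 / 2 * δ y) / (δ y / 2) = 3 * CL * d ^ (-β) := by field_simp
  have e2 : M * (δ y / 2) ≤ C1 * d ^ (-β) := by
    have : M * ϱ < C1 * ϱ ^ (-β) := by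
      have : C1 * ϱ ^ (-β) = C1 * X / ϱ := by rw [← hXϱ]; ring
      rw [this, lt_div_iff₀ hϱ]; linarith
    have : M * (δ y / 2) ≤ M * (ϱ / 2) := by gcongr
    have : C1 * ϱ ^ (-β) ≤ C1 * (2 * d ^ (-β)) := by gcongr
    linarith
  rw [e1]
  calc _ ≤ (2 * n + 1) * (8 * C1 ^ (p - 1) + 8) * (3 * CL * d ^ (-β) + C1 * d ^ (-β)) := by gcongr
    _ = (2 * n + 1) * (8 * C1 ^ (p - 1) + 8) * (3 * CL + C1) * d ^ (-β) := by ring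
    _ ≤ _ := by rw [hCG, add_mul]; linarith [mul_pos hCL0 hdβ]
end LemC


section LemZ
variable {V : Type*} [NormedAddCommGroup V] [InnerProductSpace ℝ V] [FiniteDimensional ℝ V]
  [CompleteSpace V]

/-- the situation near a boundary point `b` at scale `d` -/
structure Near (p β M C1 κ rg : ℝ) (Ω : Set V) (δ : V → ℝ) (ν : V → V) (a : V)
    (v : V → ℝ) (g : V → V) (b : V) (d N e k1 : ℝ) : Prop where
  S : Slice p β M C1 κ rg Ω δ ν a v g
  hb : b ∈ frontier Ω
  hba : dist b a < rg / 4
  hd : 0 < d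
  hdr : 8 * d < rg / 4
  hN : 0 < N
  he : 0 < e
  he1 : e ≤ 1 / 8
  hk1 : 0 ≤ k1
  hk : p * N ^ (p - 1) ≤ k1 / d
  bnd : ∀ y ∈ Ω, ‖y - b‖ ≤ 3 * d → |v y| ≤ N * δ y ∧ ‖g y‖ ≤ N
  tan : ∀ y c, y ∈ Ω → y + c ∈ Ω → ‖y - b‖ ≤ 3 * d → ‖c‖ ≤ 3 * d → ⟪c, ν b⟫ = 0 →
    |v (y + c) - v y| ≤ e * N * d
  kd : 4 * κ * d ≤ e ^ 2
  Md : M * d ≤ e * N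

variable {p β M C1 κ rg : ℝ} {Ω : Set V} {δ : V → ℝ} {ν : V → V} {a : V} {v : V → ℝ} {g : V → V}
variable {b : V} {d N e k1 : ℝ}

theorem Near.pt (h : Near p β M C1 κ rg Ω δ ν a v g b d N e k1) {y c : V} (hy : ‖y - b‖ ≤ 3 * d)
    (hyc : ‖y + c - b‖ ≤ 3 * d) (hc : ⟪c, ν b⟫ = 0) (hs : 0 < ⟪y - b, ν b⟫)
    (hw : 4 * κ * (‖y - b‖ ^ 2 + ‖c‖ ^ 2) ≤ ⟪y - b, ν b⟫) :
    (y ∈ Ω ∧ ⟪y - b, ν b⟫ / 2 ≤ δ y ∧ δ y ≤ 2 * ⟪y - b, ν b⟫) ∧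
    (y + c ∈ Ω ∧ ⟪y - b, ν b⟫ / 2 ≤ δ (y + c) ∧ δ (y + c) ≤ 2 * ⟪y - b, ν b⟫) := by
  have G := h.S.geo
  have hκ := G.hκ
  have hd := h.hd
  have hdr := h.hdr
  have hrg := G.hrg
  have hba := h.hba
  have hsc : ⟪y + c - b, ν b⟫ = ⟪y - b, ν b⟫ := by
    rw [show y + c - b = (y - b) + c by abel, inner_add_left, hc, add_zero]
  have hn : ‖y + c - b‖ ^ 2 ≤ 2 * (‖y - b‖ ^ 2 + ‖c‖ ^ 2) := by
    rw [show y + c - b = (y - b) + c by abel]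
    have := parallelogram_law_with_norm ℝ (y - b) c
    nlinarith [mul_self_nonneg ‖y - b - c‖]
  have h1 := G.pt (y := y) h.hb (by linarith) hs (by nlinarith [sq_nonneg ‖c‖, mul_nonneg hκ.le (sq_nonneg ‖c‖), mul_nonneg hκ.le (sq_nonneg ‖y - b‖)]) (by linarith)
  have h2 := G.pt (y := y + c) h.hb (by linarith) (by rwa [hsc]) (by
    rw [hsc]
    have : κ * ‖y + c - b‖ ^ 2 ≤ κ * (2 * (‖y - b‖ ^ 2 + ‖c‖ ^ 2)) := by gcongr
    linarith) (by linarith)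
  rw [hsc] at h2
  exact ⟨⟨h1.1, h1.2.1, h1.2.2.1⟩, ⟨h2.1, h2.2.1, h2.2.2.1⟩⟩

def EZ (n k1 : ℝ) : ℝ := (16 * n + 16 * k1 + 3) * Real.exp (2 * (k1 + 1)) * (k1 + 1)

set_option maxHeartbeats 1600000 in
theorem Near.z0 (h : Near p β M C1 κ rg Ω δ ν a v g b d N e k1) {y0 c : V} (hy0 : ‖y0 - b‖ ≤ d)
    (hcd : ‖c‖ ≤ d) (hc : ⟪c, ν b⟫ = 0) (hs0 : 0 < ⟪y0 - b, ν b⟫)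
    (hw : 4 * κ * (‖y0 - b‖ ^ 2 + ‖c‖ ^ 2) ≤ ⟪y0 - b, ν b⟫) {σ : ℝ} (hσ : |σ| = 1) :
    σ * (v (y0 + c) - v y0) ≤ N * (16 * κ * (‖y0 - b‖ ^ 2 + ‖c‖ ^ 2) +
      EZ (Module.finrank ℝ V) k1 * e * ⟪y0 - b, ν b⟫) := by
  have S := h.S
  have G := S.geo
  have hκ := G.hκ
  have hd := h.hd
  have hN := h.hN
  have he := h.he
  have hk1 := h.hk1
  have he1 := h.he1
  set n : ℝ := (Module.finrank ℝ V : ℝ)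
  have hn : 0 ≤ n := by positivity
  by_cases hc0 : c = 0
  · simp only [hc0, add_zero, sub_self, mul_zero]
    unfold EZ
    positivity
  have hcp : 0 < ‖c‖ := norm_pos_iff.2 hc0
  set K : Set V := {y | 4 * κ * (‖y - b‖ ^ 2 + ‖c‖ ^ 2) ≤ ⟪y - b, ν b⟫ ∧ ‖y - y0‖ ≤ d} with hKd
  have hKb : ∀ y ∈ K, ‖y - b‖ ≤ 2 * d := fun y hy => by
    have := norm_sub_le_norm_sub_add_norm_sub y y0 b
    linarith [hy.2]
  have hsc : ∀ y, ⟪y + c - b, ν b⟫ = ⟪y - b, ν b⟫ := fun y => by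
    rw [show y + c - b = (y - b) + c by abel, inner_add_left, hc, add_zero]
  have hnc : ∀ y, ‖y + c - b‖ ≤ ‖y - b‖ + d := fun y => by
    rw [show y + c - b = (y - b) + c by abel]
    exact (norm_add_le _ _).trans (by linarith)
  have hKp : ∀ y ∈ K, 0 < ⟪y - b, ν b⟫ := fun y hy => lt_of_lt_of_le (by positivity) hy.1
  have hK : ∀ y ∈ K, (y ∈ Ω ∧ ⟪y - b, ν b⟫ / 2 ≤ δ y ∧ δ y ≤ 2 * ⟪y - b, ν b⟫) ∧
    (y + c ∈ Ω ∧ ⟪y - b, ν b⟫ / 2 ≤ δ (y + c) ∧ δ (y + c) ≤ 2 * ⟪y - b, ν b⟫) := fun y hy =>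
    h.pt (by linarith [hKb y hy]) (by linarith [hKb y hy, hnc y]) hc (hKp y hy) hy.1
  have cs : Continuous fun y : V => ⟪y - b, ν b⟫ := by fun_prop
  have cq : Continuous fun y : V => 4 * κ * (‖y - b‖ ^ 2 + ‖c‖ ^ 2) := by fun_prop
  have cn : Continuous fun y : V => ‖y - y0‖ := by fun_prop
  have hKc : IsCompact K := by
    refine (isCompact_closedBall y0 d).of_isClosed_subset ?_ (fun y hy => by
      rw [mem_closedBall, dist_eq_norm]; exact hy.2)
    exact (isClosed_le cq cs).inter (isClosed_le cn continuous_const)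
  have hcontv : ContinuousOn v Ω := S.cont.mono subset_closure
  set E0 := (16 * n + 16 * k1 + 3) * Real.exp (2 * (k1 + 1)) with hE0
  have hE00 : 0 < E0 := by positivity
  have key := barE (w := fun y => σ * (v (y + c) - v y)) hKc (e := ν b) (b := b) (y0 := y0)
    (k := k1 / d) (m := (k1 + 1) / d) (f := 2 * M) (c0 := 16 * κ * N * ‖c‖ ^ 2) (c1 := e * N / d)
    (c2 := 16 * κ * N)
    (K1 := E0 * N * e * d) (L := d) (L' := 2 * d) (R' := 2 * d) ?_ (G.nrm b h.hb) (by positivity)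
    (by gcongr; linarith) (by positivity) (by positivity) (by positivity) ?_
    (fun y hy => ⟨hy.2, hKb y hy, (G.inner_le h.hb).trans (hKb y hy)⟩) ?_ y0 ⟨hw, by simp; positivity⟩
  · refine key.trans ?_
    simp only [sub_self, norm_zero]
    have e1 := Real.add_one_le_exp (-((k1 + 1) / d * ⟪y0 - b, ν b⟫))
    have e2 : E0 * N * e * d * (1 - Real.exp (-((k1 + 1) / d * ⟪y0 - b, ν b⟫))) ≤
      E0 * N * e * d * ((k1 + 1) / d * ⟪y0 - b, ν b⟫) := by gcongr; linarith
    have e3 : E0 * N * e * d * ((k1 + 1) / d * ⟪y0 - b, ν b⟫) = N * (EZ n k1 * e * ⟪y0 - b, ν b⟫) := by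
      unfold EZ; rw [← hE0]; field_simp
    rw [e3] at e2
    have e4 : N * (16 * κ * (‖y0 - b‖ ^ 2 + ‖c‖ ^ 2) + EZ n k1 * e * ⟪y0 - b, ν b⟫) =
      16 * κ * N * ‖c‖ ^ 2 + 16 * κ * N * ‖y0 - b‖ ^ 2 + N * (EZ n k1 * e * ⟪y0 - b, ν b⟫) := by ring
    rw [e4]
    have e5 : e * N / d * (0:ℝ) ^ 2 = 0 := by ring
    linarith
  · refine ContinuousOn.mul continuousOn_const (ContinuousOn.sub (hcontv.comp (by fun_prop) fun y hy => (hK y hy).2.1)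
      (hcontv.mono fun y hy => (hK y hy).1.1))
  · intro y hy hlt
    have hsp := hKp y hy
    have hexp : Real.exp (-((k1 + 1) / d * ⟪y - b, ν b⟫)) ≤ 1 := by
      apply Real.exp_le_one_iff.2
      have : 0 ≤ (k1 + 1) / d * ⟪y - b, ν b⟫ := by positivity
      linarith
    have t0 : 0 ≤ E0 * N * e * d * (1 - Real.exp (-((k1 + 1) / d * ⟪y - b, ν b⟫))) :=
        mul_nonneg (by positivity) (by linarith)
    have t1 : 0 ≤ e * N / d * ‖y - y0‖ ^ 2 := by positivity
    have t2 : 0 ≤ 16 * κ * N * ‖c‖ ^ 2 := by positivity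
    have t3 : 0 ≤ 16 * κ * N * ‖y - b‖ ^ 2 := by positivity
    have habs : σ * (v (y + c) - v y) ≤ |v (y + c) - v y| := by
      refine (le_abs_self _).trans ?_
      rw [abs_mul, hσ, one_mul]
    have a1 := hK y hy
    have b1 := h.bnd y a1.1.1 (by linarith [hKb y hy])
    have b2 := h.bnd (y + c) a1.2.1 (by linarith [hKb y hy, hnc y])
    have f1 : 4 * κ * (‖y - b‖ ^ 2 + ‖c‖ ^ 2) < ⟪y - b, ν b⟫ := by
      rcases lt_or_eq_of_le hy.1 with h' | h'
      · exact h'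
      have c1 : |v y| ≤ N * (2 * ⟪y - b, ν b⟫) := b1.1.trans (by gcongr; exact a1.1.2.2)
      have c2 : |v (y + c)| ≤ N * (2 * ⟪y - b, ν b⟫) := b2.1.trans (by gcongr; exact a1.2.2.2)
      rw [← h'] at c1 c2
      have c3 : |v (y + c) - v y| ≤ |v (y + c)| + |v y| := abs_sub _ _
      nlinarith
    have f2 : ‖y - y0‖ < d := by
      rcases lt_or_eq_of_le hy.2 with h' | h'
      · exact h'
      have := h.tan y c a1.1.1 a1.2.1 (by linarith [hKb y hy]) (by linarith) hc
      rw [h'] at hlt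
      have c1 : e * N / d * d ^ 2 = e * N * d := by field_simp
      linarith
    constructor
    · have o : IsOpen {y | 4 * κ * (‖y - b‖ ^ 2 + ‖c‖ ^ 2) < ⟪y - b, ν b⟫ ∧ ‖y - y0‖ < d} :=
        (isOpen_lt cq cs).inter (isOpen_lt cn continuous_const)
      exact mem_of_superset (o.mem_nhds ⟨f1, f2⟩) fun z hz => ⟨hz.1.le, hz.2.le⟩
    · obtain ⟨l, hl1, hl2⟩ := S.zjet (N := N) a1.1.1 a1.2.1 b1.2 b2.2
      refine ⟨_, _, hl1.const_mul σ, ?_⟩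
      rw [norm_smul, Real.norm_eq_abs, hσ, one_mul]
      have c1 : |σ * l| = |l| := by rw [abs_mul, hσ, one_mul]
      have c2 := neg_abs_le (σ * l)
      have c3 : p * N ^ (p - 1) * ‖g (y + c) - g y‖ ≤ k1 / d * ‖g (y + c) - g y‖ := by
        gcongr; exact h.hk
      linarith
  · have q1 : (k1 + 1) / d * (2 * d) = 2 * (k1 + 1) := by field_simp
    have q2 : E0 * N * e * d * ((k1 + 1) / d) * ((k1 + 1) / d - k1 / d) * Real.exp (-((k1 + 1) / d * (2 * d)))
        = (16 * n + 16 * k1 + 3) * (k1 + 1) * (e * N / d) := by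
      rw [q1, hE0, Real.exp_neg]; field_simp; ring
    rw [q2]
    have q3 : k1 / d * d = k1 := by field_simp
    have q3' : 2 * (k1 / d) * d = 2 * k1 := by field_simp
    have q3'' : 2 * (k1 / d) * (2 * d) = 4 * k1 := by field_simp; ring
    rw [q3', q3'']
    have hX : 0 < e * N / d := by positivity
    have q4 : M ≤ e * N / d := by rw [le_div_iff₀ hd]; exact h.Md
    have q5 : 16 * κ * N ≤ 4 * (e * N / d) := by
      have : 16 * κ * N = 4 * ((4 * κ * d) * N / d) := by field_simp; ring
      rw [this]
      have := h.kd
      gcongr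
      nlinarith
    have q6 : 16 * κ * N * (2 * n + 4 * k1) ≤ 4 * (e * N / d) * (2 * n + 4 * k1) := by gcongr
    have q7 : 0 ≤ (e * N / d) * n := by positivity
    have q8 : 0 ≤ (e * N / d) * k1 := by positivity
    have q9 : 0 ≤ (e * N / d) * k1 * k1 := by positivity
    have q10 : 0 ≤ (e * N / d) * n * k1 := by positivity
    nlinarith
end LemZ


section LemZg
variable {V : Type*} [NormedAddCommGroup V] [InnerProductSpace ℝ V] [FiniteDimensional ℝ V]
  [CompleteSpace V]
variable {p β M C1 κ rg : ℝ} {Ω : Set V} {δ : V → ℝ} {ν : V → V} {a : V} {v : V → ℝ} {g : V → V}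
variable {b : V} {d N e k1 : ℝ}

def E3 (n k1 : ℝ) : ℝ := (2 * n + 1) * (8 * k1 + 8) * (49 + 8 * EZ n k1)

theorem Near.wall (h : Near p β M C1 κ rg Ω δ ν a v g b d N e k1) {y c : V} (hy : ‖y - b‖ ≤ d / 2)
    (hs : 0 < ⟪y - b, ν b⟫)
    (hw : e / d * (‖y - b‖ ^ 2 + ‖c‖ ^ 2) ≤ ⟪y - b, ν b⟫) {y' : V}
    (hy' : ‖y' - y‖ ≤ ⟪y - b, ν b⟫ / 4) :
    3 / 4 * ⟪y - b, ν b⟫ ≤ ⟪y' - b, ν b⟫ ∧ ⟪y' - b, ν b⟫ ≤ 5 / 4 * ⟪y - b, ν b⟫ ∧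
    ‖y' - b‖ ≤ d ∧ 4 * κ * (‖y' - b‖ ^ 2 + ‖c‖ ^ 2) ≤ 3 * e * ⟪y - b, ν b⟫ := by
  have G := h.S.geo
  have hκ := G.hκ
  have hd := h.hd
  have he := h.he
  have he1 := h.he1
  have hsd : ⟪y - b, ν b⟫ ≤ ‖y - b‖ := G.inner_le h.hb
  have h1 : |⟪y' - y, ν b⟫| ≤ ‖y' - y‖ := by
    have := abs_real_inner_le_norm (y' - y) (ν b)
    rwa [G.nrm b h.hb, mul_one] at this
  have h2 : ⟪y' - b, ν b⟫ = ⟪y - b, ν b⟫ + ⟪y' - y, ν b⟫ := by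
    rw [← inner_add_left]; congr 1; abel
  have h3 : ‖y' - b‖ ≤ ‖y' - y‖ + ‖y - b‖ := norm_sub_le_norm_sub_add_norm_sub _ _ _
  set s := ⟪y - b, ν b⟫
  have h4 : ‖y' - b‖ ^ 2 ≤ 2 * ‖y - b‖ ^ 2 + s ^ 2 / 8 := by
    have : ‖y' - b‖ ^ 2 ≤ (s / 4 + ‖y - b‖) ^ 2 := by gcongr; linarith
    nlinarith [sq_nonneg (s / 4 - ‖y - b‖)]
  rw [abs_le] at h1
  refine ⟨by linarith, by linarith, by linarith, ?_⟩
  have h5 : 4 * κ ≤ e * (e / d) := by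
    have := h.kd
    rw [← mul_div_assoc, le_div_iff₀ hd]; nlinarith
  calc 4 * κ * (‖y' - b‖ ^ 2 + ‖c‖ ^ 2) ≤ e * (e / d) * ((2 * ‖y - b‖ ^ 2 + s ^ 2 / 8) + 2 * ‖c‖ ^ 2) := by
        gcongr
        nlinarith [sq_nonneg ‖c‖]
    _ = e * (2 * (e / d * (‖y - b‖ ^ 2 + ‖c‖ ^ 2)) + e * s * (s / d) / 8) := by ring
    _ ≤ e * (2 * s + 1 / 8 * s * 1 / 8) := by
        have : s / d ≤ 1 := by rw [div_le_one hd]; linarith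
        gcongr
    _ ≤ _ := by nlinarith

set_option maxHeartbeats 800000 in
theorem Near.zg (h : Near p β M C1 κ rg Ω δ ν a v g b d N e k1) {y c : V} (hy : ‖y - b‖ ≤ d / 2)
    (hcd : ‖c‖ ≤ d) (hc : ⟪c, ν b⟫ = 0) (hs : 0 < ⟪y - b, ν b⟫)
    (hw : e / d * (‖y - b‖ ^ 2 + ‖c‖ ^ 2) ≤ ⟪y - b, ν b⟫) :
    ‖g (y + c) - g y‖ ≤ E3 (Module.finrank ℝ V) k1 * e * N := by
  have S := h.S
  have G := S.geo
  have hκ := G.hκ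
  have hd := h.hd
  have hN := h.hN
  have he := h.he
  have hk1 := h.hk1
  have he1 := h.he1
  set n : ℝ := (Module.finrank ℝ V : ℝ) with hn'
  have hn : 0 ≤ n := by positivity
  have hsd : ⟪y - b, ν b⟫ ≤ ‖y - b‖ := G.inner_le h.hb
  have W := fun y' hy' => h.wall (c := c) hy hs hw (y' := y') hy'
  set s := ⟪y - b, ν b⟫ with hs'
  have hB : ∀ y' ∈ closedBall y (s / 4), ‖y' - y‖ ≤ s / 4 := fun y' h' => by
    rwa [mem_closedBall, dist_eq_norm] at h'
  have hnc : ∀ y, ‖y + c - b‖ ≤ ‖y - b‖ + d := fun y => by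
    rw [show y + c - b = (y - b) + c by abel]
    exact (norm_add_le _ _).trans (by linarith)
  have W2 : ∀ y' ∈ closedBall y (s / 4), 0 < ⟪y' - b, ν b⟫ ∧ 4 * κ * (‖y' - b‖ ^ 2 + ‖c‖ ^ 2) ≤ ⟪y' - b, ν b⟫ :=
    fun y' h' => by
      have := W y' (hB y' h')
      refine ⟨by linarith, ?_⟩
      have : 3 * e * s ≤ 3 * (1/8) * s := by gcongr
      linarith
  have P := fun y' h' => h.pt (y := y') (c := c) (by linarith [(W y' (hB y' h')).2.2.1])
    (by linarith [(W y' (hB y' h')).2.2.1, hnc y']) hc (W2 y' h').1 (W2 y' h').2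
  have hgc : ContinuousOn (fun y => g (y + c) - g y) (closedBall y (s / 4)) :=
    (S.gc.comp (by fun_prop) fun y h' => (P y h').2.1).sub (S.gc.mono fun y h' => (P y h').1.1)
  have key := lemGe (v := fun z => v (z + c) - v z) (G := fun y => g (y + c) - g y) (x0 := y)
    (R := s / 4) (S := N * e * s * (12 + 2 * EZ n k1)) (g := 2 * M) (k := k1) (by positivity) hk1
    (by linarith [S.hM]) hgc ?_ ?_
  · refine key.trans ?_
    rw [← hn']
    unfold E3
    have e1 : N * e * s * (12 + 2 * EZ n k1) / (s / 4) = N * e * (48 + 8 * EZ n k1) := by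
      field_simp; ring
    rw [e1]
    have e2 : 2 * M * (s / 4) ≤ e * N := by
      have := h.Md
      have : M * s ≤ M * d := mul_le_mul_of_nonneg_left (by linarith) S.hM
      nlinarith [mul_nonneg S.hM hs.le]
    calc _ ≤ (2 * n + 1) * (8 * k1 + 8) * (N * e * (48 + 8 * EZ n k1) + e * N) := by gcongr
      _ = _ := by ring
  · intro y' h'
    have w := W y' (hB y' h')
    obtain ⟨l, hl1, hl2⟩ := S.zjet (N := N) (P y' h').1.1 (P y' h').2.1
      (h.bnd y' (P y' h').1.1 (by linarith [w.2.2.1])).2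
      (h.bnd _ (P y' h').2.1 (by linarith [w.2.2.1, hnc y'])).2
    refine ⟨l, hl1, hl2.trans ?_⟩
    gcongr
    refine h.hk.trans ?_
    gcongr
    linarith
  · intro y' h'
    have w := W y' (hB y' h')
    have z1 := h.z0 w.2.2.1 hcd hc (W2 y' h').1 (W2 y' h').2 (σ := 1) (by simp)
    have z2 := h.z0 w.2.2.1 hcd hc (W2 y' h').1 (W2 y' h').2 (σ := -1) (by simp)
    have hEZ : 0 ≤ EZ n k1 := by unfold EZ; positivity
    have z3 : N * (16 * κ * (‖y' - b‖ ^ 2 + ‖c‖ ^ 2) + EZ n k1 * e * ⟪y' - b, ν b⟫) ≤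
       N * e * s * (12 + 2 * EZ n k1) := by
      calc _ = N * (4 * (4 * κ * (‖y' - b‖ ^ 2 + ‖c‖ ^ 2)) + EZ n k1 * e * ⟪y' - b, ν b⟫) := by ring
        _ ≤ N * (4 * (3 * e * s) + EZ n k1 * e * (2 * s)) := by
          have := w.2.2.2
          have : ⟪y' - b, ν b⟫ ≤ 2 * s := by linarith [w.2.1]
          gcongr
        _ = _ := by ring
    rw [abs_le]
    constructor <;> linarith

def E4 (n k1 : ℝ) : ℝ := k1 * E3 n k1 + 2

theorem Near.zl (h : Near p β M C1 κ rg Ω δ ν a v g b d N e k1) {y c : V} (hy : ‖y - b‖ ≤ d / 2)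
    (hcd : ‖c‖ ≤ d) (hc : ⟪c, ν b⟫ = 0) (hs : 0 < ⟪y - b, ν b⟫)
    (hw : e / d * (‖y - b‖ ^ 2 + ‖c‖ ^ 2) ≤ ⟪y - b, ν b⟫) :
    ∃ l1 l2, Jet v (y + c) (g (y + c)) l1 ∧ Jet v y (g y) l2 ∧
      |l1 - l2| ≤ E4 (Module.finrank ℝ V) k1 * (e * N / d) := by
  have S := h.S
  have hd := h.hd
  have hN := h.hN
  have he := h.he
  have hk1 := h.hk1
  have he1 := h.he1
  have hw' := h.wall (c := c) hy hs hw (y' := y) (by simp; positivity)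
  have hnc : ‖y + c - b‖ ≤ ‖y - b‖ + d := by
    rw [show y + c - b = (y - b) + c by abel]
    exact (norm_add_le _ _).trans (by linarith)
  have P := h.pt (y := y) (c := c) (by linarith) (by linarith) hc hs (by nlinarith)
  obtain ⟨l1, j1, b1⟩ := S.jet _ P.1.1
  obtain ⟨l2, j2, b2⟩ := S.jet _ P.2.1
  refine ⟨l2, l1, j2, j1, ?_⟩
  have b3 := normpow_lip (p := p) (by linarith [S.hp]) (h.bnd _ P.2.1 (by linarith)).2 (h.bnd _ P.1.1 (by linarith)).2
  have b4 := h.zg hy hcd hc hs hw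
  set n : ℝ := (Module.finrank ℝ V : ℝ) with hn'
  have b5 : p * N ^ (p - 1) * ‖g (y + c) - g y‖ ≤ k1 / d * (E3 n k1 * e * N) := by
    gcongr
    exact h.hk
  have q4 : M ≤ e * N / d := by rw [le_div_iff₀ hd]; exact h.Md
  have : E4 n k1 * (e * N / d) = k1 / d * (E3 n k1 * e * N) + 2 * (e * N / d) := by
    unfold E4; ring
  rw [this]
  rw [abs_le] at *
  constructor <;> linarith
end LemZg


section FourBar
variable {V : Type*} [NormedAddCommGroup V] [InnerProductSpace ℝ V] [FiniteDimensional ℝ V]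
  [CompleteSpace V]

theorem four_alg {D s : ℝ} (hD : 0 < D) (hs : 0 < s) :
    (D * s) ^ (4 / 3 : ℝ) ≤ D ^ 2 + 4 * s ^ 2 * D := by
  obtain ⟨x, hx, rfl⟩ : ∃ x, 0 < x ∧ x ^ 3 = D := ⟨D ^ (1 / 3 : ℝ), by positivity, by
    rw [← Real.rpow_natCast, ← Real.rpow_mul hD.le]; norm_num⟩
  obtain ⟨y, hy, rfl⟩ : ∃ x, 0 < x ∧ x ^ 3 = s := ⟨s ^ (1 / 3 : ℝ), by positivity, by
    rw [← Real.rpow_natCast, ← Real.rpow_mul hs.le]; norm_num⟩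
  have h1 : (x ^ 3 * y ^ 3) ^ (4 / 3 : ℝ) = (x * y) ^ 4 := by
    rw [← mul_pow, ← Real.rpow_natCast (x * y) 3, ← Real.rpow_mul (by positivity),
      ← Real.rpow_natCast (x * y) 4]; norm_num
  rw [h1]
  have : x * y ^ 4 ≤ x ^ 3 + y ^ 6 := by
    rcases le_total (y ^ 2) x with h | h
    · have : x * (y ^ 2) ^ 2 ≤ x * x ^ 2 := by gcongr
      nlinarith [pow_pos hy 6]
    · have : x * y ^ 4 ≤ y ^ 2 * y ^ 4 := by gcongr
      nlinarith [pow_pos hx 3]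
  have h2 : x ^ 3 * (x * y ^ 4) ≤ x ^ 3 * (x ^ 3 + y ^ 6) := by gcongr
  nlinarith [mul_pos (pow_pos hx 3) (pow_pos hy 6)]

theorem four_jet {e1 e2 e3 w0 w : V} {m : ℝ} (h1 : ‖e1‖ = 1) (h2 : ‖e2‖ = 1) (h3 : ‖e3‖ = 1)
    (h12 : ⟪e1, e2⟫ = 0) (h13 : ⟪e1, e3⟫ = 0) (h23 : ⟪e2, e3⟫ = 0) (hs : 0 < ⟪w - w0, e1⟫)
    (hq : |⟪w - w0, e3⟫| < ⟪w - w0, e2⟫ - m) :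
    ∃ g l, Jet (fun w => (((⟪w - w0, e2⟫ - m) ^ 2 - ⟪w - w0, e3⟫ ^ 2) * ⟪w - w0, e1⟫) ^ (2 / 3 : ℝ)) w g l ∧
      l ≤ - (2 / 9) := by
  have jP := (Jet.linear w0 e2 w).sub (Jet.const m w)
  have jq := Jet.linear w0 e3 w
  have js := Jet.linear w0 e1 w
  have jX := ((jP.mul jP).sub (jq.mul jq)).mul js
  set P := ⟪w - w0, e2⟫ - m
  set q := ⟪w - w0, e3⟫
  set s := ⟪w - w0, e1⟫
  have hqP : 0 < P ^ 2 - q ^ 2 := by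
    have := sq_lt_sq.2 (show |q| < |P| by rw [abs_of_pos (lt_of_le_of_lt (abs_nonneg _) hq)]; exact hq)
    linarith
  have hX : 0 < (P * P - q * q) * s := by
    have : P * P - q * q = P ^ 2 - q ^ 2 := by ring
    rw [this]; positivity
  set X := (P * P - q * q) * s with hXd
  have := jX.comp (η := fun x => x ^ (2 / 3 : ℝ)) (η' := fun x => (2 / 3) * x ^ (-(1 / 3) : ℝ))
    (c := -(2 / 9) * X ^ (-(4 / 3) : ℝ)) ?_ ?_
  · refine ⟨_, _, this.congr_fun (Eventually.of_forall fun z => by simp only [sq]), ?_⟩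
    have i1 : ⟪e1, e1⟫ = (1 : ℝ) := by rw [real_inner_self_eq_norm_sq, h1]; norm_num
    have i2 : ⟪e2, e2⟫ = (1 : ℝ) := by rw [real_inner_self_eq_norm_sq, h2]; norm_num
    have i3 : ⟪e3, e3⟫ = (1 : ℝ) := by rw [real_inner_self_eq_norm_sq, h3]; norm_num
    have i21 : ⟪e2, e1⟫ = (0 : ℝ) := by rw [real_inner_comm, h12]
    have i31 : ⟪e3, e1⟫ = (0 : ℝ) := by rw [real_inner_comm, h13]
    have i32 : ⟪e3, e2⟫ = (0 : ℝ) := by rw [real_inner_comm, h23]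
    rw [← real_inner_self_eq_norm_sq]
    simp only [inner_sub_left, inner_sub_right, inner_add_left, inner_add_right, inner_smul_left, inner_smul_right,
      i1, i2, i3, i21, i31, i32, h12, h13, h23, inner_zero_left, inner_zero_right, map_sub, conj_trivial, sub_zero]
    have key := four_alg hqP hs
    have e4 : (P * P - q * q) * s = (P ^ 2 - q ^ 2) * s := by ring
    have e5 : X ^ (-(4 / 3) : ℝ) * X ^ (4 / 3 : ℝ) = 1 := by
      rw [← Real.rpow_add hX]; norm_num
    rw [← e4] at key
    have e6 : (P ^ 2 - q ^ 2) ^ 2 + 4 * s ^ 2 * (P ^ 2 - q ^ 2) ≤ (P ^ 2 - q ^ 2) ^ 2 + 4 * s ^ 2 * (P ^ 2 + q ^ 2) := by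
      gcongr
      nlinarith
    have e7 : (1 : ℝ) ≤ X ^ (-(4 / 3) : ℝ) * ((P ^ 2 - q ^ 2) ^ 2 + 4 * s ^ 2 * (P ^ 2 + q ^ 2)) := by
      rw [← e5]; gcongr; exact key.trans e6
    ring_nf at e7 ⊢
    linarith
  · filter_upwards [lt_mem_nhds hX] with x hx
    refine (Real.hasDerivAt_rpow_const (Or.inl hx.ne')).congr_deriv (by norm_num)
  · refine ((Real.hasDerivAt_rpow_const (p := (-(1 / 3) : ℝ)) (Or.inl hX.ne')).const_mul (2 / 3)).congr_deriv ?_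
    rw [show (-(1 / 3) - 1 : ℝ) = -(4 / 3) by norm_num]
    ring

/-- coisometry `V × ℝ → V` changing the `τ`-coordinate -/
def co4 (τ : V) (α γ : ℝ) : WithLp 2 (V × ℝ) →L[ℝ] V :=
  WithLp.fstL 2 ℝ V ℝ + ((α - 1) • (innerSL ℝ τ).comp (WithLp.fstL 2 ℝ V ℝ) + γ • WithLp.sndL 2 ℝ V ℝ).smulRight τ

theorem co4_apply (τ : V) (α γ : ℝ) (w : WithLp 2 (V × ℝ)) :
    co4 τ α γ w = w.fst + ((α - 1) * ⟪τ, w.fst⟫ + γ * w.snd) • τ := by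
  simp [co4]

theorem co4_co {τ : V} (hτ : ‖τ‖ = 1) {α γ : ℝ} (h : α ^ 2 + γ ^ 2 = 1) (x : V) :
    co4 τ α γ (ContinuousLinearMap.adjoint (co4 τ α γ) x) = x := by
  have i2 : ⟪τ, τ⟫ = (1 : ℝ) := by rw [real_inner_self_eq_norm_sq, hτ]; norm_num
  have : ContinuousLinearMap.adjoint (co4 τ α γ) x =
    WithLp.toLp 2 (x + ((α - 1) * ⟪τ, x⟫) • τ, γ * ⟪τ, x⟫) := by
    refine ext_inner_right ℝ fun w => ?_
    rw [ContinuousLinearMap.adjoint_inner_left, co4_apply, WithLp.prod_inner_apply]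
    simp only [inner_add_right, inner_add_left, inner_smul_right, inner_smul_left, conj_trivial]
    simp [real_inner_comm]
    ring
  rw [this, co4_apply]
  simp only [WithLp.toLp_fst, WithLp.toLp_snd, inner_add_right, inner_smul_right, i2]
  have : x + ((α - 1) * ⟪τ, x⟫) • τ + ((α - 1) * (⟪τ, x⟫ + (α - 1) * ⟪τ, x⟫ * 1) + γ * (γ * ⟪τ, x⟫)) • τ
    = x + ((α^2 + γ^2 - 1) * ⟪τ, x⟫) • τ := by module
  rw [this, h]; simp

theorem co4_jet {v : V → ℝ} {τ b : V} (hτ : ‖τ‖ = 1) {α γ m : ℝ} (h : α ^ 2 + γ ^ 2 = 1)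
    {w : WithLp 2 (V × ℝ)} {g : V} {l : ℝ} (j : Jet v (w.fst + ((α - 1) * (⟪w.fst - b, τ⟫ - m) + γ * w.snd) • τ) g l) :
    ∃ g', Jet (fun w : WithLp 2 (V × ℝ) => v (w.fst + ((α - 1) * (⟪w.fst - b, τ⟫ - m) + γ * w.snd) • τ)) w g' l := by
  have e : ∀ w : WithLp 2 (V × ℝ), w.fst + ((α - 1) * (⟪w.fst - b, τ⟫ - m) + γ * w.snd) • τ =
    co4 τ α γ w + (-(α - 1) * (⟪b, τ⟫ + m)) • τ := fun w => by
      rw [co4_apply, inner_sub_left, real_inner_comm τ w.fst]; module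
  rw [e] at j
  exact ⟨_, (j.coisom _ _ w (co4_co hτ h)).congr_fun (Eventually.of_forall fun w => by rw [e])⟩
end FourBar


section LemF
variable {V : Type*} [NormedAddCommGroup V] [InnerProductSpace ℝ V] [FiniteDimensional ℝ V]
  [CompleteSpace V]
variable {p β M C1 κ rg : ℝ} {Ω : Set V} {δ : V → ℝ} {ν : V → V} {a : V} {v : V → ℝ} {g : V → V}
variable {b : V} {d N e k1 : ℝ}

set_option maxHeartbeats 1600000 in
theorem Near.f1 (h : Near p β M C1 κ rg Ω δ ν a v g b d N e k1) {τ : V} (hτ : ‖τ‖ = 1)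
    (hτν : ⟪τ, ν b⟫ = 0) {y : V} {q m t : ℝ} (hP : |q| ≤ ⟪y - b, τ⟫ - m)
    (hw : 32 * (e / d) * (‖y - b‖ ^ 2 + q ^ 2 + m ^ 2) ≤ ⟪y - b, ν b⟫)
    (hQ : ‖y - b‖ ^ 2 + q ^ 2 + m ^ 2 ≤ d ^ 2 / 128) (ht : |t| ≤ 2 * (⟪y - b, τ⟫ - m)) :
    ‖t • τ‖ ^ 2 ≤ 8 * (‖y - b‖ ^ 2 + q ^ 2 + m ^ 2) ∧ ‖y - b‖ ≤ d / 8 ∧ ‖t • τ‖ ≤ d / 4 ∧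
    (0 < ⟪y - b, ν b⟫ → y + t • τ ∈ Ω ∧ |v (y + t • τ)| ≤ 2 * N * ⟪y - b, ν b⟫) ∧
    y + t • τ ∈ closure Ω := by
  have G := h.S.geo
  have hκ := G.hκ
  have hd := h.hd
  have he := h.he
  have he1 := h.he1
  have hN := h.hN
  set P := ⟪y - b, τ⟫ - m with hPd
  set Q := ‖y - b‖ ^ 2 + q ^ 2 + m ^ 2 with hQd
  set s := ⟪y - b, ν b⟫ with hsd
  have hP0 : 0 ≤ P := (abs_nonneg _).trans hP
  have hQ0 : 0 ≤ Q := by positivity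
  have hyt : |⟪y - b, τ⟫| ≤ ‖y - b‖ := by
    have := abs_real_inner_le_norm (y - b) τ
    rwa [hτ, mul_one] at this
  have hyt2 : ⟪y - b, τ⟫ ^ 2 ≤ ‖y - b‖ ^ 2 := by
    rw [← sq_abs]; gcongr
  have hP2 : P ^ 2 ≤ 2 * Q := by
    have : P ^ 2 ≤ 2 * ⟪y - b, τ⟫ ^ 2 + 2 * m ^ 2 := by nlinarith [sq_nonneg (⟪y - b, τ⟫ + m)]
    nlinarith [sq_nonneg q]
  have hc2 : ‖t • τ‖ ^ 2 ≤ 8 * Q := by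
    rw [norm_smul, hτ, mul_one, Real.norm_eq_abs]
    have : |t| ^ 2 ≤ (2 * P) ^ 2 := by gcongr
    nlinarith
  have hy8 : ‖y - b‖ ≤ d / 8 := by
    apply abs_le_of_sq_le_sq' _ (by positivity) |>.2
    nlinarith [sq_nonneg q, sq_nonneg m]
  have hc8 : ‖t • τ‖ ≤ d / 4 := by
    apply abs_le_of_sq_le_sq' _ (by positivity) |>.2
    nlinarith [sq_nonneg q, sq_nonneg m]
  have hnc : ‖y + t • τ - b‖ ≤ d / 2 := by
    rw [show y + t • τ - b = (y - b) + t • τ by abel]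
    exact (norm_add_le _ _).trans (by linarith)
  have hpos : 0 < s → y + t • τ ∈ Ω ∧ |v (y + t • τ)| ≤ 2 * N * s := fun hs => by
    have h5 : 4 * κ ≤ e / d := by
      have := h.kd
      rw [le_div_iff₀ hd]; nlinarith
    have P := h.pt (y := y) (c := t • τ) (by linarith) (by linarith) (by rw [inner_smul_left, hτν]; simp) hs (by
      calc 4 * κ * (‖y - b‖ ^ 2 + ‖t • τ‖ ^ 2) ≤ e / d * (Q + 8 * Q) := by
            gcongr
            rw [hQd]; nlinarith [sq_nonneg q, sq_nonneg m]
        _ ≤ 32 * (e / d) * Q := by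
            have : 0 ≤ e / d * Q := by positivity
            linarith
        _ ≤ _ := hw)
    refine ⟨P.2.1, (h.bnd _ P.2.1 (by linarith)).1.trans ?_⟩
    have := P.2.2.2
    calc N * δ (y + t • τ) ≤ N * (2 * s) := by gcongr
      _ = _ := by ring
  refine ⟨hc2, hy8, hc8, hpos, ?_⟩
  rcases lt_or_ge 0 s with hs | hs
  · exact subset_closure (hpos hs).1
  have hQz : Q = 0 := by
    by_contra hne
    have : 0 < Q := lt_of_le_of_ne hQ0 (Ne.symm hne)
    have : 0 < 32 * (e / d) * Q := by positivity
    linarith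
  have h1 : ‖y - b‖ = 0 := by
    have : ‖y - b‖ ^ 2 = 0 := by nlinarith [sq_nonneg q, sq_nonneg m, sq_nonneg ‖y - b‖]
    simpa using this
  have h2 : ‖t • τ‖ = 0 := by
    have : ‖t • τ‖ ^ 2 = 0 := by nlinarith [sq_nonneg ‖t • τ‖]
    simpa using this
  rw [norm_eq_zero] at h1 h2
  rw [h2, add_zero, sub_eq_zero.1 h1]
  exact frontier_subset_closure h.hb

def E6 (n nW k1 : ℝ) : ℝ := (9 / 2) * (2 * E4 n k1 + 512 * nW + 1)

theorem inW1 (x : V) (w : WithLp 2 (V × ℝ)) (b : V) : ⟪w - WithLp.toLp 2 (b, (0:ℝ)), WithLp.toLp 2 (x, (0:ℝ))⟫ = ⟪w.fst - b, x⟫ := by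
  rw [WithLp.prod_inner_apply]; simp
theorem inW2 (w : WithLp 2 (V × ℝ)) (b : V) : ⟪w - WithLp.toLp 2 (b, (0:ℝ)), WithLp.toLp 2 ((0:V), (1:ℝ))⟫ = w.snd := by
  rw [WithLp.prod_inner_apply]; simp
theorem inW3 (w : WithLp 2 (V × ℝ)) (b : V) : ‖w - WithLp.toLp 2 (b, (0:ℝ))‖ ^ 2 = ‖w.fst - b‖ ^ 2 + w.snd ^ 2 := by
  rw [WithLp.prod_norm_sq_eq_of_L2]; simp

set_option maxHeartbeats 3200000 in
theorem Near.F (h : Near p β M C1 κ rg Ω δ ν a v g b d N e k1) {τ : V} (hτ : ‖τ‖ = 1)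
    (hτν : ⟪τ, ν b⟫ = 0) {y : V} {q m : ℝ} (hP : |q| ≤ ⟪y - b, τ⟫ - m)
    (hw : 32 * (e / d) * (‖y - b‖ ^ 2 + q ^ 2 + m ^ 2) ≤ ⟪y - b, ν b⟫)
    (hQ : ‖y - b‖ ^ 2 + q ^ 2 + m ^ 2 ≤ d ^ 2 / 128) {σ : ℝ} (hσ : |σ| = 1) :
    σ * ((v y + v (y + (-2 * (⟪y - b, τ⟫ - m)) • τ)) -
      (v (y + (q - (⟪y - b, τ⟫ - m)) • τ) + v (y + (-q - (⟪y - b, τ⟫ - m)) • τ))) ≤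
    E6 (Module.finrank ℝ V) (Module.finrank ℝ (WithLp 2 (V × ℝ))) k1 * (e * N / d) *
      (((⟪y - b, τ⟫ - m) ^ 2 - q ^ 2) * ⟪y - b, ν b⟫) ^ (2 / 3 : ℝ)
      + 256 * (e * N / d) * (‖y - b‖ ^ 2 + q ^ 2 + m ^ 2) := by
  have S := h.S
  have G := S.geo
  have hκ := G.hκ
  have hd := h.hd
  have he := h.he
  have he1 := h.he1
  have hN := h.hN
  have hk1 := h.hk1
  set n : ℝ := (Module.finrank ℝ V : ℝ) with hn'
  have hn : 0 ≤ n := by positivity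
  set nW : ℝ := (Module.finrank ℝ (WithLp 2 (V × ℝ)) : ℝ) with hnW'
  have hnW : 0 ≤ nW := by positivity
  set R := e * N / d with hR
  have hRp : 0 < R := by positivity
  have hE4 : 0 ≤ E4 n k1 := by unfold E4 E3 EZ; positivity
  have hE6 : 0 ≤ E6 n nW k1 := by unfold E6; positivity
  let Pf : WithLp 2 (V × ℝ) → ℝ := fun w => ⟪w.fst - b, τ⟫ - m
  let Qf : WithLp 2 (V × ℝ) → ℝ := fun w => ‖w.fst - b‖ ^ 2 + w.snd ^ 2 + m ^ 2
  let sf : WithLp 2 (V × ℝ) → ℝ := fun w => ⟪w.fst - b, ν b⟫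
  let pt : ℝ → ℝ → WithLp 2 (V × ℝ) → V := fun α γ w => w.fst + ((α - 1) * (⟪w.fst - b, τ⟫ - m) + γ * w.snd) • τ
  let F : WithLp 2 (V × ℝ) → ℝ := fun w => (v (pt 1 0 w) + v (pt (-1) 0 w)) - (v (pt 0 1 w) + v (pt 0 (-1) w))
  let K : Set (WithLp 2 (V × ℝ)) := {w | |w.snd| ≤ Pf w ∧ 32 * (e / d) * Qf w ≤ sf w ∧ Qf w ≤ d ^ 2 / 128}
  have c1 : Continuous fun w : WithLp 2 (V × ℝ) => w.fst := (WithLp.fstL 2 ℝ V ℝ).continuous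
  have c2 : Continuous fun w : WithLp 2 (V × ℝ) => w.snd := (WithLp.sndL 2 ℝ V ℝ).continuous
  have cP : Continuous Pf := by fun_prop
  have cQ : Continuous Qf := by fun_prop
  have cs : Continuous sf := by fun_prop
  have cpt : ∀ α γ, Continuous (pt α γ) := fun α γ => by fun_prop
  have cabs : Continuous fun w : WithLp 2 (V × ℝ) => |w.snd| := by fun_prop
  have cw : Continuous fun w => 32 * (e / d) * Qf w := by fun_prop
  have hKc : IsCompact K := by
    refine (isCompact_closedBall (WithLp.toLp 2 (b, (0:ℝ))) d).of_isClosed_subset ?_ (fun w hw => ?_)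
    · exact (isClosed_le cabs cP).inter ((isClosed_le cw cs).inter (isClosed_le cQ continuous_const))
    · rw [mem_closedBall, dist_eq_norm]
      have h1 := hw.2.2
      apply abs_le_of_sq_le_sq' _ hd.le |>.2
      rw [inW3]
      simp only [Qf] at h1
      nlinarith [sq_nonneg m]
  have hpt : ∀ w ∈ K, ∀ t : ℝ, |t| ≤ 2 * Pf w → _ := fun w hw t ht => h.f1 hτ hτν (y := w.fst) (q := w.snd) (m := m) (t := t) hw.1 hw.2.1 hw.2.2 ht
  have hco : ∀ w ∈ K, ∀ α γ : ℝ, |α| + |γ| ≤ 1 → |(α - 1) * Pf w + γ * w.snd| ≤ 2 * Pf w := fun w hw α γ hαγ => by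
    have h1 := hw.1
    have h0 : 0 ≤ Pf w := (abs_nonneg _).trans h1
    have h2 : |γ * w.snd| ≤ |γ| * Pf w := by rw [abs_mul]; gcongr
    have h3 : |α * Pf w| = |α| * Pf w := by rw [abs_mul, abs_of_nonneg h0]
    have h4 : (|α| + |γ|) * Pf w ≤ 1 * Pf w := by gcongr
    rw [abs_le] at h2 ⊢
    have h5 := abs_le.1 h3.le
    constructor <;> nlinarith
  have hcl : ∀ α γ : ℝ, |α| + |γ| ≤ 1 → ContinuousOn (fun w => v (pt α γ w)) K := fun α γ hαγ =>
    S.cont.comp (cpt α γ).continuousOn fun w hw => (hpt w hw _ (hco w hw α γ hαγ)).2.2.2.2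
  have cF : ContinuousOn F K := ((hcl 1 0 (by norm_num)).add (hcl (-1) 0 (by norm_num))).sub
    ((hcl 0 1 (by norm_num)).add (hcl 0 (-1) (by norm_num)))
  let X : WithLp 2 (V × ℝ) → ℝ := fun w => (Pf w ^ 2 - w.snd ^ 2) * sf w
  have cX : Continuous fun w => (X w) ^ (2 / 3 : ℝ) := by
    have : Continuous X := by fun_prop
    exact this.rpow_const fun w => Or.inr (by norm_num)
  have hX0 : ∀ w ∈ K, 0 ≤ X w := fun w hw => by
    have h1 := hw.1
    have h0 : 0 ≤ Pf w := (abs_nonneg _).trans h1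
    have h2 : 0 ≤ sf w := le_trans (by positivity) hw.2.1
    have : w.snd ^ 2 ≤ Pf w ^ 2 := sq_le_sq.2 (by rwa [abs_of_nonneg h0])
    exact mul_nonneg (by linarith) h2
  have key := ell_max hKc (Φ := fun w => σ * F w - E6 n nW k1 * R * (X w) ^ (2 / 3 : ℝ) - 256 * R * Qf w)
    (((continuousOn_const.mul cF).sub (continuousOn_const.mul cX.continuousOn)).sub (continuousOn_const.mul cQ.continuousOn)) ?_
    (WithLp.toLp 2 (y, q)) ⟨hP, hw, hQ⟩
  · have e1 : F (WithLp.toLp 2 (y, q)) = ((v y + v (y + (-2 * (⟪y - b, τ⟫ - m)) • τ)) -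
      (v (y + (q - (⟪y - b, τ⟫ - m)) • τ) + v (y + (-q - (⟪y - b, τ⟫ - m)) • τ))) := by
      simp only [F, pt]
      congr 2
      · congr 1; simp
      · congr 3; simp; norm_num
      · congr 3; simp; ring
      · congr 3; simp; ring
    rw [← e1]
    have e2 : X (WithLp.toLp 2 (y, q)) = ((⟪y - b, τ⟫ - m) ^ 2 - q ^ 2) * ⟪y - b, ν b⟫ := rfl
    have e3 : Qf (WithLp.toLp 2 (y, q)) = ‖y - b‖ ^ 2 + q ^ 2 + m ^ 2 := rfl
    rw [← e2, ← e3]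
    linarith
  intro w hw hpos
  have hwX := hX0 w hw
  have hQ0 : 0 ≤ Qf w := by positivity
  have hlt : 256 * R * Qf w < |F w| := by
    have : σ * F w ≤ |F w| := by
      refine (le_abs_self _).trans ?_
      rw [abs_mul, hσ, one_mul]
    have : 0 ≤ E6 n nW k1 * R * (X w) ^ (2 / 3 : ℝ) := by positivity
    have hpos' : 0 < σ * F w - E6 n nW k1 * R * (X w) ^ (2 / 3 : ℝ) - 256 * R * Qf w := hpos
    linarith
  have hP0 : 0 ≤ Pf w := (abs_nonneg _).trans hw.1
  have hs0 : 0 ≤ sf w := le_trans (by positivity) hw.2.1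
  have hpt0 : pt 1 0 w = w.fst := by simp [pt]
  -- strictness
  have st1 : |w.snd| < Pf w := by
    refine lt_of_le_of_ne hw.1 fun heq => ?_
    have hF : F w = 0 := by
      rcases abs_choice w.snd with h' | h'
      · have e1 : pt 0 1 w = pt 1 0 w := by
          rw [hpt0]; simp only [pt]
          have : (0 - 1) * (⟪w.fst - b, τ⟫ - m) + 1 * w.snd = 0 := by
            have : w.snd = ⟪w.fst - b, τ⟫ - m := h' ▸ heq
            linarith
          rw [this]; simp
        have e2 : pt 0 (-1) w = pt (-1) 0 w := by
          simp only [pt]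
          congr 2
          have : w.snd = ⟪w.fst - b, τ⟫ - m := h' ▸ heq
          linarith
        simp only [F, e1, e2]; ring
      · have h'' : - w.snd = ⟪w.fst - b, τ⟫ - m := h' ▸ heq
        have e1 : pt 0 (-1) w = pt 1 0 w := by
          rw [hpt0]; simp only [pt]
          have : (0 - 1) * (⟪w.fst - b, τ⟫ - m) + -1 * w.snd = 0 := by
            linarith
          rw [this]; simp
        have e2 : pt 0 1 w = pt (-1) 0 w := by
          simp only [pt]
          congr 2
          linarith
        simp only [F, e1, e2]; ring
    rw [hF, abs_zero] at hlt
    have : 0 ≤ 256 * R * Qf w := by positivity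
    linarith
  have hQp : 0 < Qf w := by
    have h1 : 0 < Pf w := lt_of_le_of_lt (abs_nonneg _) st1
    refine lt_of_le_of_ne hQ0 fun heq => ?_
    have h2 := (hpt w hw (Pf w) (by rw [abs_of_pos h1]; linarith)).1
    rw [norm_smul, hτ, mul_one, Real.norm_eq_abs, sq_abs] at h2
    have : 8 * (‖w.fst - b‖ ^ 2 + w.snd ^ 2 + m ^ 2) = 8 * Qf w := rfl
    rw [this, ← heq] at h2
    nlinarith
  have hsp : 0 < sf w := lt_of_lt_of_le (by positivity) hw.2.1
  have hab : ∀ x1 x2 x3 x4 : ℝ, |x1 + x2 - (x3 + x4)| ≤ |x1| + |x2| + (|x3| + |x4|) := fun x1 x2 x3 x4 =>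
    (abs_sub _ _).trans (add_le_add (abs_add_le _ _) (abs_add_le _ _))
  have st2 : 32 * (e / d) * Qf w < sf w := by
    refine lt_of_le_of_ne hw.2.1 fun heq => ?_
    have v1 : ∀ α γ : ℝ, |α| + |γ| ≤ 1 → |v (pt α γ w)| ≤ 2 * N * sf w := fun α γ hαγ =>
      ((hpt w hw _ (hco w hw α γ hαγ)).2.2.2.1 hsp).2
    have := hab (v (pt 1 0 w)) (v (pt (-1) 0 w)) (v (pt 0 1 w)) (v (pt 0 (-1) w))
    have h1 := v1 1 0 (by norm_num)
    have h2 := v1 (-1) 0 (by norm_num)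
    have h3 := v1 0 1 (by norm_num)
    have h4 := v1 0 (-1) (by norm_num)
    have h5 : |F w| ≤ 8 * N * sf w := by
      refine this.trans ?_
      linarith
    rw [← heq] at h5
    have : 8 * N * (32 * (e / d) * Qf w) = 256 * R * Qf w := by rw [hR]; ring
    linarith
  -- differences between points
  have ed1 : pt 0 1 w = pt 1 0 w + (w.snd - Pf w) • τ := by
    rw [hpt0]; simp only [pt, Pf]; congr 2; ring
  have ed2 : pt 0 (-1) w = pt (-1) 0 w + (Pf w - w.snd) • τ := by
    simp only [pt, Pf]; module
  have tb : |w.snd - Pf w| ≤ 2 * Pf w := by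
    have := abs_le.1 hw.1
    rw [abs_le]; constructor <;> linarith
  have tb' : |Pf w - w.snd| ≤ 2 * Pf w := by rw [abs_sub_comm]; exact tb
  have hm1 := (hpt w hw _ (hco w hw (-1) 0 (by norm_num)))
  have hp1 := (hpt w hw _ (hco w hw 1 0 (by norm_num)))
  have h01 := (hpt w hw _ (hco w hw 0 1 (by norm_num)))
  have h0m := (hpt w hw _ (hco w hw 0 (-1) (by norm_num)))
  have hc1 := (hpt w hw _ tb)
  have hc2 := (hpt w hw _ tb')
  have nm1 : ‖pt (-1) 0 w - b‖ ≤ ‖w.fst - b‖ + ‖((-1 - 1) * Pf w + 0 * w.snd) • τ‖ := by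
    rw [show pt (-1) 0 w - b = (w.fst - b) + ((-1 - 1) * Pf w + 0 * w.snd) • τ by simp only [pt, Pf]; abel]
    exact norm_add_le _ _
  have hm12 : ‖((-1 - 1) * Pf w + 0 * w.snd) • τ‖ ≤ d / 4 := hm1.2.2.1
  have nm2 : ‖pt (-1) 0 w - b‖ ≤ 3 * d / 8 := nm1.trans ((add_le_add hm1.2.1 hm12).trans (by linarith))
  have hor : ∀ t : ℝ, ⟪t • τ, ν b⟫ = 0 := fun t => by rw [inner_smul_left, hτν]; simp
  have st3 : Qf w < d ^ 2 / 128 := by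
    refine lt_of_le_of_ne hw.2.2 fun heq => ?_
    have t1 := h.tan (pt 1 0 w) ((w.snd - Pf w) • τ) (hp1.2.2.2.1 hsp).1 (by rw [← ed1]; exact (h01.2.2.2.1 hsp).1)
      (by rw [hpt0]; linarith [hp1.2.1]) (by linarith [hc1.2.2.1]) (hor _)
    have t2 := h.tan (pt (-1) 0 w) ((Pf w - w.snd) • τ) (hm1.2.2.2.1 hsp).1 (by rw [← ed2]; exact (h0m.2.2.2.1 hsp).1)
      (by linarith [nm2]) (by linarith [hc2.2.2.1]) (hor _)
    rw [← ed1] at t1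
    rw [← ed2] at t2
    have : |F w| ≤ 2 * (e * N * d) := by
      simp only [F]
      rw [abs_le] at *
      constructor <;> linarith
    rw [heq] at hlt
    have : 256 * R * (d ^ 2 / 128) = 2 * (e * N * d) := by rw [hR]; field_simp; ring
    linarith
  constructor
  · have o : IsOpen {w | |w.snd| < Pf w ∧ 32 * (e / d) * Qf w < sf w ∧ Qf w < d ^ 2 / 128} :=
      (isOpen_lt cabs cP).inter ((isOpen_lt cw cs).inter (isOpen_lt cQ continuous_const))
    exact mem_of_superset (o.mem_nhds ⟨st1, st2, st3⟩) fun z hz => ⟨hz.1.le, hz.2.1.le, hz.2.2.le⟩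
  have hws : e / d * (32 * Qf w) ≤ sf w := by linarith [hw.2.1]
  have nsq : ‖pt (-1) 0 w - b‖ ^ 2 ≤ 2 * ‖w.fst - b‖ ^ 2 + 2 * ‖((-1 - 1) * Pf w + 0 * w.snd) • τ‖ ^ 2 := by
    have : ‖pt (-1) 0 w - b‖ ^ 2 ≤ (‖w.fst - b‖ + ‖((-1 - 1) * Pf w + 0 * w.snd) • τ‖) ^ 2 := by gcongr
    nlinarith [sq_nonneg (‖w.fst - b‖ - ‖((-1 - 1) * Pf w + 0 * w.snd) • τ‖)]
  have hQn : ‖w.fst - b‖ ^ 2 ≤ Qf w := by simp only [Qf]; nlinarith [sq_nonneg m, sq_nonneg w.snd]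
  have smin : ⟪pt (-1) 0 w - b, ν b⟫ = sf w := by
    rw [show pt (-1) 0 w - b = (w.fst - b) + ((-1 - 1) * Pf w + 0 * w.snd) • τ by simp only [pt, Pf]; abel,
      inner_add_left, hor, add_zero]
  have hd4 : ‖pt (-1) 0 w - b‖ ≤ d / 2 := by linarith [nm2]
  obtain ⟨l3, l1, j3, j1, bb1⟩ := h.zl (y := pt 1 0 w) (c := (w.snd - Pf w) • τ) (by rw [hpt0]; linarith [hp1.2.1])
    (by linarith [hc1.2.2.1]) (hor _) (by rw [hpt0]; exact hsp) (by
      rw [hpt0]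
      refine le_trans ?_ hws
      gcongr
      have := hc1.1
      have e3 : ‖w.fst - b‖ ^ 2 + w.snd ^ 2 + m ^ 2 = Qf w := rfl
      rw [e3] at this
      linarith)
  obtain ⟨l4, l2, j4, j2, bb2⟩ := h.zl (y := pt (-1) 0 w) (c := (Pf w - w.snd) • τ) hd4
    (by linarith [hc2.2.2.1]) (hor _) (by rw [smin]; exact hsp) (by
      rw [smin]
      refine le_trans ?_ hws
      gcongr
      have t1 := hc2.1
      have t2 := hm1.1
      have e3 : ‖w.fst - b‖ ^ 2 + w.snd ^ 2 + m ^ 2 = Qf w := rfl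
      rw [e3] at t1 t2
      have t3 : ‖((-1 - 1) * (⟪w.fst - b, τ⟫ - m) + 0 * w.snd) • τ‖ = ‖((-1 - 1) * Pf w + 0 * w.snd) • τ‖ := rfl
      linarith)
  rw [← ed1] at j3
  rw [← ed2] at j4
  obtain ⟨g1, J1⟩ := co4_jet (b := b) (m := m) hτ (α := 1) (γ := 0) (by norm_num) (w := w) j1
  obtain ⟨g2, J2⟩ := co4_jet (b := b) (m := m) hτ (α := -1) (γ := 0) (by norm_num) (w := w) j2
  obtain ⟨g3, J3⟩ := co4_jet (b := b) (m := m) hτ (α := 0) (γ := 1) (by norm_num) (w := w) j3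
  obtain ⟨g4, J4⟩ := co4_jet (b := b) (m := m) hτ (α := 0) (γ := -1) (by norm_num) (w := w) j4
  obtain ⟨gX, lX, JX, bX⟩ := four_jet (e1 := WithLp.toLp 2 (ν b, (0:ℝ))) (e2 := WithLp.toLp 2 (τ, (0:ℝ)))
    (e3 := WithLp.toLp 2 ((0:V), (1:ℝ))) (w0 := WithLp.toLp 2 (b, (0:ℝ))) (w := w) (m := m)
    (by rw [WithLp.norm_toLp_fst]; exact G.nrm b h.hb) (by rw [WithLp.norm_toLp_fst]; exact hτ)
    (by rw [WithLp.norm_toLp_snd]; simp)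
    (by rw [WithLp.prod_inner_apply]; simp; rw [real_inner_comm]; exact hτν)
    (by rw [WithLp.prod_inner_apply]; simp)
    (by rw [WithLp.prod_inner_apply]; simp)
    (by rw [inW1]; exact hsp) (by rw [inW1, inW2]; exact st1)
  have JQ := (Jet.normsq (WithLp.toLp 2 (b, (0:ℝ))) w).add (Jet.const (m ^ 2) w)
  simp only [inW1, inW2] at JX
  simp only [inW3] at JQ
  refine ⟨_, _, ((((J1.add J2).sub (J3.add J4)).const_mul σ).sub (JX.const_mul (E6 n nW k1 * R))).sub
    (JQ.const_mul (256 * R)), fun _ => ?_⟩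
  rw [← hnW']
  have hσl : -(2 * (E4 n k1 * R)) ≤ σ * (l1 + l2 - (l3 + l4)) := by
    have : |l1 + l2 - (l3 + l4)| ≤ 2 * (E4 n k1 * R) := by
      rw [abs_le] at *
      constructor <;> linarith
    have h2 := neg_abs_le (σ * (l1 + l2 - (l3 + l4)))
    rw [abs_mul, hσ, one_mul] at h2
    linarith
  have hx : E6 n nW k1 * R * lX ≤ E6 n nW k1 * R * (-(2 / 9)) := by gcongr
  have : E6 n nW k1 * R * (-(2 / 9)) = -(2 * (E4 n k1 * R)) - 512 * nW * R - R := by unfold E6; ring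
  linarith
end LemF


section LemH
variable {V : Type*} [NormedAddCommGroup V] [InnerProductSpace ℝ V] [FiniteDimensional ℝ V]
  [CompleteSpace V]
variable {p β M C1 κ rg : ℝ} {Ω : Set V} {δ : V → ℝ} {ν : V → V} {a : V} {v : V → ℝ} {g : V → V}
variable {b : V} {d N e k1 : ℝ}

theorem ball_facts {n b y : V} (hn : ‖n‖ = 1) {ρ : ℝ} (hρ : 0 < ρ)
    (hy : y ∈ closedBall (b + ρ • n) (ρ / 2)) : ρ / 2 ≤ ⟪y - b, n⟫ ∧ ⟪y - b, n⟫ ≤ 3 / 2 * ρ ∧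
    ‖y - b‖ ≤ 3 / 2 * ρ := by
  rw [mem_closedBall, dist_eq_norm] at hy
  have e1 : y - b = (y - (b + ρ • n)) + ρ • n := by abel
  have h1 := abs_real_inner_le_norm (y - (b + ρ • n)) n
  rw [hn, mul_one, abs_le] at h1
  have h2 : ⟪y - b, n⟫ = ⟪y - (b + ρ • n), n⟫ + ρ := by
    rw [e1, inner_add_left, inner_smul_left, real_inner_self_eq_norm_sq, hn]
    simp
  refine ⟨by linarith, by linarith, ?_⟩
  rw [e1]
  refine (norm_add_le _ _).trans ?_
  rw [norm_smul, hn, Real.norm_eq_abs, abs_of_pos hρ]; linarith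

theorem ball_diff {x y τ : V} (hτ : ‖τ‖ = 1) {ρ r : ℝ} (h1 : y ∈ closedBall x (ρ / 2))
    (h2 : y + r • τ ∈ closedBall x (ρ / 2)) : |r| ≤ ρ := by
  rw [mem_closedBall] at *
  have : dist (y + r • τ) y = |r| := by rw [dist_eq_norm]; simp [norm_smul, hτ]
  rw [← this]
  refine (dist_triangle_right _ _ x).trans (by linarith)

set_option maxHeartbeats 1600000 in
theorem Near.h2 (h : Near p β M C1 κ rg Ω δ ν a v g b d N e k1) {τ : V} (hτ : ‖τ‖ = 1)
    (hτν : ⟪τ, ν b⟫ = 0) {ρ : ℝ} (hρ : 0 < ρ) (hρd : 40 * ρ ≤ d) {y : V} {r : ℝ}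
    (h1 : y ∈ closedBall (b + ρ • ν b) (ρ / 2)) (h2 : y + r • τ ∈ closedBall (b + ρ • ν b) (ρ / 2)) :
    |v (y + r • τ) - v y| ≤ (1 + 2 * EZ (Module.finrank ℝ V) k1) * e * ρ * N := by
  have G := h.S.geo
  have hκ := G.hκ
  have hd := h.hd
  have he := h.he
  have he1 := h.he1
  have hN := h.hN
  have hk1 := h.hk1
  set n : ℝ := (Module.finrank ℝ V : ℝ) with hn'
  have hn : 0 ≤ n := by positivity
  have hEZ : 0 ≤ EZ n k1 := by unfold EZ; positivity
  obtain ⟨b1, b2, b3⟩ := ball_facts (G.nrm b h.hb) hρ h1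
  have hr := ball_diff hτ h1 h2
  have hc : ‖r • τ‖ = |r| := by simp [norm_smul, hτ]
  have hcc : ‖r • τ‖ ^ 2 ≤ ρ ^ 2 := by rw [hc]; gcongr
  have hyy : ‖y - b‖ ^ 2 ≤ (3 / 2 * ρ) ^ 2 := by gcongr
  have hsm : 4 * κ * (‖y - b‖ ^ 2 + ‖r • τ‖ ^ 2) ≤ e * ρ / 8 := by
    have h5 : 4 * κ ≤ e * e / d := by
      have := h.kd
      rw [le_div_iff₀ hd]; nlinarith
    calc 4 * κ * (‖y - b‖ ^ 2 + ‖r • τ‖ ^ 2) ≤ e * e / d * (4 * ρ ^ 2) := by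
          gcongr
          nlinarith
      _ = e * (e * (ρ / d) * 4 * ρ) := by ring
      _ ≤ e * (1 / 8 * (1 / 40) * 4 * ρ) := by
          have : ρ / d ≤ 1 / 40 := by rw [div_le_iff₀ hd]; linarith
          gcongr
      _ ≤ _ := by nlinarith [mul_pos he hρ]
  have hor : ⟪r • τ, ν b⟫ = 0 := by rw [inner_smul_left, hτν]; simp
  have Z := fun σ hσ => h.z0 (y0 := y) (c := r • τ) (by linarith) (by rw [hc]; linarith) hor (by linarith) (by nlinarith) (σ := σ) hσ
  have z1 := Z 1 (by simp)
  have z2 := Z (-1) (by simp)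
  rw [← hn'] at z1 z2
  have z3 : N * (16 * κ * (‖y - b‖ ^ 2 + ‖r • τ‖ ^ 2) + EZ n k1 * e * ⟪y - b, ν b⟫) ≤
      (1 + 2 * EZ n k1) * e * ρ * N := by
    have : EZ n k1 * e * ⟪y - b, ν b⟫ ≤ EZ n k1 * e * (2 * ρ) := by gcongr; linarith
    calc _ ≤ N * (e * ρ + EZ n k1 * e * (2 * ρ)) := by
          refine mul_le_mul_of_nonneg_left ?_ hN.le
          nlinarith [mul_pos he hρ]
      _ = _ := by ring
  rw [abs_le]
  constructor <;> linarith

def E7 (n nW k1 : ℝ) : ℝ := E6 n nW k1 + 1280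

set_option maxHeartbeats 1600000 in
theorem Near.h3c (h : Near p β M C1 κ rg Ω δ ν a v g b d N e k1) {τ : V} (hτ : ‖τ‖ = 1)
    (hτν : ⟪τ, ν b⟫ = 0) {ρ : ℝ} (hρ : 0 < ρ) (hρd : 40 * ρ ≤ d) {c0 : V} {P q : ℝ} (hq : |q| ≤ P)
    (h1 : c0 + P • τ ∈ closedBall (b + ρ • ν b) (ρ / 2)) (h2 : c0 + (-P) • τ ∈ closedBall (b + ρ • ν b) (ρ / 2)) :
    |(v (c0 + P • τ) + v (c0 + (-P) • τ)) - (v (c0 + q • τ) + v (c0 + (-q) • τ))| ≤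
      E7 (Module.finrank ℝ V) (Module.finrank ℝ (WithLp 2 (V × ℝ))) k1 * (e * N / d) * ρ ^ 2 := by
  have G := h.S.geo
  have hκ := G.hκ
  have hd := h.hd
  have he := h.he
  have he1 := h.he1
  have hN := h.hN
  have hk1 := h.hk1
  set n : ℝ := (Module.finrank ℝ V : ℝ) with hn'
  have hn : 0 ≤ n := by positivity
  set nW : ℝ := (Module.finrank ℝ (WithLp 2 (V × ℝ)) : ℝ) with hnW'
  have hnW : 0 ≤ nW := by positivity
  set R := e * N / d with hR
  have hRp : 0 < R := by positivity
  have hE4 : 0 ≤ E4 n k1 := by unfold E4 E3 EZ; positivity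
  have hE6 : 0 ≤ E6 n nW k1 := by unfold E6; positivity
  obtain ⟨b1, b2, b3⟩ := ball_facts (G.nrm b h.hb) hρ h1
  obtain ⟨-, -, b3'⟩ := ball_facts (G.nrm b h.hb) hρ h2
  have hP0 : 0 ≤ P := (abs_nonneg _).trans hq
  have hPr : P ≤ ρ / 2 := by
    have := ball_diff (r := 2 * P) hτ h2 (by convert h1 using 1; module)
    rw [abs_of_nonneg (by linarith)] at this
    linarith
  have hcb : ‖c0 - b‖ ≤ 3 / 2 * ρ := by
    have : c0 - b = (1 / 2 : ℝ) • ((c0 + P • τ - b) + (c0 + (-P) • τ - b)) := by module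
    rw [this, norm_smul]
    have := norm_add_le (c0 + P • τ - b) (c0 + (-P) • τ - b)
    simp only [Real.norm_eq_abs]
    rw [abs_of_pos (by norm_num)]
    linarith
  set m := ⟪c0 - b, τ⟫ with hm
  have hmm : |m| ≤ 3 / 2 * ρ := by
    have := abs_real_inner_le_norm (c0 - b) τ
    rw [hτ, mul_one] at this
    linarith
  have hPm : ⟪c0 + P • τ - b, τ⟫ - m = P := by
    rw [show c0 + P • τ - b = (c0 - b) + P • τ by abel, inner_add_left, inner_smul_left, real_inner_self_eq_norm_sq, hτ]
    simp [hm]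
  have hQ : ‖c0 + P • τ - b‖ ^ 2 + q ^ 2 + m ^ 2 ≤ 5 * ρ ^ 2 := by
    have e1 : ‖c0 + P • τ - b‖ ^ 2 ≤ (3 / 2 * ρ) ^ 2 := by gcongr
    have e2 : m ^ 2 ≤ (3 / 2 * ρ) ^ 2 := by rw [← sq_abs m]; gcongr
    have e3 : q ^ 2 ≤ (ρ / 2) ^ 2 := by rw [← sq_abs q]; gcongr; linarith
    nlinarith
  have hw : 32 * (e / d) * (‖c0 + P • τ - b‖ ^ 2 + q ^ 2 + m ^ 2) ≤ ⟪c0 + P • τ - b, ν b⟫ := by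
    calc _ ≤ 32 * (e / d) * (5 * ρ ^ 2) := by gcongr
      _ = 160 * e * (ρ / d) * ρ := by ring
      _ ≤ 160 * (1 / 8) * (1 / 40) * ρ := by
          have : ρ / d ≤ 1 / 40 := by rw [div_le_iff₀ hd]; linarith
          gcongr
      _ ≤ _ := by linarith
  have Z := fun σ hσ => h.F hτ hτν (y := c0 + P • τ) (q := q) (m := m) (by rw [hPm]; exact hq) hw (by nlinarith) (σ := σ) hσ
  have e1 : c0 + P • τ + (-2 * P) • τ = c0 + (-P) • τ := by module
  have e2 : c0 + P • τ + (q - P) • τ = c0 + q • τ := by module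
  have e3 : c0 + P • τ + (-q - P) • τ = c0 + (-q) • τ := by module
  simp only [hPm, e1, e2, e3] at Z
  have z1 := Z 1 (by simp)
  have z2 := Z (-1) (by simp)
  have z3 : ((P ^ 2 - q ^ 2) * ⟪c0 + P • τ - b, ν b⟫) ^ (2 / 3 : ℝ) ≤ ρ ^ 2 := by
    have : ρ ^ 2 = (ρ ^ 3) ^ (2 / 3 : ℝ) := by
      rw [← Real.rpow_natCast ρ 3, ← Real.rpow_mul hρ.le, ← Real.rpow_natCast ρ 2]; norm_num
    rw [this]
    have hq2 : q ^ 2 ≤ P ^ 2 := sq_le_sq.2 (by rwa [abs_of_nonneg hP0])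
    refine Real.rpow_le_rpow (mul_nonneg (by linarith) (by linarith)) ?_ (by norm_num)
    calc _ ≤ (ρ ^ 2 / 4) * (3 / 2 * ρ) := by
          refine mul_le_mul ?_ b2 (by linarith) (by positivity)
          have : P ^ 2 ≤ (ρ / 2) ^ 2 := by gcongr
          nlinarith [sq_nonneg q]
      _ ≤ _ := by nlinarith [pow_pos hρ 3]
  have z4 : E6 n nW k1 * R * ((P ^ 2 - q ^ 2) * ⟪c0 + P • τ - b, ν b⟫) ^ (2 / 3 : ℝ) + 256 * R * (‖c0 + P • τ - b‖ ^ 2 + q ^ 2 + m ^ 2)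
      ≤ E7 n nW k1 * R * ρ ^ 2 := by
    calc _ ≤ E6 n nW k1 * R * ρ ^ 2 + 256 * R * (5 * ρ ^ 2) :=
          add_le_add (mul_le_mul_of_nonneg_left z3 (by positivity)) (mul_le_mul_of_nonneg_left hQ (by positivity))
      _ = _ := by unfold E7; ring
  rw [abs_le]
  constructor <;> linarith
theorem Near.h3 (h : Near p β M C1 κ rg Ω δ ν a v g b d N e k1) {τ : V} (hτ : ‖τ‖ = 1)
    (hτν : ⟪τ, ν b⟫ = 0) {ρ : ℝ} (hρ : 0 < ρ) (hρd : 40 * ρ ≤ d) {y : V} {r1 r2 : ℝ}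
    (h0 : y ∈ closedBall (b + ρ • ν b) (ρ / 2)) (h1 : y + r1 • τ ∈ closedBall (b + ρ • ν b) (ρ / 2))
    (h2 : y + r2 • τ ∈ closedBall (b + ρ • ν b) (ρ / 2)) (h3 : y + (r1 + r2) • τ ∈ closedBall (b + ρ • ν b) (ρ / 2)) :
    |v (y + (r1 + r2) • τ) - v (y + r1 • τ) - v (y + r2 • τ) + v y| ≤
      E7 (Module.finrank ℝ V) (Module.finrank ℝ (WithLp 2 (V × ℝ))) k1 * (e * N / d) * ρ ^ 2 := by
  set E := E7 (Module.finrank ℝ V) (Module.finrank ℝ (WithLp 2 (V × ℝ))) k1 * (e * N / d) * ρ ^ 2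
  set c0 := y + ((r1 + r2) / 2) • τ with hc0
  have q0 : y = c0 + (-((r1 + r2) / 2)) • τ := by rw [hc0]; module
  have q1 : y + (r1 + r2) • τ = c0 + ((r1 + r2) / 2) • τ := by rw [hc0]; module
  have q2 : y + r1 • τ = c0 + ((r1 - r2) / 2) • τ := by rw [hc0]; module
  have q3 : y + r2 • τ = c0 + (-((r1 - r2) / 2)) • τ := by rw [hc0]; module
  rw [q1, q2, q3]
  have q0' : v y = v (c0 + (-((r1 + r2) / 2)) • τ) := by rw [← q0]
  rw [q0']
  have key : ∀ A B : ℝ, |B| ≤ |A| → c0 + A • τ ∈ closedBall (b + ρ • ν b) (ρ / 2) →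
      c0 + (-A) • τ ∈ closedBall (b + ρ • ν b) (ρ / 2) →
      |(v (c0 + A • τ) + v (c0 + (-A) • τ)) - (v (c0 + B • τ) + v (c0 + (-B) • τ))| ≤ E := by
    intro A B hAB a1 a2
    rcases le_total 0 A with hA | hA
    · rw [abs_of_nonneg hA] at hAB
      exact h.h3c hτ hτν hρ hρd hAB a1 a2
    · rw [abs_of_nonpos hA] at hAB
      have := h.h3c hτ hτν hρ hρd hAB a2 (by rwa [neg_neg])
      rw [neg_neg, add_comm (v (c0 + -A • τ))] at this
      exact this
  rcases le_total |(r1 - r2) / 2| |(r1 + r2) / 2| with hh | hh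
  · have := key _ _ hh (q1 ▸ h3) (q0 ▸ h0)
    rw [abs_le] at *
    constructor <;> linarith
  · have := key _ _ hh (q2 ▸ h1) (q3 ▸ h2)
    rw [abs_le] at *
    constructor <;> linarith
end LemH


section SolSec
variable {V : Type*} [NormedAddCommGroup V] [InnerProductSpace ℝ V] [FiniteDimensional ℝ V]
  [CompleteSpace V]

structure Sol (p β M C1 κ rg T : ℝ) (Ω : Set V) (δ : V → ℝ) (ν : V → V) (a : V)
    (u : V → ℝ → ℝ) (G : V → ℝ → V) (H : V → ℝ → V →L[ℝ] V) : Prop where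
  hT : 0 < T
  sl : ∀ t ∈ Ico (T / 2) T, Slice p β M C1 κ rg Ω δ ν a (fun y => u y t) (fun y => G y t)
  par : Par u G (fun y t => ‖G y t‖ ^ p) (Ω ×ˢ Ioo 0 T)
  lip : ∀ y ∈ Ω, ∀ s ∈ Ico (T / 2) T, ∀ t ∈ Ico (T / 2) T, |u y t - u y s| ≤ M * |t - s|
  hH : ∀ y ∈ Ω, ∀ t ∈ Ioo 0 T, HasFDerivAt (fun y => G y t) (H y t) y
  pde : ∀ y ∈ Ω, ∀ t ∈ Ico (T / 2) T, |LinearMap.trace ℝ V (H y t : V →ₗ[ℝ] V) + ‖G y t‖ ^ p| ≤ M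
  gbu : ∀ K : ℝ, ∀ η > 0, ∃ x ∈ Ω, ∃ t ∈ Ioo (T - η) T, dist x a < η ∧ K ≤ ‖G x t‖

variable {p β M C1 κ rg T : ℝ} {Ω : Set V} {δ : V → ℝ} {ν : V → V} {a : V}
  {u : V → ℝ → ℝ} {G : V → ℝ → V} {H : V → ℝ → V →L[ℝ] V}

theorem Sol.mid (S : Sol p β M C1 κ rg T Ω δ ν a u G H) :
    Slice p β M C1 κ rg Ω δ ν a (fun y => u y (T/2)) (fun y => G y (T/2)) :=
  S.sl _ ⟨le_rfl, by linarith [S.hT]⟩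

set_option maxHeartbeats 1600000 in
theorem lemY (S : Sol p β M C1 κ rg T Ω δ ν a u G H) {κ0 : ℝ} (hκ0 : 0 < κ0) :
    ∃ d1 > 0, ∀ b ∈ frontier Ω, dist b a < rg / 4 → ∀ t ∈ Ico (T / 2) T, ∀ d, 0 < d → d ≤ d1 →
    (∀ s, 0 < s → s ≤ d → u (b + s • ν b) t ≤ κ0 / 4 * s ^ (1 - β)) →
    ∀ t' ∈ Ico (T / 2) T, |t' - t| ≤ d ^ 2 → ∀ y ∈ Ω, ‖y - b‖ ≤ 6 * d → δ y ≤ d / 2 →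
    u y t' ≤ κ0 * d ^ (1 - β) := by
  have hp := S.mid.hp
  have hβ := S.mid.hβ
  have hM := S.mid.hM
  have hC := S.mid.hC
  have Gm := S.mid.geo
  have hκ := Gm.hκ
  have hrg := Gm.hrg
  obtain ⟨β0, β1, β2⟩ := beta_pos hp hβ
  obtain ⟨ρ0, hρ0, hA⟩ := lemA V (p := p) (β := β) (M := M) (C1 := C1) (κ := κ) (rg := rg)
    hp hβ hM hC hκ hrg (θ := κ0 / 4) (by positivity)
  obtain ⟨l, hl, hl1⟩ := pw_small (c := C1) (q := 1 - β) hC.le (by linarith) hκ0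
  obtain ⟨m, hm, hm1⟩ := pw_small (c := M) (q := 1 + β) hM (by linarith) (ε := κ0 / 4) (by positivity)
  refine ⟨min (min ρ0 m) (min (rg / 16) (min (l / (72 * κ)) (1 / (72 * κ)))), by positivity, ?_⟩
  intro b hb hba t ht d hd hdd hY t' ht' htt y hy hyb hyd
  have d1 : d ≤ ρ0 := hdd.trans ((min_le_left _ _).trans (min_le_left _ _))
  have d2 : d ≤ m := hdd.trans ((min_le_left _ _).trans (min_le_right _ _))
  have d3 : d ≤ rg / 16 := hdd.trans ((min_le_right _ _).trans (min_le_left _ _))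
  have d4 : d ≤ l / (72 * κ) :=
    hdd.trans ((min_le_right _ _).trans ((min_le_right _ _).trans (min_le_left _ _)))
  have d5 : d ≤ 1 / (72 * κ) :=
    hdd.trans ((min_le_right _ _).trans ((min_le_right _ _).trans (min_le_right _ _)))
  rw [le_div_iff₀ (by positivity)] at d4 d5
  have hdb : dist y b ≤ 6 * d := by rw [dist_eq_norm]; exact hyb
  have hya : dist y a < rg := by linarith [dist_triangle y b a]
  have hX : 0 < d ^ (1 - β) := Real.rpow_pos_of_pos hd _
  have hδ0 : 0 < δ y := Gm.dpos hy
  rcases le_or_gt (δ y) (l * d) with h1 | h1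
  · have h2 := (S.sl t' ht').ub y hy hya
    have h3 : δ y ^ (1 - β) ≤ (l * d) ^ (1 - β) := Real.rpow_le_rpow hδ0.le h1 (by linarith)
    rw [Real.mul_rpow hl.le hd.le] at h3
    have h4 := hl1 l hl.le le_rfl
    calc u y t' ≤ |u y t'| := le_abs_self _
      _ ≤ C1 * δ y ^ (1 - β) := h2
      _ ≤ C1 * (l ^ (1 - β) * d ^ (1 - β)) := mul_le_mul_of_nonneg_left h3 hC.le
      _ = C1 * l ^ (1 - β) * d ^ (1 - β) := by ring
      _ ≤ κ0 * d ^ (1 - β) := mul_le_mul_of_nonneg_right h4.le hX.le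
  · set s := ⟪y - b, ν b⟫ with hs
    have e1 := Gm.ext b hb (by linarith) y hy (by linarith)
    have e2 := Gm.dlow b hb y
    have e3 : κ * ‖y - b‖ ^ 2 ≤ 36 * κ * d * d := by
      have : ‖y - b‖ ^ 2 ≤ (6 * d) ^ 2 := pow_le_pow_left₀ (norm_nonneg _) hyb 2
      nlinarith
    have e4 : 36 * κ * d * d ≤ l * d / 2 := by nlinarith
    have e5 : 36 * κ * d * d ≤ d / 2 := by nlinarith
    have hs0 : 0 < s := by have := mul_pos hl hd; linarith
    have hs1 : s ≤ d := by linarith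
    have hν := Gm.nrm b hb
    have hr := Gm.ray b hb s hs0 (by linarith)
    have hb' : b + s • ν b - b = s • ν b := by abel
    have hn1 : ‖s • ν b‖ = s := by rw [norm_smul, hν, mul_one, Real.norm_eq_abs, abs_of_pos hs0]
    have h5 := hA Ω δ ν a _ _ (S.sl t ht) b hb (by linarith) d hd d1 (b + s • ν b) (y - b - s • ν b)
      (by rw [hb', hn1]; linarith)
      (by rw [inner_sub_left, inner_smul_left, real_inner_self_eq_norm_sq, hν]; simp [hs])
      (by have := norm_sub_le (y - b) (s • ν b); rw [hn1] at this; linarith) hr.1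
      (by convert hy using 1; abel)
    have e6 : b + s • ν b + (y - b - s • ν b) = y := by abel
    simp only [e6] at h5
    have h6 := S.lip y hy t ht t' ht'
    have h7 : M * |t' - t| ≤ κ0 / 4 * d ^ (1 - β) := by
      calc M * |t' - t| ≤ M * d ^ 2 := mul_le_mul_of_nonneg_left htt hM
        _ = M * d ^ (1 + β) * d ^ (1 - β) := by rw [pw_sq hd (β := β)]; ring
        _ ≤ _ := mul_le_mul_of_nonneg_right (hm1 d hd.le d2).le hX.le
    have h8 := hY s hs0 hs1
    have h9 : s ^ (1 - β) ≤ d ^ (1 - β) := Real.rpow_le_rpow hs0.le hs1 (by linarith)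
    have h10 : κ0 / 4 * s ^ (1 - β) ≤ κ0 / 4 * d ^ (1 - β) :=
      mul_le_mul_of_nonneg_left h9 (by positivity)
    have h11 := (abs_le.mp h5).2
    have h12 := (abs_le.mp h6).2
    nlinarith [mul_pos hκ0 hX]

theorem lemYC (S : Sol p β M C1 κ rg T Ω δ ν a u G H) :
    ∃ κ0 > 0, ∃ CG > 0, ∃ d2 > 0, ∀ b ∈ frontier Ω, dist b a < rg / 4 → ∀ t ∈ Ico (T / 2) T,
    ∀ d, 0 < d → d ≤ d2 → (∀ s, 0 < s → s ≤ d → u (b + s • ν b) t ≤ κ0 * s ^ (1 - β)) →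
    ∀ t' ∈ Ico (T / 2) T, |t' - t| ≤ d ^ 2 → ∀ y ∈ Ω, ‖y - b‖ ≤ 3 * d →
    |u y t'| ≤ CG * d ^ (-β) * δ y ∧ ‖G y t'‖ ≤ CG * d ^ (-β) := by
  have hp := S.mid.hp
  have hβ := S.mid.hβ
  have Gm := S.mid.geo
  obtain ⟨κ0, hκ0, CG, hCG, d0, hd0, hCC⟩ := lemC V (p := p) (β := β) (M := M) (C1 := C1) (κ := κ)
    (rg := rg) hp hβ S.mid.hM S.mid.hC Gm.hκ Gm.hrg
  obtain ⟨d1, hd1, hYY⟩ := lemY S hκ0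
  refine ⟨κ0 / 4, by positivity, CG, hCG, min d0 d1, by positivity, ?_⟩
  intro b hb hba t ht d hd hdd hY t' ht' htt
  exact hCC Ω δ ν a _ _ (S.sl t' ht') b hb hba d hd (hdd.trans (min_le_left _ _))
    (hYY b hb hba t ht d hd (hdd.trans (min_le_right _ _)) hY t' ht' htt)

/-- derivative of the solution along the normal ray -/
theorem Slice.rayd {v : V → ℝ} {g : V → V} (S : Slice p β M C1 κ rg Ω δ ν a v g) {b : V}
    (hb : b ∈ frontier Ω) {s : ℝ} (hs : 0 < s) (hsr : s < rg) :
    HasDerivAt (fun s : ℝ => v (b + s • ν b)) ⟪g (b + s • ν b), ν b⟫ s := by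
  obtain ⟨l, ⟨G, A, h1, h2, h3, h4⟩, -⟩ := S.jet _ (S.geo.ray b hb s hs hsr).1
  have h5 := h1.self_of_nhds
  rw [h2] at h5
  have h6 : HasDerivAt (fun s : ℝ => b + s • ν b) (ν b) s := by
    simpa using ((hasDerivAt_id s).smul_const (ν b)).const_add b
  have := h5.hasFDerivAt.comp_hasDerivAt s h6
  exact this.congr_deriv (by simp)

theorem Slice.rayc {v : V → ℝ} {g : V → V} (S : Slice p β M C1 κ rg Ω δ ν a v g) {b : V}
    (hb : b ∈ frontier Ω) {s : ℝ} (hsr : s < rg) :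
    ContinuousOn (fun s : ℝ => v (b + s • ν b)) (Icc 0 s) := by
  refine S.cont.comp (by fun_prop) ?_
  intro r hr
  rcases eq_or_lt_of_le hr.1 with h | h
  · rw [← h]; simpa using hb.1
  · exact subset_closure (S.geo.ray b hb r h (by linarith [hr.2])).1

theorem Slice.raymvt {v : V → ℝ} {g : V → V} (S : Slice p β M C1 κ rg Ω δ ν a v g) {b : V}
    (hb : b ∈ frontier Ω) {s : ℝ} (hs : 0 < s) (hsr : s < rg) :
    ∃ r, 0 < r ∧ r < s ∧ v (b + s • ν b) = s * ⟪g (b + r • ν b), ν b⟫ := by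
  obtain ⟨r, hr, h⟩ := exists_hasDerivAt_eq_slope (fun s : ℝ => v (b + s • ν b))
    (fun s => ⟪g (b + s • ν b), ν b⟫) hs (S.rayc hb hsr)
    (fun r hr => S.rayd hb hr.1 (hr.2.trans hsr))
  refine ⟨r, hr.1, hr.2, ?_⟩
  have h0 : v (b + (0:ℝ) • ν b) = 0 := by rw [zero_smul, add_zero]; exact S.bd b hb
  rw [h, h0, sub_zero, sub_zero, mul_div_cancel₀ _ hs.ne']

theorem firstcross {f : ℝ → ℝ} {e s0 : ℝ} (he : 0 < e) (hes : e ≤ s0) (hf : ContinuousOn f (Icc 0 s0))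
    (h1 : ∀ s, 0 < s → s ≤ e → f s ≤ 0) (h2 : 0 ≤ f s0) :
    ∃ d, 0 < d ∧ d ≤ s0 ∧ f d = 0 ∧ ∀ s, 0 < s → s ≤ d → f s ≤ 0 := by
  set A := Icc e s0 ∩ f ⁻¹' {0} with hA
  have hfc : ContinuousOn f (Icc e s0) := hf.mono (Icc_subset_Icc_left he.le)
  have Ac : IsCompact A := by
    refine isCompact_Icc.of_isClosed_subset ?_ inter_subset_left
    exact hfc.preimage_isClosed_of_isClosed isClosed_Icc isClosed_singleton
  have An : A.Nonempty := by
    obtain ⟨c, hc, hc0⟩ := intermediate_value_Icc hes hfc ⟨h1 e he le_rfl, h2⟩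
    exact ⟨c, hc, hc0⟩
  obtain ⟨d, hd, hdl⟩ := Ac.exists_isLeast An
  refine ⟨d, he.trans_le hd.1.1, hd.1.2, hd.2, ?_⟩
  intro s hs hsd
  by_contra hc
  push Not at hc
  have hse : e < s := by
    by_contra h
    exact absurd (h1 s hs (not_lt.mp h)) (not_le.mpr hc)
  have hsd' : s < d := lt_of_le_of_ne hsd (by rintro rfl; rw [hd.2] at hc; exact lt_irrefl _ hc)
  obtain ⟨c, hc1, hc0⟩ := intermediate_value_Icc hse.le
    (hfc.mono (Icc_subset_Icc_right (hsd.trans hd.1.2))) ⟨h1 e he le_rfl, hc.le⟩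
  have := hdl ⟨⟨hc1.1, hc1.2.trans (hsd.trans hd.1.2)⟩, hc0⟩
  linarith [hc1.2]

set_option maxHeartbeats 1600000 in
theorem lemB (S : Sol p β M C1 κ rg T Ω δ ν a u G H) {κ0 CG d2 : ℝ} (hκ0 : 0 < κ0) (hd2 : 0 < d2)
    (hYC : ∀ b ∈ frontier Ω, dist b a < rg / 4 → ∀ t ∈ Ico (T / 2) T,
    ∀ d, 0 < d → d ≤ d2 → (∀ s, 0 < s → s ≤ d → u (b + s • ν b) t ≤ κ0 * s ^ (1 - β)) →
    ∀ t' ∈ Ico (T / 2) T, |t' - t| ≤ d ^ 2 → ∀ y ∈ Ω, ‖y - b‖ ≤ 3 * d →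
    |u y t'| ≤ CG * d ^ (-β) * δ y ∧ ‖G y t'‖ ≤ CG * d ^ (-β)) {dmax : ℝ} (hdm : 0 < dmax) :
    ∃ η > 0, ∀ b ∈ frontier Ω, dist b a < η → ∀ t ∈ Ioo (T - η) T, ∃ d, 0 < d ∧ d ≤ dmax ∧
      u (b + d • ν b) t = κ0 * d ^ (1 - β) ∧
      ∀ s, 0 < s → s ≤ d → u (b + s • ν b) t ≤ κ0 * s ^ (1 - β) := by
  have hp := S.mid.hp
  have hβ := S.mid.hβ
  have Gm := S.mid.geo
  have hrg := Gm.hrg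
  have hT := S.hT
  obtain ⟨β0, β1, β2⟩ := beta_pos hp hβ
  set dm := min (min dmax d2) (rg / 2) with hdmd
  have hdm0 : 0 < dm := by positivity
  have m1 : dm ≤ dmax := (min_le_left _ _).trans (min_le_left _ _)
  have m2 : dm ≤ d2 := (min_le_left _ _).trans (min_le_right _ _)
  have m3 : dm ≤ rg / 2 := min_le_right _ _
  set η := min (min (rg / 4) dm) (min (dm ^ 2) (T / 2)) with hη
  have hη0 : 0 < η := by positivity
  have n1 : η ≤ rg / 4 := (min_le_left _ _).trans (min_le_left _ _)
  have n2 : η ≤ dm := (min_le_left _ _).trans (min_le_right _ _)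
  have n3 : η ≤ dm ^ 2 := (min_le_right _ _).trans (min_le_left _ _)
  have n4 : η ≤ T / 2 := (min_le_right _ _).trans (min_le_right _ _)
  refine ⟨η, hη0, fun b hb hba t ht => ?_⟩
  have ht' : t ∈ Ico (T / 2) T := ⟨by linarith [ht.1], ht.2⟩
  have St := S.sl t ht'
  have key : ∃ s, 0 < s ∧ s ≤ dm ∧ κ0 * s ^ (1 - β) < u (b + s • ν b) t := by
    by_contra hc
    push Not at hc
    obtain ⟨x, hx, t1, ht1, hxa, hK⟩ := S.gbu (CG * dm ^ (-β) + 1) η hη0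
    have := (hYC b hb (by linarith) t ht' dm hdm0 m2 hc t1 ⟨by linarith [ht1.1], ht1.2⟩
      (by rw [abs_le]; constructor <;> linarith [ht.1, ht.2, ht1.1, ht1.2]) x hx
      (by rw [← dist_eq_norm]; linarith [dist_triangle_right x b a])).2
    linarith
  obtain ⟨s0, hs0, hs1, hs2⟩ := key
  obtain ⟨C, hC⟩ := St.fin
  obtain ⟨m, hm, hm1⟩ := pw_small (c := |C|) (q := β) (abs_nonneg C) β0 hκ0
  obtain ⟨d, hd0, hd1, hd3, hd4⟩ := firstcross (f := fun s => u (b + s • ν b) t - κ0 * s ^ (1 - β))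
    (e := min m s0) (s0 := s0) (by positivity) (min_le_right _ _)
    ((St.rayc hb (by linarith)).sub (continuousOn_const.mul
      ((Real.continuous_rpow_const (by linarith : 0 ≤ 1 - β)).continuousOn)))
    (by
      intro s h1 h2
      have hsm : s ≤ m := h2.trans (min_le_left _ _)
      have hss : s ≤ s0 := h2.trans (min_le_right _ _)
      obtain ⟨r, r0, r1, hr⟩ := St.raymvt hb h1 (by linarith)
      have hr2 := hC _ (Gm.ray b hb r r0 (by linarith)).1
      have hr3 := real_inner_le_norm (G (b + r • ν b) t) (ν b)
      rw [Gm.nrm b hb, mul_one] at hr3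
      have hr4 := hm1 s h1.le hsm
      have hX : 0 < s ^ (1 - β) := Real.rpow_pos_of_pos h1 _
      have es : s = s ^ β * s ^ (1 - β) := by
        rw [← Real.rpow_add h1]; simp
      have : u (b + s • ν b) t ≤ κ0 * s ^ (1 - β) := by
        rw [hr]
        calc s * ⟪G (b + r • ν b) t, ν b⟫ ≤ s * |C| :=
              mul_le_mul_of_nonneg_left (hr3.trans (hr2.trans (le_abs_self C))) h1.le
          _ = |C| * s ^ β * s ^ (1 - β) := by
              nth_rewrite 1 [es]; ring
          _ ≤ _ := mul_le_mul_of_nonneg_right hr4.le hX.le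
      linarith)
    (by linarith)
  refine ⟨d, hd0, by linarith, by linarith, fun s h1 h2 => by linarith [hd4 s h1 h2]⟩

set_option maxHeartbeats 1600000 in
theorem lemNear (S : Sol p β M C1 κ rg T Ω δ ν a u G H) {κ0 CG d2 e : ℝ} (hκ0 : 0 < κ0) (hCG : 0 < CG)
    (hd2 : 0 < d2) (he : 0 < e) (he1 : e ≤ 1 / 8)
    (hYC : ∀ b ∈ frontier Ω, dist b a < rg / 4 → ∀ t ∈ Ico (T / 2) T,
    ∀ d, 0 < d → d ≤ d2 → (∀ s, 0 < s → s ≤ d → u (b + s • ν b) t ≤ κ0 * s ^ (1 - β)) →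
    ∀ t' ∈ Ico (T / 2) T, |t' - t| ≤ d ^ 2 → ∀ y ∈ Ω, ‖y - b‖ ≤ 3 * d →
    |u y t'| ≤ CG * d ^ (-β) * δ y ∧ ‖G y t'‖ ≤ CG * d ^ (-β)) :
    ∃ d3 > 0, ∀ b ∈ frontier Ω, dist b a < rg / 4 → ∀ t ∈ Ico (T / 2) T,
    ∀ d, 0 < d → d ≤ d3 → (∀ s, 0 < s → s ≤ d → u (b + s • ν b) t ≤ κ0 * s ^ (1 - β)) →
    ∀ t' ∈ Ico (T / 2) T, |t' - t| ≤ d ^ 2 →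
    Near p β M C1 κ rg Ω δ ν a (fun y => u y t') (fun y => G y t') b d (CG * d ^ (-β)) e
      (p * CG ^ (p - 1)) := by
  have hp := S.mid.hp
  have hβ := S.mid.hβ
  have hM := S.mid.hM
  have Gm := S.mid.geo
  have hrg := Gm.hrg
  have hκ := Gm.hκ
  obtain ⟨β0, β1, β2⟩ := beta_pos hp hβ
  obtain ⟨ρ0, hρ0, hA⟩ := lemA V (p := p) (β := β) (M := M) (C1 := C1) (κ := κ) (rg := rg)
    hp hβ hM S.mid.hC hκ hrg (θ := e * CG) (by positivity)
  obtain ⟨m, hm, hm1⟩ := pw_small (c := M) (q := 1 + β) hM (by linarith) (ε := e * CG) (by positivity)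
  refine ⟨min (min (min ρ0 m) d2) (min (rg / 64) (e ^ 2 / (4 * κ))), by positivity, ?_⟩
  intro b hb hba t ht d hd hdd hY t' ht' htt
  have q1 : d ≤ ρ0 := hdd.trans ((min_le_left _ _).trans ((min_le_left _ _).trans (min_le_left _ _)))
  have q2 : d ≤ m := hdd.trans ((min_le_left _ _).trans ((min_le_left _ _).trans (min_le_right _ _)))
  have q3 : d ≤ d2 := hdd.trans ((min_le_left _ _).trans (min_le_right _ _))
  have q4 : d ≤ rg / 64 := hdd.trans ((min_le_right _ _).trans (min_le_left _ _))
  have q5 : d ≤ e ^ 2 / (4 * κ) := hdd.trans ((min_le_right _ _).trans (min_le_right _ _))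
  rw [le_div_iff₀ (by positivity)] at q5
  have hX : 0 < d ^ (-β) := Real.rpow_pos_of_pos hd _
  exact
    { S := S.sl t' ht'
      hb := hb
      hba := hba
      hd := hd
      hdr := by linarith
      hN := by positivity
      he := he
      he1 := he1
      hk1 := by have := Real.rpow_pos_of_pos hCG (p-1); nlinarith
      hk := by
        rw [pw2 hp hβ hCG.le hd]
        exact le_of_eq (by ring)
      bnd := hYC b hb hba t ht d hd q3 hY t' ht' htt
      tan := by
        intro y c hy hyc hyb hc hcn
        have := hA Ω δ ν a _ _ (S.sl t' ht') b hb (by linarith) d hd q1 y c (by linarith) hcn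
          (by linarith) hy hyc
        refine this.trans (le_of_eq ?_)
        rw [pw1 hd]
        field_simp
      kd := by linarith
      Md := by
        have := hm1 d hd.le q2
        have e1 : d = d ^ (1 + β) * d ^ (-β) := by
          rw [← Real.rpow_add hd]; simp
        calc M * d = M * d ^ (1 + β) * d ^ (-β) := by nth_rewrite 1 [e1]; ring
          _ ≤ e * CG * d ^ (-β) := mul_le_mul_of_nonneg_right this.le hX.le
          _ = _ := by ring }

end SolSec


section E1Sec
variable {V : Type*} [NormedAddCommGroup V] [InnerProductSpace ℝ V] [FiniteDimensional ℝ V]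
  [CompleteSpace V]

theorem trace_normal {A : V →L[ℝ] V} {n : V} (hn : ‖n‖ = 1) {B : ℝ} (hB : 0 ≤ B)
    (h : ∀ τ : V, ‖τ‖ = 1 → ⟪τ, n⟫ = 0 → |⟪A τ, τ⟫| ≤ B) :
    |LinearMap.trace ℝ V (A : V →ₗ[ℝ] V) - ⟪A n, n⟫| ≤ Module.finrank ℝ V * B := by
  classical
  have ho : Orthonormal ℝ ((↑) : ({n} : Set V) → V) := by
    constructor
    · rintro ⟨x, hx⟩
      rw [mem_singleton_iff] at hx
      simp [hx, hn]
    · rintro ⟨x, hx⟩ ⟨y, hy⟩ hxy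
      rw [mem_singleton_iff] at hx hy
      exact absurd (Subtype.ext (hx.trans hy.symm)) hxy
  obtain ⟨w, b, hw, hb⟩ := ho.exists_orthonormalBasis_extension
  have hnw : n ∈ w := hw (mem_singleton n)
  rw [LinearMap.trace_eq_sum_inner _ b]
  have hcard : Fintype.card w = Module.finrank ℝ V := (Module.finrank_eq_card_basis b.toBasis).symm
  have e0 : b ⟨n, hnw⟩ = n := by rw [hb]
  rw [← Finset.add_sum_erase _ _ (Finset.mem_univ (⟨n, hnw⟩ : w))]
  have e1 : ⟪b ⟨n, hnw⟩, (A : V →ₗ[ℝ] V) (b ⟨n, hnw⟩)⟫ = ⟪A n, n⟫ := by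
    rw [e0, real_inner_comm]; rfl
  rw [e1, add_sub_cancel_left]
  refine (Finset.abs_sum_le_sum_abs _ _).trans ?_
  have : ∀ i ∈ Finset.univ.erase (⟨n, hnw⟩ : w), |⟪b i, (A : V →ₗ[ℝ] V) (b i)⟫| ≤ B := by
    intro i hi
    rw [real_inner_comm]
    refine h (b i) (b.orthonormal.1 i) ?_
    have := b.orthonormal.2 (Finset.ne_of_mem_erase hi)
    simp only at this
    rwa [e0] at this
  refine (Finset.sum_le_card_nsmul _ _ _ this).trans ?_
  rw [nsmul_eq_mul]
  refine mul_le_mul_of_nonneg_right ?_ hB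
  rw [← hcard]
  exact_mod_cast (Finset.card_le_univ _)

theorem norm_normal {g n : V} (hn : ‖n‖ = 1) {B : ℝ} (hB : 0 ≤ B)
    (h : ∀ τ : V, ‖τ‖ = 1 → ⟪τ, n⟫ = 0 → |⟪g, τ⟫| ≤ B) : |‖g‖ - (|⟪g, n⟫|)| ≤ B := by
  set c := g - ⟪g, n⟫ • n with hc
  have hcn : ⟪c, n⟫ = 0 := by
    rw [hc, inner_sub_left, inner_smul_left, real_inner_self_eq_norm_sq, hn]; simp
  have hcB : ‖c‖ ≤ B := by
    rcases eq_or_ne c 0 with h0 | h0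
    · rw [h0, norm_zero]; exact hB
    · have hp : 0 < ‖c‖ := norm_pos_iff.mpr h0
      have := h (‖c‖⁻¹ • c) (by rw [norm_smul, norm_inv, norm_norm]; field_simp)
        (by rw [inner_smul_left, hcn, mul_zero])
      rw [inner_smul_right] at this
      have e : ⟪g, c⟫ = ‖c‖ ^ 2 := by
        have : g = c + ⟪g, n⟫ • n := by rw [hc]; abel
        nth_rewrite 1 [this]
        rw [inner_add_left, inner_smul_left, real_inner_comm c n, hcn, real_inner_self_eq_norm_sq]
        simp
      rw [e, sq, ← mul_assoc, inv_mul_cancel₀ hp.ne', one_mul, abs_of_pos hp] at this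
      exact this
  have e2 : ‖⟪g, n⟫ • n‖ = |⟪g, n⟫| := by rw [norm_smul, hn, mul_one, Real.norm_eq_abs]
  rw [← e2]
  exact (abs_norm_sub_norm_le _ _).trans hcB

theorem core_normal {A : V →L[ℝ] V} {g n : V} (hn : ‖n‖ = 1) {M N η p : ℝ} (hp : 1 ≤ p) (hN : 0 < N)
    (hη : 0 ≤ η) (hg : ‖g‖ ≤ N) (hM : |LinearMap.trace ℝ V (A : V →ₗ[ℝ] V) + ‖g‖ ^ p| ≤ M)
    (h : ∀ τ : V, ‖τ‖ = 1 → ⟪τ, n⟫ = 0 → |⟪g, τ⟫| ≤ η * N ∧ |⟪A τ, τ⟫| ≤ η * N ^ p) :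
    |⟪A n, n⟫ + |⟪g, n⟫| ^ p| ≤ M + (Module.finrank ℝ V + p) * η * N ^ p := by
  have hNp : 0 < N ^ p := Real.rpow_pos_of_pos hN _
  have h1 := trace_normal hn (B := η * N ^ p) (by positivity) (fun τ a b => (h τ a b).2)
  have h2 := norm_normal hn (B := η * N) (by positivity) (fun τ a b => (h τ a b).1)
  have h3 : |⟪g, n⟫| ≤ N := by
    have := abs_real_inner_le_norm g n
    rw [hn, mul_one] at this
    exact this.trans hg
  have h4 := rpow_lip hp (norm_nonneg g) (abs_nonneg ⟪g, n⟫) hg h3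
  have h5 : p * N ^ (p - 1) * |‖g‖ - (|⟪g, n⟫|)| ≤ p * η * N ^ p := by
    calc _ ≤ p * N ^ (p - 1) * (η * N) := by
          refine mul_le_mul_of_nonneg_left h2 ?_
          have := Real.rpow_nonneg hN.le (p - 1)
          positivity
      _ = p * η * (N ^ (p - 1) * N) := by ring
      _ = p * η * N ^ p := by rw [← Real.rpow_add_one hN.ne', sub_add_cancel]
  have h6 := h4.trans h5
  rw [abs_le] at *
  constructor <;> nlinarith

variable {p β M C1 κ rg T : ℝ} {Ω : Set V} {δ : V → ℝ} {ν : V → V} {a : V}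
  {u : V → ℝ → ℝ} {G : V → ℝ → V} {H : V → ℝ → V →L[ℝ] V}

/-- geometry of the small ball -/
theorem Geo.ballpt (h : Geo Ω δ ν a κ rg) {b y : V} (hb : b ∈ frontier Ω) (hba : dist b a < rg / 4)
    {s : ℝ} (hs : 0 < s) (hs1 : 9 * κ * s ≤ 1) (hs2 : 8 * s ≤ rg)
    (hy : y ∈ closedBall (b + s • ν b) (s / 2)) :
    y ∈ Ω ∧ s / 4 ≤ δ y ∧ dist y a < rg ∧ ‖y - b‖ ≤ 3 / 2 * s := by
  obtain ⟨f1, f2, f3⟩ := ball_facts (h.nrm b hb) hs hy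
  have hκ := h.hκ
  have hrg := h.hrg
  have e : κ * ‖y - b‖ ^ 2 ≤ s / 4 := by
    have : ‖y - b‖ ^ 2 ≤ (3 / 2 * s) ^ 2 := pow_le_pow_left₀ (norm_nonneg _) f3 2
    nlinarith
  obtain ⟨g1, g2, -, g4⟩ := h.pt (y := y) hb (by linarith) (by linarith) (by linarith) (by linarith)
  exact ⟨g1, by linarith, g4, f3⟩

theorem Sol.parball (S : Sol p β M C1 κ rg T Ω δ ν a u G H) {b : V} (hb : b ∈ frontier Ω)
    (hba : dist b a < rg / 4) {s t : ℝ} (hs : 0 < s) (hs1 : 9 * κ * s ≤ 1) (hs2 : 8 * s ≤ rg)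
    (ht : T / 2 ≤ t - s ^ 2 / 4) (htT : t < T) :
    Par u G (fun y t => ‖G y t‖ ^ p) (closedBall (b + s • ν b) (s / 2) ×ˢ Icc (t - s ^ 2 / 4) t) := by
  refine S.par.mono (prod_mono ?_ ?_)
  · intro y hy
    exact (S.mid.geo.ballpt hb hba hs hs1 hs2 hy).1
  · intro r hr
    exact ⟨by linarith [hr.1, S.hT], by linarith [hr.2]⟩

set_option maxHeartbeats 1600000 in
theorem regI (S : Sol p β M C1 κ rg T Ω δ ν a u G H) {k0 η1 : ℝ} (hk0 : 4 * C1 ^ (p - 1) ≤ k0)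
    (hη : 0 < η1) : ∃ s0 > 0, ∀ b ∈ frontier Ω, dist b a < rg / 4 → ∀ t, t < T → ∀ s, 0 < s → s ≤ s0 →
    T / 2 ≤ t - s ^ 2 / 4 → ‖G (b + s • ν b) t‖ ≤ C1 * (s / 4) ^ (-β) ∧
    ∀ τ : V, ‖τ‖ = 1 → ⟪τ, ν b⟫ = 0 →
    |⟪G (b + s • ν b) t, τ⟫| ≤ η1 * (C1 * (s / 4) ^ (-β)) ∧
    |⟪H (b + s • ν b) t τ, τ⟫| ≤ η1 * (C1 * (s / 4) ^ (-β)) ^ p := by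
  have hp := S.mid.hp
  have hβ := S.mid.hβ
  have hM := S.mid.hM
  have hC := S.mid.hC
  have Gm := S.mid.geo
  have hrg := Gm.hrg
  have hκ := Gm.hκ
  have hT := S.hT
  obtain ⟨β0, β1, β2⟩ := beta_pos hp hβ
  have hCp1 : 0 < C1 ^ (p - 1) := Real.rpow_pos_of_pos hC _
  have hCp : 0 < C1 ^ p := Real.rpow_pos_of_pos hC _
  obtain ⟨ε1, hε1, hS⟩ := lemS V (p := p) (k0 := k0) (by linarith) (by linarith) hη
  obtain ⟨ρ0, hρ0, hA⟩ := lemA V (p := p) (β := β) (M := M) (C1 := C1) (κ := κ) (rg := rg)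
    hp hβ hM hC hκ hrg (θ := min (ε1 * C1) (ε1 * C1 ^ p / 2)) (by positivity)
  refine ⟨min ρ0 (min (1 / (9 * κ)) (rg / 8)), by positivity, ?_⟩
  intro b hb hba t htT s hs hss ht
  have q1 : s ≤ ρ0 := hss.trans (min_le_left _ _)
  have q2 : s ≤ 1 / (9 * κ) := hss.trans ((min_le_right _ _).trans (min_le_left _ _))
  have q3 : s ≤ rg / 8 := hss.trans ((min_le_right _ _).trans (min_le_right _ _))
  rw [le_div_iff₀ (by positivity)] at q2
  set N := C1 * (s / 4) ^ (-β) with hN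
  set θ := min (ε1 * C1) (ε1 * C1 ^ p / 2) with hθ
  have hθ1 : θ ≤ ε1 * C1 := min_le_left _ _
  have hθ2 : θ ≤ ε1 * C1 ^ p / 2 := min_le_right _ _
  have hN0 : 0 < N := by positivity
  have hX : 0 < s ^ (1 - β) := Real.rpow_pos_of_pos hs _
  have hN1 : C1 * s ^ (-β) ≤ N :=
    mul_le_mul_of_nonneg_left (pw_anti β0.le (by positivity) (by linarith)) hC.le
  have hball : ∀ y ∈ closedBall (b + s • ν b) (s / 2), _ := fun y hy =>
    Gm.ballpt hb hba hs (by linarith) (by linarith) hy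
  have htm : ∀ r ∈ Icc (t - s ^ 2 / 4) t, r ∈ Ico (T / 2) T := fun r hr =>
    ⟨by linarith [hr.1], by linarith [hr.2]⟩
  have hgN : ∀ y ∈ closedBall (b + s • ν b) (s / 2), ∀ r ∈ Icc (t - s ^ 2 / 4) t, ‖G y r‖ ≤ N := by
    intro y hy r hr
    obtain ⟨g1, g2, g3, g4⟩ := hball y hy
    refine ((S.sl r (htm r hr)).grad y g1 g3).trans ?_
    exact mul_le_mul_of_nonneg_left (pw_anti β0.le (by positivity) g2) hC.le
  have hx : b + s • ν b ∈ closedBall (b + s • ν b) (s / 2) := mem_closedBall_self (by positivity)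
  have htI : t ∈ Icc (t - s ^ 2 / 4) t := ⟨by nlinarith [sq_nonneg s], le_rfl⟩
  refine ⟨hgN _ hx _ htI, fun τ hτ hτν => ?_⟩
  have sh : SHyp p s N k0 (b + s • ν b) t u G :=
    { hp := by linarith
      hρ := hs
      hN := hN0
      hk := by
        rw [hN, pw2 hp hβ hC.le (by positivity)]
        refine le_trans (le_of_eq ?_) hk0
        field_simp
      par := S.parball hb hba hs (by linarith) (by linarith) ht htT
      hG := hgN }
  have hd2 : ∀ r ∈ Icc (t - s ^ 2 / 4) t, ∀ y : V, ∀ q : ℝ, y ∈ closedBall (b + s • ν b) (s / 2) →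
      y + q • τ ∈ closedBall (b + s • ν b) (s / 2) → |u (y + q • τ) r - u y r| ≤ θ * s ^ (1 - β) := by
    intro r hr y q hy hyq
    obtain ⟨g1, -, -, g4⟩ := hball y hy
    have hq := ball_diff hτ hy hyq
    exact hA Ω δ ν a _ _ (S.sl r (htm r hr)) b hb (by linarith) s hs q1 y (q • τ) (by linarith)
      (by rw [inner_smul_left, hτν, mul_zero])
      (by rw [norm_smul, hτ, mul_one, Real.norm_eq_abs]; linarith) g1 (hball _ hyq).1
  have e1 : θ * s ^ (1 - β) ≤ ε1 * s * N := by
    calc θ * s ^ (1 - β) ≤ ε1 * C1 * s ^ (1 - β) := mul_le_mul_of_nonneg_right hθ1 hX.le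
      _ = ε1 * s * (C1 * s ^ (-β)) := by rw [pw1 hs]; field_simp
      _ ≤ _ := mul_le_mul_of_nonneg_left hN1 (by positivity)
  have e2 : 2 * (θ * s ^ (1 - β)) ≤ ε1 * s ^ 2 * N ^ p := by
    have hNp : (C1 * s ^ (-β)) ^ p ≤ N ^ p := Real.rpow_le_rpow (by positivity) hN1 (by linarith)
    rw [pw3 hp hβ hC.le hs] at hNp
    calc 2 * (θ * s ^ (1 - β)) ≤ 2 * (ε1 * C1 ^ p / 2 * s ^ (1 - β)) := by
          have := mul_le_mul_of_nonneg_right hθ2 hX.le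
          linarith
      _ = ε1 * s ^ 2 * (C1 ^ p * s ^ (1 - β) / s ^ 2) := by field_simp
      _ ≤ _ := mul_le_mul_of_nonneg_left hNp (by positivity)
  obtain ⟨c1, c2⟩ := hS s N (b + s • ν b) t u G τ sh hτ
    (by
      intro r hr y r1 r2 h0 h1 h2 h3
      have a1 := hd2 r hr y r1 h0 h1
      have e3 : y + (r1 + r2) • τ = (y + r2 • τ) + r1 • τ := by module
      have a2 := hd2 r hr (y + r2 • τ) r1 h2 (by rw [← e3]; exact h3)
      rw [← e3] at a2
      rw [abs_le] at *
      constructor <;> linarith)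
    (fun r hr y q hy hyq => (hd2 r hr y q hy hyq).trans e1)
  exact ⟨c1, c2 _ (S.hH _ (hball _ hx).1 t ⟨by nlinarith [sq_nonneg s], htT⟩)⟩

set_option maxHeartbeats 1600000 in
theorem regII (S : Sol p β M C1 κ rg T Ω δ ν a u G H) {κ0 CG d2 k0 η1 : ℝ} (hκ0 : 0 < κ0)
    (hCG : 0 < CG) (hd2 : 0 < d2) (hk0 : CG ^ (p - 1) ≤ k0) (hη : 0 < η1)
    (hYC : ∀ b ∈ frontier Ω, dist b a < rg / 4 → ∀ t ∈ Ico (T / 2) T,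
    ∀ d, 0 < d → d ≤ d2 → (∀ s, 0 < s → s ≤ d → u (b + s • ν b) t ≤ κ0 * s ^ (1 - β)) →
    ∀ t' ∈ Ico (T / 2) T, |t' - t| ≤ d ^ 2 → ∀ y ∈ Ω, ‖y - b‖ ≤ 3 * d →
    |u y t'| ≤ CG * d ^ (-β) * δ y ∧ ‖G y t'‖ ≤ CG * d ^ (-β)) :
    ∃ d4 > 0, ∀ b ∈ frontier Ω, dist b a < rg / 4 → ∀ t, t < T →
    ∀ d, 0 < d → d ≤ d4 → (∀ s, 0 < s → s ≤ d → u (b + s • ν b) t ≤ κ0 * s ^ (1 - β)) →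
    ∀ s, 0 < s → 40 * s ≤ d →
    T / 2 ≤ t - s ^ 2 / 4 → ‖G (b + s • ν b) t‖ ≤ CG * d ^ (-β) ∧
    ∀ τ : V, ‖τ‖ = 1 → ⟪τ, ν b⟫ = 0 →
    |⟪G (b + s • ν b) t, τ⟫| ≤ η1 * (CG * d ^ (-β)) ∧
    |⟪H (b + s • ν b) t τ, τ⟫| ≤ η1 * (CG * d ^ (-β)) ^ p := by
  have hp := S.mid.hp
  have hβ := S.mid.hβ
  have Gm := S.mid.geo
  have hrg := Gm.hrg
  have hκ := Gm.hκ
  have hT := S.hT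
  obtain ⟨β0, β1, β2⟩ := beta_pos hp hβ
  have hCp1 : 0 < CG ^ (p - 1) := Real.rpow_pos_of_pos hCG _
  have hCp : 0 < CG ^ p := Real.rpow_pos_of_pos hCG _
  obtain ⟨ε1, hε1, hS⟩ := lemS V (p := p) (k0 := k0) (by linarith) (by linarith) hη
  set Z1 := 1 + 2 * EZ (Module.finrank ℝ V) (p * CG ^ (p - 1)) with hZ1
  set Z2 := E7 (Module.finrank ℝ V) (Module.finrank ℝ (WithLp 2 (V × ℝ))) (p * CG ^ (p - 1)) with hZ2
  set e := min (1 / 8) (min (ε1 / (|Z1| + 1)) (ε1 * CG ^ p / (CG * (|Z2| + 1)))) with he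
  have he0 : 0 < e := by positivity
  have he1 : e ≤ 1 / 8 := min_le_left _ _
  have he2 : e ≤ ε1 / (|Z1| + 1) := (min_le_right _ _).trans (min_le_left _ _)
  have he3 : e ≤ ε1 * CG ^ p / (CG * (|Z2| + 1)) := (min_le_right _ _).trans (min_le_right _ _)
  rw [le_div_iff₀ (by positivity)] at he2 he3
  have f1 : Z1 * e ≤ ε1 := by
    have := mul_le_mul_of_nonneg_right (le_abs_self Z1) he0.le
    linarith
  have f2 : Z2 * e * CG ≤ ε1 * CG ^ p := by
    have := mul_le_mul_of_nonneg_right (le_abs_self Z2) (mul_pos he0 hCG).le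
    nlinarith [mul_pos he0 hCG]
  obtain ⟨d3, hd3, hNear⟩ := lemNear S hκ0 hCG hd2 he0 he1 hYC
  refine ⟨min d3 (min (1 / (9 * κ)) (rg / 8)), by positivity, ?_⟩
  intro b hb hba t htT d hd hdd hY s hs hsd ht
  have q1 : d ≤ d3 := hdd.trans (min_le_left _ _)
  have q2 : d ≤ 1 / (9 * κ) := hdd.trans ((min_le_right _ _).trans (min_le_left _ _))
  have q3 : d ≤ rg / 8 := hdd.trans ((min_le_right _ _).trans (min_le_right _ _))
  rw [le_div_iff₀ (by positivity)] at q2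
  set N := CG * d ^ (-β) with hN
  have hN0 : 0 < N := by positivity
  have htm : ∀ r ∈ Icc (t - s ^ 2 / 4) t, r ∈ Ico (T / 2) T := fun r hr =>
    ⟨by linarith [hr.1], by linarith [hr.2]⟩
  have htI : t ∈ Icc (t - s ^ 2 / 4) t := ⟨by nlinarith [sq_nonneg s], le_rfl⟩
  have hnr : ∀ r ∈ Icc (t - s ^ 2 / 4) t, _ := fun r hr => hNear b hb hba t (htm t htI) d hd q1 hY r
    (htm r hr) (by
      have : s ^ 2 ≤ d ^ 2 := pow_le_pow_left₀ hs.le (by linarith) 2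
      rw [abs_le]; constructor <;> nlinarith [hr.1, hr.2, sq_nonneg s])
  have hs9 : 9 * κ * s ≤ 1 := by nlinarith
  have hs8 : 8 * s ≤ rg := by linarith
  have hball : ∀ y ∈ closedBall (b + s • ν b) (s / 2), _ := fun y hy =>
    Gm.ballpt hb hba hs hs9 hs8 hy
  have hgN : ∀ y ∈ closedBall (b + s • ν b) (s / 2), ∀ r ∈ Icc (t - s ^ 2 / 4) t, ‖G y r‖ ≤ N := by
    intro y hy r hr
    obtain ⟨g1, g2, g3, g4⟩ := hball y hy
    exact ((hnr r hr).bnd y g1 (by linarith)).2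
  have hx : b + s • ν b ∈ closedBall (b + s • ν b) (s / 2) := mem_closedBall_self (by positivity)
  refine ⟨hgN _ hx _ htI, fun τ hτ hτν => ?_⟩
  have sh : SHyp p s N k0 (b + s • ν b) t u G :=
    { hp := by linarith
      hρ := hs
      hN := hN0
      hk := by
        rw [hN, pw2 hp hβ hCG.le hd]
        refine le_trans ?_ hk0
        rw [div_mul_eq_mul_div, div_le_iff₀ hd]
        exact mul_le_mul_of_nonneg_left (by linarith) hCp1.le
      par := S.parball hb hba hs hs9 hs8 ht htT
      hG := hgN }
  obtain ⟨c1, c2⟩ := hS s N (b + s • ν b) t u G τ sh hτ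
    (by
      intro r hr y r1 r2 h0 h1 h2 h3
      refine ((hnr r hr).h3 hτ hτν hs hsd h0 h1 h2 h3).trans ?_
      have e3 : Z2 * (e * N / d) ≤ ε1 * N ^ p := by
        rw [hN, pw3 hp hβ hCG.le hd, pw1 hd]
        have hX : 0 < d ^ (1 - β) := Real.rpow_pos_of_pos hd _
        calc Z2 * (e * (CG * (d ^ (1 - β) / d)) / d) = Z2 * e * CG * (d ^ (1 - β) / d ^ 2) := by
              field_simp
          _ ≤ ε1 * CG ^ p * (d ^ (1 - β) / d ^ 2) := mul_le_mul_of_nonneg_right f2 (by positivity)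
          _ = _ := by ring
      have := mul_le_mul_of_nonneg_right e3 (sq_nonneg s)
      linarith)
    (fun r hr y q hy hyq => by
      refine ((hnr r hr).h2 hτ hτν hs hsd hy hyq).trans ?_
      have := mul_le_mul_of_nonneg_right f1 (mul_pos hs hN0).le
      linarith)
  exact ⟨c1, c2 _ (S.hH _ (hball _ hx).1 t ⟨by nlinarith [sq_nonneg s], htT⟩)⟩

set_option maxHeartbeats 1600000 in
theorem lemE1 (S : Sol p β M C1 κ rg T Ω δ ν a u G H) {κ0 CG d2 ε : ℝ} (hκ0 : 0 < κ0)
    (hCG : 0 < CG) (hd2 : 0 < d2) (hε : 0 < ε)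
    (hYC : ∀ b ∈ frontier Ω, dist b a < rg / 4 → ∀ t ∈ Ico (T / 2) T,
    ∀ d, 0 < d → d ≤ d2 → (∀ s, 0 < s → s ≤ d → u (b + s • ν b) t ≤ κ0 * s ^ (1 - β)) →
    ∀ t' ∈ Ico (T / 2) T, |t' - t| ≤ d ^ 2 → ∀ y ∈ Ω, ‖y - b‖ ≤ 3 * d →
    |u y t'| ≤ CG * d ^ (-β) * δ y ∧ ‖G y t'‖ ≤ CG * d ^ (-β)) :
    ∃ r0 > 0, ∀ b ∈ frontier Ω, dist b a < rg / 4 → ∀ t, 3 / 4 * T ≤ t → t < T →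
    ∀ d, 0 < d → d ≤ r0 → (∀ s, 0 < s → s ≤ d → u (b + s • ν b) t ≤ κ0 * s ^ (1 - β)) →
    ∀ s, 0 < s → s ≤ r0 →
    |⟪H (b + s • ν b) t (ν b), ν b⟫ + |⟪G (b + s • ν b) t, ν b⟫| ^ p| ≤ ε * (max s d) ^ (-β - 1) := by
  have hp := S.mid.hp
  have hβ := S.mid.hβ
  have hM := S.mid.hM
  have hC := S.mid.hC
  have Gm := S.mid.geo
  have hrg := Gm.hrg
  have hκ := Gm.hκ
  have hT := S.hT
  obtain ⟨β0, β1, β2⟩ := beta_pos hp hβ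
  set n : ℝ := (Module.finrank ℝ V : ℝ) with hn
  have hn0 : 0 ≤ n := by positivity
  set NB := max CG (C1 * (160:ℝ) ^ β) with hNB
  have hNB0 : 0 < NB := lt_of_lt_of_le hCG (le_max_left _ _)
  have hNBp : 0 < NB ^ p := Real.rpow_pos_of_pos hNB0 _
  set η1 := ε / (2 * (n + p) * NB ^ p) with hη1
  have hη : 0 < η1 := by positivity
  obtain ⟨s0, hs0, hI⟩ := regI S (k0 := max (4 * C1 ^ (p - 1)) (CG ^ (p - 1))) (le_max_left _ _) hη
  obtain ⟨d4, hd4, hII⟩ := regII S (k0 := max (4 * C1 ^ (p - 1)) (CG ^ (p - 1))) hκ0 hCG hd2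
    (le_max_right _ _) hη hYC
  obtain ⟨m, hm, hm1⟩ := pw_small (c := M) (q := β + 1) hM (by linarith) (ε := ε / 2) (by positivity)
  refine ⟨min (min s0 d4) (min m (min (rg / 2) (min 1 T))), by positivity, ?_⟩
  intro b hb hba t ht htT d hd hdd hY s hs hss
  have le1 : min (min s0 d4) (min m (min (rg / 2) (min 1 T))) ≤ s0 := (min_le_left _ _).trans (min_le_left _ _)
  have le2 : min (min s0 d4) (min m (min (rg / 2) (min 1 T))) ≤ d4 := (min_le_left _ _).trans (min_le_right _ _)
  have le3 : min (min s0 d4) (min m (min (rg / 2) (min 1 T))) ≤ m := (min_le_right _ _).trans (min_le_left _ _)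
  have le4 : min (min s0 d4) (min m (min (rg / 2) (min 1 T))) ≤ rg / 2 :=
    (min_le_right _ _).trans ((min_le_right _ _).trans (min_le_left _ _))
  have le5 : min (min s0 d4) (min m (min (rg / 2) (min 1 T))) ≤ 1 :=
    (min_le_right _ _).trans ((min_le_right _ _).trans ((min_le_right _ _).trans (min_le_left _ _)))
  have le6 : min (min s0 d4) (min m (min (rg / 2) (min 1 T))) ≤ T :=
    (min_le_right _ _).trans ((min_le_right _ _).trans ((min_le_right _ _).trans (min_le_right _ _)))
  set l := max s d with hl
  have hl0 : 0 < l := lt_of_lt_of_le hs (le_max_left _ _)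
  have hlm : l ≤ m := max_le (hss.trans le3) (hdd.trans le3)
  have htt : T / 2 ≤ t - s ^ 2 / 4 := by
    have : s ^ 2 ≤ T := by nlinarith
    linarith
  have key : ∃ N, 0 < N ∧ N ≤ NB * l ^ (-β) ∧ ‖G (b + s • ν b) t‖ ≤ N ∧
    ∀ τ : V, ‖τ‖ = 1 → ⟪τ, ν b⟫ = 0 → |⟪G (b + s • ν b) t, τ⟫| ≤ η1 * N ∧
    |⟪H (b + s • ν b) t τ, τ⟫| ≤ η1 * N ^ p := by
    rcases le_or_gt (40 * s) d with h | h
    · obtain ⟨a1, a2⟩ := hII b hb hba t htT d hd (hdd.trans le2) hY s hs h htt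
      refine ⟨_, by positivity, ?_, a1, a2⟩
      have : l = d := max_eq_right (by linarith)
      rw [this]
      exact mul_le_mul_of_nonneg_right (le_max_left _ _) (by positivity)
    · obtain ⟨a1, a2⟩ := hI b hb hba t htT s hs (hss.trans le1) htt
      refine ⟨_, by positivity, ?_, a1, a2⟩
      have h1 : l / 160 ≤ s / 4 := by
        have : l ≤ 40 * s := max_le (by linarith) h.le
        linarith
      have h2 : (s / 4) ^ (-β) ≤ (l / 160) ^ (-β) := pw_anti β0.le (by positivity) h1
      have h3 : (l / 160) ^ (-β) = (160:ℝ) ^ β * l ^ (-β) := by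
        rw [Real.div_rpow hl0.le (by norm_num), Real.rpow_neg (by norm_num : (0:ℝ) ≤ 160)]
        field_simp
      calc C1 * (s / 4) ^ (-β) ≤ C1 * ((160:ℝ) ^ β * l ^ (-β)) := by
            rw [← h3]; exact mul_le_mul_of_nonneg_left h2 hC.le
        _ = C1 * (160:ℝ) ^ β * l ^ (-β) := by ring
        _ ≤ _ := mul_le_mul_of_nonneg_right (le_max_right _ _) (by positivity)
  obtain ⟨N, hN0, hN1, hN2, hN3⟩ := key
  have hx := (Gm.ray b hb s hs (by linarith)).1
  have fin := core_normal (Gm.nrm b hb) (by linarith) hN0 hη.le hN2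
    (S.pde _ hx t ⟨by linarith, htT⟩) hN3
  refine fin.trans ?_
  have hL : 0 < l ^ (-β - 1) := Real.rpow_pos_of_pos hl0 _
  have g1 : N ^ p ≤ NB ^ p * l ^ (-β - 1) := by
    have := Real.rpow_le_rpow hN0.le hN1 (by linarith : 0 ≤ p)
    rwa [Real.mul_rpow hNB0.le (by positivity), ← Real.rpow_mul hl0.le,
      show -β * p = -β - 1 by linarith] at this
  have g2 : M ≤ ε / 2 * l ^ (-β - 1) := by
    have h1 := hm1 l hl0.le hlm
    have h2 : M = M * l ^ (β + 1) * l ^ (-β - 1) := by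
      rw [mul_assoc, ← Real.rpow_add hl0]; simp
    rw [h2]
    exact mul_le_mul_of_nonneg_right h1.le hL.le
  have g3 : (n + p) * η1 * N ^ p ≤ ε / 2 * l ^ (-β - 1) := by
    calc (n + p) * η1 * N ^ p ≤ (n + p) * η1 * (NB ^ p * l ^ (-β - 1)) :=
          mul_le_mul_of_nonneg_left g1 (by positivity)
      _ = ε / 2 * l ^ (-β - 1) := by rw [hη1]; field_simp
  linarith

end E1Sec


section E2Sec

theorem ode_low {p β κ0 c ε d r0 s1 : ℝ} {g h : ℝ → ℝ} (hp : 2 < p) (hβ : β = 1 / (p - 1)) (hκ0 : 0 < κ0)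
    (hc : 0 < c) (hc1 : c ≤ κ0 / 2) (hc2 : c ^ (p - 1) < β / 2) (hε : 0 < ε) (hε1 : ε ≤ β * c / 8)
    (hε2 : ε ≤ κ0 / 2) (hd : 0 < d) (hdr : d ≤ r0) (hder : ∀ s, 0 < s → s ≤ r0 → HasDerivAt g (h s) s)
    (hode : ∀ s, 0 < s → s ≤ r0 → |h s + |g s| ^ p| ≤ ε * (max s d) ^ (-β - 1))
    (h1 : 0 < s1) (h2 : s1 < d) (hs1 : g s1 = κ0 * d ^ (-β)) {s : ℝ} (hs : 0 < s) (hsr : s ≤ r0) :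
    c / 2 * (max s d) ^ (-β) ≤ g s := by
  obtain ⟨β0, β1, β2⟩ := beta_pos hp hβ
  rcases lt_or_ge s s1 with hss | hss
  · have hl : max s d = d := max_eq_right (by linarith)
    rw [hl]
    obtain ⟨r, hr, hrs⟩ := exists_hasDerivAt_eq_slope g h hss
      (fun x hx => (hder x (by linarith [hx.1]) (by linarith [hx.2])).continuousAt.continuousWithinAt)
      (fun x hx => hder x (by linarith [hx.1]) (by linarith [hx.2]))
    have hr0 : 0 < r := by linarith [hr.1]
    have h3 := hode r hr0 (by linarith [hr.2])
    rw [max_eq_right (by linarith [hr.2])] at h3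
    have h4 := (abs_le.mp h3).2
    have h5 : 0 ≤ |g r| ^ p := Real.rpow_nonneg (abs_nonneg _) _
    have hX : 0 < d ^ (-β) := Real.rpow_pos_of_pos hd _
    have hX' : d ^ (-β - 1) = d ^ (-β) / d := Real.rpow_sub_one hd.ne' _
    rw [hX'] at h4
    have h6 : g s1 - g s = h r * (s1 - s) := by rw [hrs]; field_simp [sub_ne_zero.mpr hss.ne']
    have hY : 0 ≤ ε * (d ^ (-β) / d) := by positivity
    have h7 : h r * (s1 - s) ≤ ε * (d ^ (-β) / d) * d := by
      calc h r * (s1 - s) ≤ ε * (d ^ (-β) / d) * (s1 - s) :=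
            mul_le_mul_of_nonneg_right (by linarith) (by linarith)
        _ ≤ _ := mul_le_mul_of_nonneg_left (by linarith) hY
    have h8 : ε * (d ^ (-β) / d) * d = ε * d ^ (-β) := by field_simp
    rw [h8] at h7
    have h9 : (c / 2) * d ^ (-β) ≤ (κ0 - ε) * d ^ (-β) :=
      mul_le_mul_of_nonneg_right (by linarith) hX.le
    linarith
  · set φ : ℝ → ℝ := fun x => c * (x + d) ^ (-β) with hφ
    have hφd : ∀ x, 0 < x → HasDerivAt φ (-(β * c) * (x + d) ^ (-β - 1)) x := by
      intro x hx
      have := (((hasDerivAt_id x).add_const d).rpow_const (p := -β)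
        (Or.inl (by simp only [id]; linarith))).const_mul c
      exact this.congr_deriv (by simp only [id]; ring)
    have hcmp : ∀ x ∈ Icc s1 s, φ x ≤ g x := by
      have hpos : ∀ x ∈ Icc s1 s, 0 < x := fun x hx => by linarith [hx.1]
      intro x hx
      refine image_le_of_deriv_right_lt_deriv_boundary' (f := φ) (a := s1) (b := s)
        (f' := fun x => -(β * c) * (x + d) ^ (-β - 1)) (B := g) (B' := h)
        (fun x hx => (hφd x (hpos x hx)).continuousAt.continuousWithinAt)
        (fun x hx => (hφd x (hpos x (Ico_subset_Icc_self hx))).hasDerivWithinAt) ?_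
        (fun x hx => (hder x (hpos x hx) (by linarith [hx.2])).continuousAt.continuousWithinAt)
        (fun x hx => (hder x (hpos x (Ico_subset_Icc_self hx)) (by linarith [hx.2])).hasDerivWithinAt)
        ?_ hx
      · rw [hs1]
        have e1 : (s1 + d) ^ (-β) ≤ d ^ (-β) := pw_anti β0.le hd (by linarith)
        have hX : 0 < d ^ (-β) := Real.rpow_pos_of_pos hd _
        calc c * (s1 + d) ^ (-β) ≤ c * d ^ (-β) := mul_le_mul_of_nonneg_left e1 hc.le
          _ ≤ _ := mul_le_mul_of_nonneg_right (by linarith) hX.le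
      · intro y hy hyeq
        have hy0 := hpos y (Ico_subset_Icc_self hy)
        have h3 := (abs_le.mp (hode y hy0 (by linarith [hy.2]))).1
        have hyd : 0 < y + d := by linarith
        set Y := (y + d) ^ (-β - 1) with hY
        have hY0 : 0 < Y := Real.rpow_pos_of_pos hyd _
        have e1 : |g y| ^ p = c ^ p * Y := by
          have hZ : 0 < (y + d) ^ (-β) := Real.rpow_pos_of_pos hyd _
          rw [← hyeq, abs_of_pos (by positivity), Real.mul_rpow hc.le hZ.le, ← Real.rpow_mul hyd.le,
            show -β * p = -β - 1 by linarith]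
        have e2 : (max y d) ^ (-β - 1) ≤ 4 * Y := by
          have hm : (y + d) / 2 ≤ max y d := by
            have := le_max_left y d
            have := le_max_right y d
            linarith
          have := Real.rpow_le_rpow_of_nonpos (by positivity) hm (by linarith : -β - 1 ≤ 0)
          refine this.trans ?_
          rw [Real.div_rpow hyd.le (by norm_num), div_eq_mul_inv, ← Real.rpow_neg (by norm_num)]
          have h4 : (2:ℝ) ^ (-(-β - 1)) ≤ 4 := by
            calc (2:ℝ) ^ (-(-β - 1)) ≤ (2:ℝ) ^ (2:ℝ) :=
                  Real.rpow_le_rpow_of_exponent_le (by norm_num) (by linarith)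
              _ = 4 := by norm_num
          nlinarith
        have e3 : c ^ p < β / 2 * c := by
          have : c ^ p = c ^ (p - 1) * c := by rw [← Real.rpow_add_one hc.ne', sub_add_cancel]
          rw [this]
          exact mul_lt_mul_of_pos_right hc2 hc
        have e4 : ε * (max y d) ^ (-β - 1) ≤ β * c / 2 * Y := by
          calc ε * (max y d) ^ (-β - 1) ≤ ε * (4 * Y) := mul_le_mul_of_nonneg_left e2 hε.le
            _ ≤ β * c / 8 * (4 * Y) := mul_le_mul_of_nonneg_right hε1 (by positivity)
            _ = _ := by ring
        have e5 : c ^ p * Y < β / 2 * c * Y := mul_lt_mul_of_pos_right e3 hY0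
        rw [e1] at h3
        show -(β * c) * Y < h y
        linarith
    have h3 := hcmp s ⟨hss, le_rfl⟩
    refine le_trans ?_ h3
    set l := max s d with hl
    have l1 : s ≤ l := le_max_left _ _
    have l2 : d ≤ l := le_max_right _ _
    have l0 : 0 < l := by linarith
    have e1 : (2 * l) ^ (-β) ≤ (s + d) ^ (-β) := pw_anti β0.le (by linarith) (by linarith)
    have e2 : (1 / 2 : ℝ) ≤ (2:ℝ) ^ (-β) := by
      calc (1 / 2 : ℝ) = (2:ℝ) ^ (-1:ℝ) := by rw [Real.rpow_neg_one]; norm_num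
        _ ≤ _ := Real.rpow_le_rpow_of_exponent_le (by norm_num) (by linarith)
    rw [Real.mul_rpow (by norm_num) l0.le] at e1
    have hX : 0 < l ^ (-β) := Real.rpow_pos_of_pos l0 _
    show c / 2 * l ^ (-β) ≤ c * (s + d) ^ (-β)
    have e3 := mul_le_mul_of_nonneg_right e2 hX.le
    have e4 := mul_le_mul_of_nonneg_left (e3.trans e1) hc.le
    linarith

variable {V : Type*} [NormedAddCommGroup V] [InnerProductSpace ℝ V] [FiniteDimensional ℝ V]
  [CompleteSpace V]
variable {p β M C1 κ rg T : ℝ} {Ω : Set V} {δ : V → ℝ} {ν : V → V} {a : V}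
  {u : V → ℝ → ℝ} {G : V → ℝ → V} {H : V → ℝ → V →L[ℝ] V}

theorem Sol.rayd2 (S : Sol p β M C1 κ rg T Ω δ ν a u G H) {b : V}
    (hb : b ∈ frontier Ω) {s t : ℝ} (hs : 0 < s) (hsr : s < rg) (ht : t ∈ Ioo 0 T) :
    HasDerivAt (fun s : ℝ => ⟪G (b + s • ν b) t, ν b⟫) ⟪H (b + s • ν b) t (ν b), ν b⟫ s := by
  have h5 := S.hH _ (S.mid.geo.ray b hb s hs hsr).1 t ht
  have h6 : HasDerivAt (fun s : ℝ => b + s • ν b) (ν b) s := by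
    simpa using ((hasDerivAt_id s).smul_const (ν b)).const_add b
  have h7 := h5.comp_hasDerivAt s h6
  have h8 := h7.inner ℝ (hasDerivAt_const s (ν b))
  exact h8.congr_deriv (by simp)

set_option maxHeartbeats 1600000 in
theorem lemFinal (S : Sol p β M C1 κ rg T Ω δ ν a u G H) {ε : ℝ} (hε : 0 < ε) :
    ∃ η > 0, ∀ x ∈ Ω, dist x a < η → ∀ t ∈ Ioo (T - η) T,
      |⟪H x t (ν x), ν x⟫ + ⟪G x t, ν x⟫ ^ p| ≤ ε * ⟪G x t, ν x⟫ ^ p := by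
  have hp := S.mid.hp
  have hβ := S.mid.hβ
  have Gm := S.mid.geo
  have hrg := Gm.hrg
  have hT := S.hT
  obtain ⟨β0, β1, β2⟩ := beta_pos hp hβ
  obtain ⟨κ0, hκ0, CG, hCG, d2, hd2, hYC⟩ := lemYC S
  obtain ⟨x0, hx0, hx1⟩ := pw_small (c := 1) (q := p - 1) (by norm_num) (by linarith)
    (ε := β / 2) (by positivity)
  set c := min x0 (κ0 / 2) with hc
  have hc0 : 0 < c := by positivity
  have hc1 : c ≤ κ0 / 2 := min_le_right _ _
  have hc2 : c ^ (p - 1) < β / 2 := by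
    have := hx1 c hc0.le (min_le_left _ _)
    rwa [one_mul] at this
  have hcp : 0 < (c / 2) ^ p := Real.rpow_pos_of_pos (by positivity) _
  set ε' := min (ε * (c / 2) ^ p) (min (β * c / 8) (κ0 / 2)) with hε'
  have hε'0 : 0 < ε' := by positivity
  have e1 : ε' ≤ ε * (c / 2) ^ p := min_le_left _ _
  have e2 : ε' ≤ β * c / 8 := (min_le_right _ _).trans (min_le_left _ _)
  have e3 : ε' ≤ κ0 / 2 := (min_le_right _ _).trans (min_le_right _ _)
  obtain ⟨r0', hr0', hE1⟩ := lemE1 S hκ0 hCG hd2 hε'0 hYC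
  set r0 := min r0' (rg / 2) with hr0d
  have hr0 : 0 < r0 := by positivity
  have r1 : r0 ≤ r0' := min_le_left _ _
  have r2 : r0 ≤ rg / 2 := min_le_right _ _
  obtain ⟨ηB, hηB, hB⟩ := lemB S hκ0 hd2 hYC hr0
  set η := min (min (ηB / 2) r0) (min (rg / 8) (T / 4)) with hη
  have hη0 : 0 < η := by positivity
  have n1 : η ≤ ηB / 2 := (min_le_left _ _).trans (min_le_left _ _)
  have n2 : η ≤ r0 := (min_le_left _ _).trans (min_le_right _ _)
  have n3 : η ≤ rg / 8 := (min_le_right _ _).trans (min_le_left _ _)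
  have n4 : η ≤ T / 4 := (min_le_right _ _).trans (min_le_right _ _)
  refine ⟨η, hη0, fun x hx hxa t ht => ?_⟩
  have hδx : 0 < δ x := Gm.dpos hx
  have hδa : δ x ≤ dist x a := by rw [Gm.dd]; exact infDist_le_dist_of_mem Gm.ha
  obtain ⟨b, hb, hxb, hνx⟩ := Gm.foot x hx (by linarith)
  have hν1 := Gm.nrm b hb
  have hbx : dist b x = δ x := by
    rw [dist_comm, dist_eq_norm]
    nth_rewrite 1 [hxb]
    rw [add_sub_cancel_left, norm_smul, hν1, mul_one, Real.norm_eq_abs, abs_of_pos hδx]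
  have hba : dist b a < 2 * η := by linarith [dist_triangle b x a]
  rw [hνx]
  set s := δ x with hs
  obtain ⟨d, hd0, hdm, hd1, hdY⟩ := hB b hb (by linarith) t ⟨by linarith [ht.1], ht.2⟩
  have htI : t ∈ Ico (T / 2) T := ⟨by linarith [ht.1], ht.2⟩
  obtain ⟨s1, hs1, hs1d, hs1e⟩ := (S.sl t htI).raymvt hb hd0 (by linarith)
  simp only [hd1] at hs1e
  have hs1f : ⟪G (b + s1 • ν b) t, ν b⟫ = κ0 * d ^ (-β) := by
    rw [pw1 hd0]
    field_simp
    linarith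
  have hode : ∀ s, 0 < s → s ≤ r0 → |⟪H (b + s • ν b) t (ν b), ν b⟫ + |⟪G (b + s • ν b) t, ν b⟫| ^ p| ≤
      ε' * (max s d) ^ (-β - 1) := fun s hs hsr =>
    hE1 b hb (by linarith) t (by linarith [ht.1]) ht.2 d hd0 (by linarith) hdY s hs (by linarith)
  have low := ode_low (g := fun s : ℝ => ⟪G (b + s • ν b) t, ν b⟫)
    (h := fun s : ℝ => ⟪H (b + s • ν b) t (ν b), ν b⟫) hp hβ hκ0 hc0 hc1 hc2 hε'0 e2 e3 hd0 hdm
    (fun s hs hsr => S.rayd2 hb hs (by linarith) ⟨by linarith [ht.1], ht.2⟩) hode hs1 hs1d hs1f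
    hδx (by linarith)
  have fin := hode s hδx (by linarith)
  rw [← hxb] at low fin
  set l := max s d with hl
  have hl0 : 0 < l := lt_of_lt_of_le hd0 (le_max_right _ _)
  have hX : 0 < l ^ (-β) := Real.rpow_pos_of_pos hl0 _
  have hX' : 0 < l ^ (-β - 1) := Real.rpow_pos_of_pos hl0 _
  have hg0 : 0 < ⟪G x t, ν b⟫ := lt_of_lt_of_le (by positivity) low
  rw [abs_of_pos hg0] at fin
  refine fin.trans ?_
  have h1 := Real.rpow_le_rpow (by positivity) low (by linarith : 0 ≤ p)
  rw [Real.mul_rpow (by positivity) hX.le, ← Real.rpow_mul hl0.le,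
    show -β * p = -β - 1 by linarith] at h1
  calc ε' * l ^ (-β - 1) ≤ ε * (c / 2) ^ p * l ^ (-β - 1) := mul_le_mul_of_nonneg_right e1 hX'.le
    _ = ε * ((c / 2) ^ p * l ^ (-β - 1)) := by ring
    _ ≤ _ := mul_le_mul_of_nonneg_left h1 hε.le

end E2Sec

section Asm
theorem trace_std {n : ℕ} (A : EuclideanSpace ℝ (Fin n) →L[ℝ] EuclideanSpace ℝ (Fin n)) :
    LinearMap.trace ℝ (EuclideanSpace ℝ (Fin n)) (A : EuclideanSpace ℝ (Fin n) →ₗ[ℝ] EuclideanSpace ℝ (Fin n)) =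
      ∑ i : Fin n, ⟪A (EuclideanSpace.single i (1 : ℝ)), EuclideanSpace.single i (1 : ℝ)⟫ := by
  rw [LinearMap.trace_eq_sum_inner _ (EuclideanSpace.basisFun (Fin n) ℝ)]
  refine Finset.sum_congr rfl fun i _ => ?_
  rw [EuclideanSpace.basisFun_apply, real_inner_comm]
  rfl

/-- integrating the gradient bound -/
theorem int_ray {β C : ℝ} (β0 : 0 < β) (β1 : β < 1) {w w' : ℝ → ℝ} {d : ℝ} (hd : 0 < d)
    (hc : ContinuousOn w (Icc 0 d)) (h0 : w 0 = 0) (hw : ∀ s, 0 < s → s < d → HasDerivAt w (w' s) s)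
    (hb : ∀ s, 0 < s → s < d → |w' s| ≤ C * s ^ (-β)) : |w d| ≤ C / (1 - β) * d ^ (1 - β) := by
  have hF : ∀ s, 0 < s → HasDerivAt (fun s : ℝ => C / (1 - β) * s ^ (1 - β)) (C * s ^ (-β)) s := by
    intro s hs
    have := (Real.hasDerivAt_rpow_const (p := 1 - β) (Or.inl hs.ne')).const_mul (C / (1 - β))
    refine this.congr_deriv ?_
    rw [show 1 - β - 1 = -β by ring]
    have : 1 - β ≠ 0 := by linarith
    field_simp
  have hFc : ContinuousOn (fun s : ℝ => C / (1 - β) * s ^ (1 - β)) (Icc 0 d) :=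
    continuousOn_const.mul ((Real.continuous_rpow_const (by linarith : 0 ≤ 1 - β)).continuousOn)
  have hF0 : C / (1 - β) * (0:ℝ) ^ (1 - β) = 0 := by
    rw [Real.zero_rpow (by linarith), mul_zero]
  have m1 : MonotoneOn (fun s => C / (1 - β) * s ^ (1 - β) - w s) (Icc 0 d) := by
    refine monotoneOn_of_hasDerivWithinAt_nonneg (f' := fun s => C * s ^ (-β) - w' s)
      (convex_Icc 0 d) (hFc.sub hc) ?_ ?_
    · intro x hx
      rw [interior_Icc] at hx
      exact ((hF x hx.1).sub (hw x hx.1 hx.2)).hasDerivWithinAt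
    · intro x hx
      rw [interior_Icc] at hx
      linarith [(abs_le.mp (hb x hx.1 hx.2)).2]
  have m2 : MonotoneOn (fun s => C / (1 - β) * s ^ (1 - β) + w s) (Icc 0 d) := by
    refine monotoneOn_of_hasDerivWithinAt_nonneg (f' := fun s => C * s ^ (-β) + w' s)
      (convex_Icc 0 d) (hFc.add hc) ?_ ?_
    · intro x hx
      rw [interior_Icc] at hx
      exact ((hF x hx.1).add (hw x hx.1 hx.2)).hasDerivWithinAt
    · intro x hx
      rw [interior_Icc] at hx
      linarith [(abs_le.mp (hb x hx.1 hx.2)).1]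
  have a1 := m1 (left_mem_Icc.mpr hd.le) (right_mem_Icc.mpr hd.le) hd.le
  have a2 := m2 (left_mem_Icc.mpr hd.le) (right_mem_Icc.mpr hd.le) hd.le
  simp only [hF0, h0] at a1 a2
  rw [abs_le]
  constructor <;> linarith
end Asm

set_option maxHeartbeats 1600000 in
theorem stmt10 {n : ℕ} (hn : 1 ≤ n)
    -- the exponents and constants
    (p β cp dp : ℝ) (hp : 2 < p) (hβ : β = 1 / (p - 1))
    (hcp : cp = β ^ β / (1 - β)) (hdp : dp = β ^ β)
    -- the bounded domain Ω with C² boundary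
    (Ω : Set (EuclideanSpace ℝ (Fin n))) (hΩo : IsOpen Ω) (hΩb : Bornology.IsBounded Ω) (hΩc2 : IsC2Boundary Ω)
    -- the distance to the boundary
    (δ : EuclideanSpace ℝ (Fin n) → ℝ) (hδ : ∀ x, δ x = infDist x (frontier Ω))
    -- δ₀ and the boundary neighborhood Ωδ = {x ∈ Ω : δ(x) < δ₀}
    (δ₀ : ℝ) (hδ₀ : 0 < δ₀)
    (Ωδ : Set (EuclideanSpace ℝ (Fin n))) (hΩδ : Ωδ = {x ∈ Ω | δ x < δ₀})
    -- δ is C² on Ωδ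
    (hδC2 : ContDiffOn ℝ 2 δ Ωδ)
    -- every x ∈ Ωδ has a unique nearest boundary point P x
    (P : EuclideanSpace ℝ (Fin n) → EuclideanSpace ℝ (Fin n))
    (hP : ∀ x ∈ Ωδ, P x ∈ frontier Ω ∧ dist x (P x) = δ x ∧
      ∀ b ∈ frontier Ω, dist x b = δ x → b = P x)
    -- interior sphere condition of radius δ₀ at every boundary point
    (hsph : ∀ b ∈ frontier Ω, ∃ y, ball y δ₀ ⊆ Ω ∧ dist y b = δ₀)
    -- the inward unit normal field ν
    (ν : EuclideanSpace ℝ (Fin n) → EuclideanSpace ℝ (Fin n))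
    (hν1 : ∀ b ∈ frontier Ω, ‖ν b‖ = 1 ∧
      ∀ s ∈ Ioo (0 : ℝ) δ₀, b + s • ν b ∈ Ω ∧ δ (b + s • ν b) = s)
    (hν2 : ∀ x ∈ Ωδ, ν x = ν (P x) ∧ HasGradientAt δ (ν x) x)
    -- the solution u on [0,T], with spatial gradient G, spatial Hessian H and
    -- time derivative u'
    (T : ℝ) (hT : 0 < T)
    (u : EuclideanSpace ℝ (Fin n) → ℝ → ℝ)
    (G : EuclideanSpace ℝ (Fin n) → ℝ → EuclideanSpace ℝ (Fin n))
    (H : EuclideanSpace ℝ (Fin n) → ℝ → (EuclideanSpace ℝ (Fin n) →L[ℝ] EuclideanSpace ℝ (Fin n)))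
    (u' : EuclideanSpace ℝ (Fin n) → ℝ → ℝ)
    -- u is continuous on Ω̄ × [0,T] and vanishes on ∂Ω × [0,T]
    (hu_cont : ContinuousOn (fun q : EuclideanSpace ℝ (Fin n) × ℝ => u q.1 q.2) (closure Ω ×ˢ Icc 0 T))
    (hu_bd : ∀ b ∈ frontier Ω, ∀ t ∈ Icc (0 : ℝ) T, u b t = 0)
    -- u is continuously differentiable in x on Ω̄ × [0,T), with spatial gradient G
    (hG : ∀ t ∈ Ico (0 : ℝ) T, ∀ x ∈ closure Ω,
      HasGradientWithinAt (fun y => u y t) (G x t) (closure Ω) x)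
    (hG_cont : ContinuousOn (fun q : EuclideanSpace ℝ (Fin n) × ℝ => G q.1 q.2) (closure Ω ×ˢ Ico 0 T))
    -- on Ω × (0,T], u has spatial gradient G, spatial Hessian H and time derivative u',
    -- all continuous there
    (hG2 : ∀ t ∈ Ioc (0 : ℝ) T, ∀ x ∈ Ω, HasGradientAt (fun y => u y t) (G x t) x)
    (hH : ∀ t ∈ Ioc (0 : ℝ) T, ∀ x ∈ Ω, HasFDerivAt (fun y => G y t) (H x t) x)
    (hu' : ∀ t ∈ Ioc (0 : ℝ) T, ∀ x ∈ Ω, HasDerivAt (fun s => u x s) (u' x t) t)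
    (hreg : ContinuousOn (fun q : EuclideanSpace ℝ (Fin n) × ℝ =>
      (u q.1 q.2, G q.1 q.2, H q.1 q.2, u' q.1 q.2)) (Ω ×ˢ Ioc 0 T))
    -- the PDE uₜ - Δu = |∇u|^p on Ω × (0,T]
    (hPDE : ∀ t ∈ Ioc (0 : ℝ) T, ∀ x ∈ Ω,
      u' x t - ∑ i : Fin n, ⟪H x t (EuclideanSpace.single i (1 : ℝ)),
        EuclideanSpace.single i (1 : ℝ)⟫ = ‖G x t‖ ^ p)
    -- a priori bounds: |uₜ| ≤ M on Ω × [T/2,T] and the Bernstein estimate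
    (M : ℝ) (hM : ∀ x ∈ Ω, ∀ t ∈ Icc (T / 2) T, |u' x t| ≤ M)
    (C₀ : ℝ) (hC₀ : ∀ x ∈ Ω, ∀ t ∈ Ico (0 : ℝ) T, ‖G x t‖ ≤ C₀ * ((δ x) ^ (-β) + 1))
    -- a ∈ ∂Ω is a gradient blow-up point:
    -- limsup of |∇u(x,t)| as t → T⁻, x → a equals ∞
    (a : EuclideanSpace ℝ (Fin n)) (ha : a ∈ frontier Ω)
    (hGBU : ∀ K : ℝ, ∀ η > 0, ∃ x ∈ Ω, ∃ t ∈ Ioo (T - η) T,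
      0 < t ∧ dist x a < η ∧ K ≤ ‖G x t‖)
    :
    ∀ ε > 0, ∃ η > 0, ∀ x ∈ Ωδ, dist x a < η →
      ∀ t ∈ Ioo (T - η) T,
        |⟪H x t (ν x), ν x⟫ + ⟪G x t, ν x⟫ ^ p| ≤ ε * ⟪G x t, ν x⟫ ^ p := by
  classical
  obtain ⟨β0, β1, β2⟩ := beta_pos hp hβ
  have hdpos : ∀ y ∈ Ω, 0 < δ y := by
    intro y hy
    rw [hδ]
    apply (isClosed_frontier.notMem_iff_infDist_pos ⟨a, ha⟩).1
    intro h1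
    rw [hΩo.frontier_eq] at h1
    exact h1.2 hy
  -- geometry
  have hgi : ∀ b ∈ frontier Ω, ∀ y, _ := fun b hb y =>
    geo_int (Ω := Ω) (b := b) (ν := ν b) (r := δ₀ / 2) (by positivity) (hν1 b hb).1
      ((hν1 b hb).2 (δ₀ / 2) ⟨by positivity, by linarith⟩).1
      (by rw [← hδ]; exact ((hν1 b hb).2 (δ₀ / 2) ⟨by positivity, by linarith⟩).2) y
  set κ1 := 1 / (2 * (δ₀ / 2)) with hκ1
  have hκ10 : 0 < κ1 := by positivity
  obtain ⟨f, U, hU, hf, hf0, hfΩ, hfb⟩ := hΩc2 a ha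
  obtain ⟨κ2, hκ2, rg2, hrg2, hext⟩ := geo_ext ha (fun b hb => (hν1 b hb).1)
    (fun b hb y => (hgi b hb y).1) hκ10 hU hf hf0 hfΩ hfb
  set κ := max κ1 κ2 with hκ
  set rg := min rg2 (min δ₀ 1) with hrg
  have hκ0 : 0 < κ := lt_of_lt_of_le hκ10 (le_max_left _ _)
  have hrg0 : 0 < rg := by positivity
  have rg1 : rg ≤ rg2 := min_le_left _ _
  have rg3 : rg ≤ δ₀ := (min_le_right _ _).trans (min_le_left _ _)
  have rg4 : rg ≤ 1 := (min_le_right _ _).trans (min_le_right _ _)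
  have k1le : ∀ x : ℝ, 0 ≤ x → κ1 * x ≤ κ * x := fun x hx =>
    mul_le_mul_of_nonneg_right (le_max_left _ _) hx
  have k2le : ∀ x : ℝ, 0 ≤ x → κ2 * x ≤ κ * x := fun x hx =>
    mul_le_mul_of_nonneg_right (le_max_right _ _) hx
  have hδa : ∀ y, δ y ≤ dist y a := fun y => by rw [hδ]; exact infDist_le_dist_of_mem ha
  have geo : Geo Ω δ ν a κ rg :=
    { op := hΩo
      dd := hδ
      ha := ha
      hκ := hκ0
      hrg := hrg0
      nrm := fun b hb => (hν1 b hb).1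
      int := fun b hb y h => (hgi b hb y).1 (lt_of_le_of_lt (k1le _ (sq_nonneg _)) h)
      dlow := fun b hb y => by
        have h1 := (hgi b hb y).2
        have h2 := k1le (‖y - b‖ ^ 2) (sq_nonneg _)
        rw [hδ]
        linarith
      ext := fun b hb hba y hy hyb => by
        have h1 := hext b hb (by linarith) y hy (by linarith)
        have h2 := k2le (‖y - b‖ ^ 2) (sq_nonneg _)
        rw [hδ]
        linarith
      foot := fun y hy hya => by
        have hyΩ : y ∈ Ωδ := by
          rw [hΩδ]
          exact ⟨hy, by linarith [hδa y]⟩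
        obtain ⟨p1, p2, p3⟩ := hP y hyΩ
        obtain ⟨v1, v2⟩ := hν2 y hyΩ
        refine ⟨P y, p1, ?_, v1⟩
        have := geo_foot hδ (hdpos y hy) p1 p2 (by rw [v1]; exact (hν1 _ p1).1) v2
        rwa [v1] at this
      ray := fun b hb s hs hsr => (hν1 b hb).2 s ⟨hs, by linarith⟩ }
  -- constants
  set C := 2 * |C₀| + 1 with hC
  have hC0 : 0 < C := by positivity
  set C1 := C / (1 - β) with hC1
  have hb1 : 0 < 1 - β := by linarith
  have hC10 : 0 < C1 := by positivity
  have hCC1 : C ≤ C1 := by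
    rw [hC1, le_div_iff₀ hb1]
    nlinarith
  have hgr : ∀ y ∈ Ω, δ y < 1 → ∀ t ∈ Ico (0:ℝ) T, ‖G y t‖ ≤ C * δ y ^ (-β) := by
    intro y hy hy1 t ht
    have h0 := hdpos y hy
    have h1 : 1 ≤ δ y ^ (-β) := Real.one_le_rpow_of_pos_of_le_one_of_nonpos h0 hy1.le (by linarith)
    have h2 := hC₀ y hy t ht
    have h3 := mul_le_mul_of_nonneg_right (le_abs_self C₀) (by linarith : 0 ≤ δ y ^ (-β) + 1)
    have h4 := mul_le_mul_of_nonneg_left h1 (abs_nonneg C₀)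
    rw [hC]
    nlinarith
  have htr : ∀ y ∈ Ω, ∀ t ∈ Ioc (0:ℝ) T,
      u' y t - LinearMap.trace ℝ _ (H y t : EuclideanSpace ℝ (Fin n) →ₗ[ℝ] EuclideanSpace ℝ (Fin n))
        = ‖G y t‖ ^ p := by
    intro y hy t ht
    rw [trace_std]
    exact hPDE t ht y hy
  have hM' : ∀ x ∈ Ω, ∀ t ∈ Icc (T / 2) T, |u' x t| ≤ |M| := fun x hx t ht =>
    (hM x hx t ht).trans (le_abs_self M)
  have hjet : ∀ y ∈ Ω, ∀ t ∈ Ioc (0:ℝ) T, Jet (fun x => u x t) y (G y t)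
      (LinearMap.trace ℝ _ (H y t : EuclideanSpace ℝ (Fin n) →ₗ[ℝ] EuclideanSpace ℝ (Fin n))) := by
    intro y hy t ht
    refine ⟨fun z => G z t, H y t, ?_, rfl, hH t ht y hy, rfl⟩
    filter_upwards [hΩo.mem_nhds hy] with z hz
    exact hG2 t ht z hz
  have hpde : ∀ y ∈ Ω, ∀ t ∈ Ico (T / 2) T, |LinearMap.trace ℝ _ (H y t : EuclideanSpace ℝ (Fin n) →ₗ[ℝ]
      EuclideanSpace ℝ (Fin n)) + ‖G y t‖ ^ p| ≤ |M| := by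
    intro y hy t ht
    have h1 := htr y hy t ⟨by linarith [ht.1], ht.2.le⟩
    rw [← h1, add_sub_cancel]
    exact hM' y hy t ⟨ht.1, ht.2.le⟩
  have hcl : ∀ t ∈ Ico (0:ℝ) T, ContinuousOn (fun y => u y t) (closure Ω) := by
    intro t ht
    exact hu_cont.comp (f := fun y => (y, t)) (by fun_prop) (fun y hy => ⟨hy, ht.1, ht.2.le⟩)
  have hGl : ∀ t ∈ Ico (0:ℝ) T, ContinuousOn (fun y => G y t) (closure Ω) := by
    intro t ht
    exact hG_cont.comp (f := fun y => (y, t)) (by fun_prop) (fun y hy => ⟨hy, ht⟩)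
  have hcpt : IsCompact (closure Ω) := hΩb.isCompact_closure
  have sl : ∀ t ∈ Ico (T / 2) T, Slice p β |M| C1 κ rg Ω δ ν a (fun y => u y t) (fun y => G y t) := by
    intro t ht
    have ht0 : t ∈ Ico (0:ℝ) T := ⟨by linarith [ht.1], ht.2⟩
    have ht1 : t ∈ Ioc (0:ℝ) T := ⟨by linarith [ht.1], ht.2.le⟩
    exact
      { geo := geo
        hp := hp
        hβ := hβ
        hM := abs_nonneg M
        hC := hC10
        jet := fun y hy => ⟨_, hjet y hy t ht1, hpde y hy t ht⟩
        gc := (hGl t ht0).mono subset_closure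
        grad := fun y hy hya => by
          have h0 := hdpos y hy
          refine (hgr y hy (by linarith [hδa y]) t ht0).trans ?_
          exact mul_le_mul_of_nonneg_right hCC1 (by positivity)
        ub := fun y hy hya => by
          have h0 := hdpos y hy
          have hyd : δ y < rg := by linarith [hδa y]
          obtain ⟨b, hb, hyb, -⟩ := geo.foot y hy hya
          have hr := fun s hs hsd => geo.ray b hb s hs hsd
          have hnb := geo.nrm b hb
          have key := int_ray (C := C) β0 β1 (w := fun s : ℝ => u (b + s • ν b) t)
            (w' := fun s : ℝ => ⟪G (b + s • ν b) t, ν b⟫) h0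
            ((hcl t ht0).comp (by fun_prop) (by
              intro s hs
              rcases eq_or_lt_of_le hs.1 with h | h
              · rw [← h]; simpa using hb.1
              · exact subset_closure (hr s h (by linarith [hs.2])).1))
            (by simpa using hu_bd b hb t ⟨ht0.1, ht.2.le⟩)
            (by
              intro s h1 h2
              have h5 := hG2 t ht1 _ (hr s h1 (by linarith)).1
              have h6 : HasDerivAt (fun s : ℝ => b + s • ν b) (ν b) s := by
                simpa using ((hasDerivAt_id s).smul_const (ν b)).const_add b
              have := h5.hasFDerivAt.comp_hasDerivAt s h6
              exact this.congr_deriv (by simp))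
            (by
              intro s h1 h2
              obtain ⟨r1, r2⟩ := hr s h1 (by linarith)
              have h3 := hgr _ r1 (by rw [r2]; linarith) t ht0
              rw [r2] at h3
              have h4 := abs_real_inner_le_norm (G (b + s • ν b) t) (ν b)
              rw [hnb, mul_one] at h4
              exact h4.trans h3)
          simp only [← hyb] at key
          exact key
        cont := hcl t ht0
        bd := fun b hb => hu_bd b hb t ⟨ht0.1, ht.2.le⟩
        fin := by
          obtain ⟨B, hB⟩ := hcpt.exists_bound_of_continuousOn (hGl t ht0)
          exact ⟨B, fun y hy => hB y (subset_closure hy)⟩ }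
  have sol : Sol p β |M| C1 κ rg T Ω δ ν a u G H :=
    { hT := hT
      sl := sl
      par := by
        have hsub : Ω ×ˢ Ioo 0 T ⊆ Ω ×ˢ Ioc 0 T := prod_mono le_rfl Ioo_subset_Ioc_self
        refine ⟨(hreg.mono hsub).fst, (hreg.mono hsub).snd.fst, ?_⟩
        rintro y t ⟨hy, ht⟩
        have ht1 : t ∈ Ioc (0:ℝ) T := Ioo_subset_Ioc_self ht
        exact ⟨_, _, hjet y hy t ht1, hu' t ht1 y hy, htr y hy t ht1⟩
      lip := by
        intro y hy s hs t ht
        have := Convex.norm_image_sub_le_of_norm_hasDerivWithin_le (s := Icc (T / 2) T)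
          (f := fun s => u y s) (f' := fun s => u' y s) (C := |M|)
          (fun r hr => (hu' r ⟨by linarith [hr.1], hr.2⟩ y hy).hasDerivWithinAt)
          (fun r hr => by rw [Real.norm_eq_abs]; exact hM' y hy r hr) (convex_Icc _ _)
          (Ico_subset_Icc_self hs) (Ico_subset_Icc_self ht)
        simpa only [Real.norm_eq_abs] using this
      hH := fun y hy t ht => hH t (Ioo_subset_Ioc_self ht) y hy
      pde := hpde
      gbu := by
        intro K η hη
        obtain ⟨x, hx, t, ht, -, hxa, hK⟩ := hGBU K η hη
        exact ⟨x, hx, t, ht, hxa, hK⟩ }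
  intro ε hε
  obtain ⟨η, hη, h⟩ := lemFinal sol hε
  refine ⟨η, hη, fun x hx hxa t ht => h x ?_ hxa t ht⟩
  rw [hΩδ] at hx
  exact hx.1
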